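/- arXiv:2410.01693 — 10 statements merged into one kernel-verified Lean document; each statement's English description precedes it below -/
import Mathlib

section
/- Let m ≥ 1 be an integer and let f : [0,∞) × [0,∞)^m → [0,∞) be a non-negative locally Carathéodory function. Suppose there exist an integer k with 0 ≤ k ≤ m−1, a locally integrable function q : [0,∞) → [0,∞), and a non-decreasing continuous function h : [0,∞) → [0,∞) with h(s) > 0 for all s > 0, such that f(t, x_0, …, x_{m−1}) ≤ q(t) h(x_k) for almost all t ∈ [0,∞) and all x_i ∈ [0,∞), i = 0, …, m−1. If ∫_1^∞ h(s)^{−1/(m−k)} s^{1/(m−k)−1} ds = ∞, then for every choice of initial values a_0, …, a_{m−1} ≥ 0 the Cauchy problem w^{(m)} = f(t, w, …, w^{(m−1)}), w^{(i)}(0) = a_i (i = 0, …, m−1), has a global solution, i.e. a solution on the whole interval [0,∞). -/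
open MeasureTheory Set Filter

noncomputable section

/-- `u : Fin m → ℝ → ℝ` is the vector of derivatives `w, w', …, w^{(m-1)}` of a solution
`w = u 0` of the ODE `w^{(m)} = f (t, w, …, w^{(m-1)})` on the set `S` (typically
`Set.Ico 0 T` or `Set.Ici 0`).  Local absolute continuity of each `w^{(i)}` together with
the a.e. differential equation is encoded by the equivalent integral identities. -/
def IsSolutionOn (m : ℕ) (f : ℝ → (Fin m → ℝ) → ℝ) (u : Fin m → ℝ → ℝ) (S : Set ℝ) : Prop :=
  (∀ (i : ℕ) (hi : i + 1 < m), ∀ t ∈ S,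
      u ⟨i, Nat.lt_of_succ_lt hi⟩ t
        = u ⟨i, Nat.lt_of_succ_lt hi⟩ 0 + ∫ τ in (0:ℝ)..t, u ⟨i + 1, hi⟩ τ)
  ∧ (∀ t ∈ S, IntervalIntegrable (fun τ => f τ (fun j => u j τ)) volume 0 t)
  ∧ (∀ (hm : 0 < m), ∀ t ∈ S,
      u ⟨m - 1, Nat.sub_lt hm Nat.one_pos⟩ t
        = u ⟨m - 1, Nat.sub_lt hm Nat.one_pos⟩ 0 + ∫ τ in (0:ℝ)..t, f τ (fun j => u j τ))

/-- `f : [0,∞) × ℝ^m → ℝ` is a locally Carathéodory function: measurable in `t` for each `x`,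
continuous in `x` for a.e. `t ≥ 0`, and bounded on compact sets by locally integrable
functions of `t`. -/
def IsLocallyCaratheodory (m : ℕ) (f : ℝ → (Fin m → ℝ) → ℝ) : Prop :=
  (∀ x : Fin m → ℝ, Measurable fun t => f t x)
  ∧ (∀ᵐ t ∂(volume.restrict (Ici (0:ℝ))), Continuous fun x : Fin m → ℝ => f t x)
  ∧ (∀ K R : ℝ, ∃ g : ℝ → ℝ, IntegrableOn g (Icc 0 K) volume ∧
      ∀ᵐ t ∂(volume.restrict (Icc (0:ℝ) K)),
        ∀ x : Fin m → ℝ, (∀ i, |x i| ≤ R) → |f t x| ≤ g t)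

open scoped Topology

/-- The `j`-fold iterated primitive of `W` based at `-1`. -/
def iteratedPrimitive (W : ℝ → ℝ) : ℕ → ℝ → ℝ
  | 0 => W
  | j + 1 => fun t => ∫ s in (-1:ℝ)..t, iteratedPrimitive W j s

section IteratedPrimitive

variable {W : ℝ → ℝ}

theorem continuous_iteratedPrimitive (hW : Continuous W) (j : ℕ) :
    Continuous (iteratedPrimitive W j) := by
  induction j with
  | zero => exact hW
  | succ j ih => exact intervalIntegral.continuous_primitive (fun a b => ih.intervalIntegrable a b) _

theorem hasDerivAt_iteratedPrimitive (hW : Continuous W) (j : ℕ) (t : ℝ) :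
    HasDerivAt (iteratedPrimitive W (j + 1)) (iteratedPrimitive W j t) t :=
  (continuous_iteratedPrimitive hW j).integral_hasStrictDerivAt _ _ |>.hasDerivAt

theorem iteratedPrimitive_nonneg (hW0 : ∀ t, 0 ≤ W t) (j : ℕ) {t : ℝ} (ht : -1 ≤ t) :
    0 ≤ iteratedPrimitive W j t := by
  induction j generalizing t with
  | zero => exact hW0 t
  | succ j ih => exact intervalIntegral.integral_nonneg ht fun s hs => ih hs.1

theorem iteratedPrimitive_succ_eq_add (hW : Continuous W) (j : ℕ) (t : ℝ) :
    iteratedPrimitive W (j + 1) t =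
      iteratedPrimitive W (j + 1) 0 + ∫ s in (0:ℝ)..t, iteratedPrimitive W j s := by
  have hi := fun a b => (continuous_iteratedPrimitive hW j).intervalIntegrable (μ := volume) a b
  exact (intervalIntegral.integral_add_adjacent_intervals (hi _ _) (hi _ _)).symm

theorem iteratedPrimitive_monotoneOn (hW : Continuous W) (hW0 : ∀ t, 0 ≤ W t)
    (hmono : Monotone W) (j : ℕ) : MonotoneOn (iteratedPrimitive W j) (Ici (-1)) := by
  cases j with
  | zero => exact hmono.monotoneOn _
  | succ j =>
    refine monotoneOn_of_hasDerivWithinAt_nonneg (convex_Ici _)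
      (continuous_iteratedPrimitive hW _).continuousOn
      (fun t _ => (hasDerivAt_iteratedPrimitive hW j t).hasDerivWithinAt) fun t ht => ?_
    rw [interior_Ici] at ht
    exact iteratedPrimitive_nonneg hW0 j (le_of_lt ht)

theorem iteratedPrimitive_of_const {A : ℝ} (hA : ∀ t ≤ 0, W t = A) (j : ℕ) {t : ℝ}
    (ht : t ≤ 0) : iteratedPrimitive W j t = A * (t + 1) ^ j / j.factorial := by
  induction j generalizing t with
  | zero => simp [iteratedPrimitive, hA t ht]
  | succ j ih =>
    have h1 : iteratedPrimitive W (j + 1) t =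
        ∫ s in (-1:ℝ)..t, A * (s + 1) ^ j / j.factorial := by
      refine intervalIntegral.integral_congr fun s hs => ih ?_
      exact hs.2.trans (max_le (by norm_num) ht)
    rw [h1, intervalIntegral.integral_div, intervalIntegral.integral_const_mul,
      intervalIntegral.integral_comp_add_right (fun s => s ^ j), integral_pow, Nat.factorial_succ]
    push_cast
    field_simp
    simp

/-- A Landau-type inequality between consecutive iterated primitives of a monotone function. -/
theorem iteratedPrimitive_landau (j : ℕ) : ∃ c : ℝ, 0 ≤ c ∧ ∀ W : ℝ → ℝ, Continuous W →
    (∀ t, 0 ≤ W t) → Monotone W → ∀ b t, -1 ≤ t → t ≤ b →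
      iteratedPrimitive W j t ^ (j + 1) ≤ c * W b * iteratedPrimitive W (j + 1) t ^ j := by
  induction j with
  | zero =>
    refine ⟨1, zero_le_one, fun W _ _ hmono b t _ htb => ?_⟩
    simpa [iteratedPrimitive] using hmono htb
  | succ j ih =>
    obtain ⟨c, hc, ih⟩ := ih
    set p : ℝ := 1 / ((j : ℝ) + 1) with hp
    have hp0 : 0 < p := by positivity
    have hjp : ((j : ℝ) + 1) * p = 1 := by rw [hp]; field_simp
    refine ⟨(1 + p) ^ (j + 1) * c, by positivity, fun W hW hW0 hmono b t ht htb => ?_⟩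
    have hM : 0 ≤ c * W b := mul_nonneg hc (hW0 b)
    set D : ℝ := (c * W b) ^ p with hD
    have hD0 : 0 ≤ D := Real.rpow_nonneg hM _
    have hDpow : D ^ (j + 1) = c * W b := by
      rw [hD, ← Real.rpow_natCast, ← Real.rpow_mul hM]
      push_cast
      rw [mul_comm p, hjp, Real.rpow_one]
    set x := iteratedPrimitive W (j + 1) with hx
    set y := iteratedPrimitive W (j + 2) with hy
    have hx0 : ∀ s, -1 ≤ s → 0 ≤ x s := fun s hs => iteratedPrimitive_nonneg hW0 _ hs
    have hy0 : ∀ s, -1 ≤ s → 0 ≤ y s := fun s hs => iteratedPrimitive_nonneg hW0 _ hs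
    have hkey : ∀ s, -1 ≤ s → s ≤ b → x s ^ p * iteratedPrimitive W j s ≤ D * x s := by
      intro s hs hsb
      refine le_of_pow_le_pow_left₀ (n := j + 1) (by omega)
        (mul_nonneg hD0 (hx0 s hs)) ?_
      have : (x s ^ p) ^ (j + 1) = x s := by
        rw [← Real.rpow_natCast, ← Real.rpow_mul (hx0 s hs)]
        push_cast
        rw [mul_comm p, hjp, Real.rpow_one]
      rw [mul_pow, mul_pow, this, hDpow, pow_succ' (x s)]
      have := mul_le_mul_of_nonneg_left (ih W hW hW0 hmono b s hs hsb) (hx0 s hs)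
      linarith
    have hmon : MonotoneOn (fun s => (1 + p) * D * y s - x s ^ (1 + p)) (Icc (-1) b) := by
      have hd : ∀ s, HasDerivAt (fun s => (1 + p) * D * y s - x s ^ (1 + p))
          ((1 + p) * D * x s - iteratedPrimitive W j s * (1 + p) * x s ^ (1 + p - 1)) s := by
        intro s
        exact ((hasDerivAt_iteratedPrimitive hW (j + 1) s).const_mul _).sub
          ((hasDerivAt_iteratedPrimitive hW j s).rpow_const (Or.inr (by linarith)))
      refine monotoneOn_of_hasDerivWithinAt_nonneg (convex_Icc _ _)
        (fun s _ => (hd s).continuousAt.continuousWithinAt)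
        (fun s _ => (hd s).hasDerivWithinAt) fun s hs => ?_
      rw [interior_Icc] at hs
      rw [add_sub_cancel_left]
      have := hkey s hs.1.le hs.2.le
      nlinarith
    have h1 := hmon (left_mem_Icc.2 (ht.trans htb)) ⟨ht, htb⟩ ht
    have hx1 : x (-1) = 0 := intervalIntegral.integral_same
    have hy1 : y (-1) = 0 := intervalIntegral.integral_same
    simp only [hx1, hy1, Real.zero_rpow (by positivity : (1 + p) ≠ 0), mul_zero, sub_zero] at h1
    have h2 : x t ^ (1 + p) ≤ (1 + p) * D * y t := by linarith
    have h3 := pow_le_pow_left₀ (Real.rpow_nonneg (hx0 t ht) _) h2 (j + 1)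
    have h4 : (x t ^ (1 + p)) ^ (j + 1) = x t ^ (j + 1 + 1) := by
      rw [← Real.rpow_natCast, ← Real.rpow_mul (hx0 t ht), ← Real.rpow_natCast]
      congr 1
      push_cast
      linarith
    rw [h4, mul_pow, mul_pow, hDpow] at h3
    linarith

/-- The growth of the root of an iterated primitive of a monotone function `W` over `[s, t]` is
controlled by `W t` and `t - s`. -/
theorem iteratedPrimitive_rpow_le (N : ℕ) : ∃ C : ℝ, 0 ≤ C ∧ ∀ W : ℝ → ℝ, Continuous W →
    (∀ t, 0 ≤ W t) → Monotone W → (∀ t, 0 ≤ t → 0 < iteratedPrimitive W N t) →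
    ∀ s t, 0 ≤ s → s ≤ t → iteratedPrimitive W N t ^ (1 / ((N : ℝ) + 1)) ≤
      iteratedPrimitive W N s ^ (1 / ((N : ℝ) + 1)) +
        C * (W t * (t - s) ^ N) ^ (1 / ((N : ℝ) + 1)) := by
  cases N with
  | zero =>
    refine ⟨1, zero_le_one, fun W _ hW0 _ _ s t _ _ => ?_⟩
    simpa [iteratedPrimitive] using hW0 s
  | succ N =>
    obtain ⟨c, hc, hl⟩ := iteratedPrimitive_landau N
    refine ⟨c ^ (1 / (((N + 1 : ℕ) : ℝ) + 1)), by positivity,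
      fun W hW hW0 hmono hpos s t hs hst => ?_⟩
    set p : ℝ := 1 / ((N : ℝ) + 1) with hp
    set r : ℝ := 1 / (((N + 1 : ℕ) : ℝ) + 1) with hr
    set z := iteratedPrimitive W (N + 1) with hz
    have hp0 : 0 < p := by positivity
    have hp1 : p ≤ 1 := by
      rw [hp, div_le_one (by positivity)]
      linarith [(Nat.cast_nonneg N : (0:ℝ) ≤ N)]
    have hNp : ((N : ℝ) + 1) * p = 1 := by rw [hp]; field_simp
    have hr0 : 0 < r := by positivity
    have hNr : ((N : ℝ) + 1) * r = 1 - r := by rw [hr]; push_cast; field_simp; ring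
    have hM : 0 ≤ c * W t := mul_nonneg hc (hW0 t)
    set D : ℝ := (c * W t) ^ p with hD
    have hD0 : 0 ≤ D := Real.rpow_nonneg hM _
    have hDpow : D ^ (N + 1) = c * W t := by
      rw [hD, ← Real.rpow_natCast, ← Real.rpow_mul hM]
      push_cast
      rw [mul_comm p, hNp, Real.rpow_one]
    have hkey : ∀ τ, 0 ≤ τ → τ ≤ t → iteratedPrimitive W N τ * z τ ^ (p - 1) ≤ D := by
      intro τ hτ hτt
      have hzp := hpos τ hτ
      refine le_of_pow_le_pow_left₀ (n := N + 1) (by omega) hD0 ?_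
      have h1 : (z τ ^ (p - 1)) ^ (N + 1) * z τ ^ N = 1 := by
        rw [← Real.rpow_natCast, ← Real.rpow_mul hzp.le, ← Real.rpow_natCast,
          ← Real.rpow_add hzp]
        have : (p - 1) * ((N + 1 : ℕ) : ℝ) + (N : ℝ) = 0 := by push_cast; linarith
        rw [this, Real.rpow_zero]
      rw [mul_pow, hDpow]
      have h2 := mul_le_mul_of_nonneg_right (hl W hW hW0 hmono t τ (by linarith) hτt)
        (by positivity : 0 ≤ (z τ ^ (p - 1)) ^ (N + 1))
      calc _ ≤ _ := h2
        _ = c * W t * ((z τ ^ (p - 1)) ^ (N + 1) * z τ ^ N) := by rw [hz]; ring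
        _ = _ := by rw [h1, mul_one]
    have hmon : MonotoneOn (fun τ => D * τ - z τ ^ p) (Icc s t) := by
      have hd : ∀ τ ∈ Icc s t, HasDerivAt (fun τ => D * τ - z τ ^ p)
          (D * 1 - iteratedPrimitive W N τ * p * z τ ^ (p - 1)) τ := by
        intro τ hτ
        exact ((hasDerivAt_id τ).const_mul _).sub ((hasDerivAt_iteratedPrimitive hW N τ).rpow_const
          (Or.inl (hpos τ (hs.trans hτ.1)).ne'))
      refine monotoneOn_of_hasDerivWithinAt_nonneg (convex_Icc _ _)
        (fun τ hτ => (hd τ hτ).continuousAt.continuousWithinAt)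
        (fun τ hτ => (hd τ (interior_subset hτ)).hasDerivWithinAt) fun τ hτ => ?_
      rw [interior_Icc] at hτ
      have := hkey τ (hs.trans hτ.1.le) hτ.2.le
      have h0 : 0 ≤ iteratedPrimitive W N τ * z τ ^ (p - 1) :=
        mul_nonneg (iteratedPrimitive_nonneg hW0 N (by linarith [hτ.1]))
          (Real.rpow_nonneg (hpos τ (hs.trans hτ.1.le)).le _)
      nlinarith
    have h1 : z t ^ p ≤ z s ^ p + D * (t - s) := by
      have := hmon (left_mem_Icc.2 hst) (right_mem_Icc.2 hst) hst
      simp only at this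
      linarith
    have hzs := (hpos s hs).le
    have hzt := (hpos t (hs.trans hst)).le
    have hts : 0 ≤ t - s := sub_nonneg.2 hst
    have hroot : p * (1 - r) = r := by
      rw [← hNr]; linear_combination r * hNp
    have h2 := Real.rpow_le_rpow (Real.rpow_nonneg hzt p) h1 (by nlinarith : 0 ≤ 1 - r)
    have h3 := Real.rpow_add_le_add_rpow (p := 1 - r) (Real.rpow_nonneg hzs p)
      (mul_nonneg hD0 hts) (by nlinarith) (by linarith)
    have h4 : (D * (t - s)) ^ (1 - r) = c ^ r * (W t * (t - s) ^ (N + 1)) ^ r := by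
      rw [← Real.mul_rpow hc (mul_nonneg (hW0 t) (pow_nonneg hts _)), ← mul_assoc, ← hDpow,
        ← mul_pow, ← Real.rpow_natCast, ← Real.rpow_mul (mul_nonneg hD0 hts)]
      push_cast
      rw [hNr]
    rw [← Real.rpow_mul hzt, hroot] at h2
    rw [← Real.rpow_mul hzs, hroot, h4] at h3
    exact h2.trans h3

end IteratedPrimitive

/-- A bound on increments of `H` over two successive doublings of `W` gives a global bound of `H`. -/
theorem le_add_of_doubling {W H Q : ℝ → ℝ} {A K C T : ℝ} (hA : 0 < A) (hC : 0 ≤ C)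
    (hW : Continuous W) (hW0 : W 0 = A) (hQm : Monotone Q)
    (hQ0 : ∀ t, 0 ≤ t → 0 ≤ Q t)
    (hbase : ∀ t, 0 ≤ t → t ≤ T → W t ≤ 4 * A → H t ≤ K)
    (hinc : ∀ r s t, 0 ≤ r → r ≤ s → s ≤ t → t ≤ T → W t = 4 * (W s - W r) →
      H t ≤ H s + C * (Q s - Q r + (t - s)))
    {t : ℝ} (ht0 : 0 ≤ t) (htT : t ≤ T) : H t ≤ K + C * (Q t + t) := by
  have half : ∀ t, 0 ≤ t → 2 * A ≤ W t → ∃ s, 0 ≤ s ∧ s ≤ t ∧ W t = 2 * W s := by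
    intro t ht h
    obtain ⟨s, hs, hs'⟩ := intermediate_value_Icc ht hW.continuousOn
      (show W t / 2 ∈ Icc (W 0) (W t) from ⟨by linarith, by linarith⟩)
    exact ⟨s, hs.1, hs.2, by linarith⟩
  have key : ∀ j : ℕ, ∀ s t, 0 ≤ s → s ≤ t → t ≤ T → W t = 2 * W s → W t ≤ 2 ^ j * (4 * A) →
      H t ≤ K + C * (Q s + t) := by
    intro j
    induction j with
    | zero =>
      intro s t hs hst htT _ hj
      have h1 := hbase t (hs.trans hst) htT (by linarith)
      have h2 := mul_nonneg hC (add_nonneg (hQ0 s hs) (hs.trans hst))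
      linarith
    | succ j ih =>
      intro s t hs hst htT hts hj
      by_cases h4 : W t ≤ 4 * A
      · have h1 := hbase t (hs.trans hst) htT h4
        have h2 := mul_nonneg hC (add_nonneg (hQ0 s hs) (hs.trans hst))
        linarith
      · push Not at h4
        obtain ⟨r, hr, hrs, hsr⟩ := half s hs (by linarith)
        have h1 := ih r s hr hrs (hst.trans htT) hsr (by rw [pow_succ] at hj; linarith)
        have h2 := hinc r s t hr hrs hst htT (by linarith)
        linarith
  by_cases h4 : W t ≤ 4 * A
  · have h1 := hbase t ht0 htT h4
    have h2 := mul_nonneg hC (add_nonneg (hQ0 t ht0) ht0)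
    linarith
  · push Not at h4
    obtain ⟨s, hs, hst, hts⟩ := half t ht0 (by linarith)
    obtain ⟨j, hj⟩ := pow_unbounded_of_one_lt (W t / (4 * A)) (one_lt_two)
    rw [div_lt_iff₀ (by linarith)] at hj
    have h1 := key j s t hs hst htT hts hj.le
    have h2 := mul_le_mul_of_nonneg_left (hQm hst) hC
    linarith

theorem intervalIntegral_rpow_weight_le {h : ℝ → ℝ} (hh_mono : MonotoneOn h (Ici 0))
    (hh_pos : ∀ s, 0 < s → 0 < h s) {p x y : ℝ} (hp : 0 < p) (hx : 0 < x) (hxy : x ≤ y)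
    (hint : IntervalIntegrable (fun s => h s ^ (-p) * s ^ (p - 1)) volume x y) :
    ∫ s in x..y, h s ^ (-p) * s ^ (p - 1) ≤ h x ^ (-p) * ((y ^ p - x ^ p) / p) := by
  have h1 : ∫ s in x..y, s ^ (p - 1) = (y ^ p - x ^ p) / p := by
    rw [integral_rpow (Or.inl (by linarith)), sub_add_cancel]
  rw [← h1, ← intervalIntegral.integral_const_mul]
  refine intervalIntegral.integral_mono_on hxy hint
    ((intervalIntegral.intervalIntegrable_rpow' (by linarith)).const_mul _) fun s hs => ?_
  have hs0 : 0 < s := hx.trans_le hs.1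
  refine mul_le_mul_of_nonneg_right ?_ (Real.rpow_nonneg hs0.le _)
  exact Real.rpow_le_rpow_of_nonpos (hh_pos x hx) (hh_mono hx.le hs0.le hs.1) (by linarith)

theorem exists_le_of_intervalIntegral_le {φ : ℝ → ℝ} (hφ : ∀ s, 1 ≤ s → 0 ≤ φ s)
    (hφc : ContinuousOn φ (Ici 1)) (hdiv : ∫⁻ s in Ici (1:ℝ), ENNReal.ofReal (φ s) = ⊤) (K : ℝ) :
    ∃ B, ∀ x, 1 ≤ x → ∫ s in (1:ℝ)..x, φ s ≤ K → x ≤ B := by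
  by_contra! hcon
  have hint : ∀ x, 1 ≤ x → IntervalIntegrable φ volume 1 x := fun x hx =>
    (hφc.mono (by rw [uIcc_of_le hx]; exact Icc_subset_Ici_self)).intervalIntegrable
  have hle : ∀ x, 1 ≤ x → ∫ s in (1:ℝ)..x, ‖φ s‖ ≤ K := by
    intro x hx
    obtain ⟨y, hy, hyK, hxy⟩ := hcon x
    refine le_trans ?_ hyK
    have h1 : ∫ s in (1:ℝ)..x, ‖φ s‖ = ∫ s in (1:ℝ)..x, φ s := by
      refine intervalIntegral.integral_congr fun s hs => ?_
      rw [uIcc_of_le hx] at hs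
      exact Real.norm_of_nonneg (hφ s hs.1)
    rw [h1]
    refine intervalIntegral.integral_mono_interval le_rfl hx hxy.le ?_ (hint y hy)
    filter_upwards [ae_restrict_mem measurableSet_Ioc] with s hs
    exact hφ s hs.1.le
  have hI : IntegrableOn φ (Ioi 1) := by
    refine integrableOn_Ioi_of_intervalIntegral_norm_bounded K 1 (fun x => ?_) tendsto_id ?_
    · rcases le_total 1 x with hx | hx
      · exact (intervalIntegrable_iff_integrableOn_Ioc_of_le hx).1 (hint x hx)
      · simp [Ioc_eq_empty_of_le hx]
    · filter_upwards [eventually_ge_atTop 1] with x hx using hle x hx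
  rw [← integrableOn_Ici_iff_integrableOn_Ioi] at hI
  exact hI.lintegral_lt_top.ne hdiv

/-- A priori bound for systems of iterated integral inequalities with right-hand side `q * h`. -/
theorem exists_bound_of_integral_inequalities (N : ℕ) {h q : ℝ → ℝ}
    (hh_mono : MonotoneOn h (Ici 0)) (hh_cont : ContinuousOn h (Ici 0))
    (hh_nonneg : ∀ s, 0 ≤ s → 0 ≤ h s) (hh_pos : ∀ s, 0 < s → 0 < h s)
    (hq : ∀ a b, IntervalIntegrable q volume a b) (hq0 : ∀ t, 0 ≤ q t)
    (hdiv : ∫⁻ s in Ici (1:ℝ), ENNReal.ofReal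
      (h s ^ (-(1 / ((N : ℝ) + 1))) * s ^ (1 / ((N : ℝ) + 1) - 1)) = ⊤)
    (A T : ℝ) (hT : 0 ≤ T) :
    ∃ B, ∀ Y : ℕ → ℝ → ℝ, (∀ j, Continuous (Y j)) → (∀ j t, 0 ≤ t → 0 ≤ Y j t) →
      (∀ j < N, ∀ t, 0 ≤ t → Y (j + 1) t ≤ A + ∫ s in (0:ℝ)..t, Y j s) →
      (∀ t, 0 ≤ t → Y 0 t ≤ A + ∫ s in (0:ℝ)..t, q s * h (Y N s)) →
      ∀ t ∈ Icc 0 T, Y N t ≤ B := by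
  set p : ℝ := 1 / ((N : ℝ) + 1) with hp
  have hp0 : 0 < p := by positivity
  have hNp : p * ((N : ℝ) + 1) = 1 := by rw [hp]; field_simp
  set φ : ℝ → ℝ := fun s => h s ^ (-p) * s ^ (p - 1) with hφ
  have hφc : ContinuousOn φ (Ici 1) := by
    refine ContinuousOn.mul ?_ ?_
    · exact (hh_cont.mono (Ici_subset_Ici.2 zero_le_one)).rpow_const
        fun s hs => Or.inl (hh_pos s (zero_lt_one.trans_le hs)).ne'
    · exact continuousOn_id.rpow_const fun s hs => Or.inl (zero_lt_one.trans_le hs).ne'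
  have hφ0 : ∀ s, 1 ≤ s → 0 ≤ φ s := fun s hs =>
    mul_nonneg (Real.rpow_nonneg (hh_nonneg s (zero_le_one.trans hs)) _)
      (Real.rpow_nonneg (zero_le_one.trans hs) _)
  have hφi : ∀ x y, 1 ≤ x → x ≤ y → IntervalIntegrable φ volume x y := fun x y hx hxy =>
    (hφc.mono (by rw [uIcc_of_le hxy]; exact fun s hs => hx.trans hs.1)).intervalIntegrable
  obtain ⟨C, hC, hroot⟩ := iteratedPrimitive_rpow_le N
  set a : ℝ := max A 1 with ha
  have ha1 : 1 ≤ a := le_max_right _ _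
  set A' : ℝ := a * N.factorial with hA'
  have hA'0 : 0 < A' := by positivity
  set K : ℝ := (∫ s in (1:ℝ)..a, φ s) + h a ^ (-p) * (C * (4 * A' * T ^ N) ^ p / p) with hK
  set C' : ℝ := 4 * C / p with hC'
  have hC'0 : 0 ≤ C' := by positivity
  obtain ⟨B, hB⟩ := exists_le_of_intervalIntegral_le hφ0 hφc hdiv
    (K + C' * ((∫ s in (0:ℝ)..T, q s) + T))
  refine ⟨B, fun Y hYc hY0 hYs hYz => ?_⟩
  -- the majorant and its iterated primitives
  set g : ℝ → ℝ := fun s => q s * h (max (Y N s) 0) with hg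
  have hg0 : ∀ s, 0 ≤ g s := fun s => mul_nonneg (hq0 s) (hh_nonneg _ (le_max_right _ _))
  have hgi : ∀ x y, IntervalIntegrable g volume x y := fun x y =>
    (hq x y).mul_continuousOn (hh_cont.comp_continuous ((hYc N).max continuous_const)
      fun s => mem_Ici.2 (le_max_right _ _)).continuousOn
  have hmaxc : Continuous fun t : ℝ => max t 0 := by fun_prop
  have hmaxm : Monotone fun t : ℝ => max t 0 := fun s t hst => max_le_max_right 0 hst
  have hprim : ∀ f : ℝ → ℝ, (∀ s, 0 ≤ f s) → (∀ x y, IntervalIntegrable f volume x y) →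
      Monotone fun t => ∫ s in (0:ℝ)..max t 0, f s := fun f hf hfi s t hst =>
    intervalIntegral.integral_mono_interval le_rfl (le_max_right _ _) (hmaxm hst)
      (.of_forall hf) (hfi _ _)
  set W : ℝ → ℝ := fun t => A' + ∫ s in (0:ℝ)..max t 0, g s with hWdef
  have hWc : Continuous W :=
    continuous_const.add ((intervalIntegral.continuous_primitive hgi 0).comp hmaxc)
  have hWm : Monotone W := fun s t hst => add_le_add_right (hprim g hg0 hgi hst) _
  have hWneg : ∀ t ≤ 0, W t = A' := fun t ht => by simp [hWdef, max_eq_right ht]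
  have hW0 : ∀ t, 0 ≤ W t := fun t =>
    add_nonneg hA'0.le (intervalIntegral.integral_nonneg (le_max_right _ _) fun s _ => hg0 s)
  set Z := iteratedPrimitive W with hZ
  have hZ0 (j : ℕ) : Z j 0 = A' / j.factorial := by
    rw [hZ, iteratedPrimitive_of_const hWneg j le_rfl]; simp
  have hZN : Z N 0 = a := by
    rw [hZ0, hA']; field_simp
  have hYZ (j : ℕ) (hj : j ≤ N) : ∀ t, 0 ≤ t → Y j t ≤ Z j t := by
    have hAj (j : ℕ) (hj : j ≤ N) : A ≤ Z j 0 := by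
      refine (le_max_left A 1).trans ?_
      rw [hZ0, hA', le_div_iff₀ (by positivity)]
      refine mul_le_mul_of_nonneg_left ?_ (by positivity)
      exact_mod_cast Nat.factorial_le hj
    induction j with
    | zero =>
      intro t ht
      refine (hYz t ht).trans ?_
      simp only [hZ, iteratedPrimitive, hWdef, max_eq_left ht]
      have : ∫ s in (0:ℝ)..t, q s * h (Y N s) = ∫ s in (0:ℝ)..t, g s := by
        refine intervalIntegral.integral_congr fun s hs => ?_
        rw [uIcc_of_le ht] at hs
        simp only [hg, max_eq_left (hY0 N s hs.1)]
      rw [this]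
      have := hAj 0 hj
      rw [hZ0] at this
      simpa using this
    | succ j ih =>
      intro t ht
      refine (hYs j hj t ht).trans ?_
      rw [hZ, iteratedPrimitive_succ_eq_add hWc]
      refine add_le_add (hAj _ hj) (intervalIntegral.integral_mono_on ht
        ((hYc j).intervalIntegrable _ _)
        ((continuous_iteratedPrimitive hWc j).intervalIntegrable _ _)
        fun s hs => ih (by omega) s hs.1)
  have hZm : MonotoneOn (Z N) (Ici 0) :=
    (iteratedPrimitive_monotoneOn hWc hW0 hWm N).mono (Ici_subset_Ici.2 (by norm_num))
  have hZa : ∀ t, 0 ≤ t → a ≤ Z N t := fun t ht => hZN ▸ hZm (mem_Ici.2 le_rfl) ht ht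
  have hZ1 : ∀ t, 0 ≤ t → 1 ≤ Z N t := fun t ht => ha1.trans (hZa t ht)
  set H : ℝ → ℝ := fun t => ∫ s in (1:ℝ)..Z N t, φ s with hH
  set Q : ℝ → ℝ := fun t => ∫ s in (0:ℝ)..max t 0, q s with hQ
  have hHinc : ∀ s t, 0 ≤ s → s ≤ t →
      H t ≤ H s + h (Z N s) ^ (-p) * (C * (W t * (t - s) ^ N) ^ p / p) := by
    intro s t hs hst
    have ht := hs.trans hst
    have hzst := hZm hs ht hst
    have h1 : H t = H s + ∫ r in (Z N s)..(Z N t), φ r :=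
      (intervalIntegral.integral_add_adjacent_intervals (hφi _ _ le_rfl (hZ1 s hs))
        (hφi _ _ (hZ1 s hs) hzst)).symm
    rw [h1]
    refine add_le_add_right ((intervalIntegral_rpow_weight_le hh_mono hh_pos hp0
      (zero_lt_one.trans_le (hZ1 s hs)) hzst (hφi _ _ (hZ1 s hs) hzst)).trans ?_) _
    refine mul_le_mul_of_nonneg_left ?_
      (Real.rpow_nonneg (hh_nonneg _ (zero_le_one.trans (hZ1 s hs))) _)
    refine div_le_div_of_nonneg_right ?_ hp0.le
    have := hroot W hWc hW0 hWm (fun t ht => zero_lt_one.trans_le (hZ1 t ht)) s t hs hst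
    linarith
  have hHT : ∀ t, 0 ≤ t → t ≤ T → H t ≤ K + C' * (Q t + t) := by
    intro t ht htT
    refine le_add_of_doubling (W := W) hA'0 hC'0 hWc (hWneg 0 le_rfl) (hprim q hq0 hq)
      (fun t ht => intervalIntegral.integral_nonneg (le_max_right _ _) fun s _ => hq0 s)
      ?_ ?_ ht htT
    · intro t ht htT hWt
      refine (hHinc 0 t le_rfl ht).trans ?_
      have hH0 : H 0 = ∫ s in (1:ℝ)..a, φ s := by simp only [hH, hZN]
      rw [hH0, hZN, hK, sub_zero]
      have := hW0 t
      have := hh_nonneg a (zero_le_one.trans ha1)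
      gcongr
    · intro r s t hr hrs hst htT hWt
      have hs := hr.trans hrs
      have hx := hh_pos _ (zero_lt_one.trans_le (hZ1 s hs))
      have hQrs : Q s - Q r = ∫ τ in r..s, q τ := by
        simp only [hQ, max_eq_left hr, max_eq_left hs]
        exact intervalIntegral.integral_interval_sub_left (hq _ _) (hq _ _)
      have hW1 : W s - W r ≤ h (Z N s) * (Q s - Q r) := by
        rw [hQrs, ← intervalIntegral.integral_const_mul]
        simp only [hWdef, max_eq_left hr, max_eq_left hs, add_sub_add_left_eq_sub]
        rw [intervalIntegral.integral_interval_sub_left (hgi _ _) (hgi _ _)]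
        refine intervalIntegral.integral_mono_on hrs (hgi _ _) ((hq _ _).const_mul _)
          fun τ hτ => ?_
        simp only [hg]
        rw [mul_comm]
        have hτ0 := hr.trans hτ.1
        refine mul_le_mul_of_nonneg_right (hh_mono (mem_Ici.2 (le_max_right _ _))
          (zero_le_one.trans (hZ1 s hs)) (max_le ?_ (zero_le_one.trans (hZ1 s hs)))) (hq0 τ)
        exact (hYZ N le_rfl τ hτ0).trans (hZm hτ0 hs hτ.2)
      have hΔ : 0 ≤ Q s - Q r := sub_nonneg.2 (hprim q hq0 hq hrs)
      have hts : 0 ≤ t - s := sub_nonneg.2 hst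
      refine (hHinc s t hs hst).trans (add_le_add_right ?_ _)
      set δ := Q s - Q r + (t - s) with hδ
      have hδ0 : 0 ≤ δ := add_nonneg hΔ hts
      have h1 : W t * (t - s) ^ N ≤ h (Z N s) * (4 * δ) ^ (N + 1) := by
        have e1 : (t - s) ^ N ≤ (4 * δ) ^ N := pow_le_pow_left₀ hts (by linarith) N
        calc W t * (t - s) ^ N ≤ (4 * (h (Z N s) * δ)) * (4 * δ) ^ N := by
              refine mul_le_mul ?_ e1 (by positivity) (by positivity)
              have := mul_le_mul_of_nonneg_left (show Q s - Q r ≤ δ by linarith) hx.le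
              linarith
          _ = _ := by ring
      have h2 := Real.rpow_le_rpow (mul_nonneg (hW0 t) (pow_nonneg hts _)) h1 hp0.le
      have h3 : (h (Z N s) * (4 * δ) ^ (N + 1)) ^ p = h (Z N s) ^ p * (4 * δ) := by
        rw [Real.mul_rpow hx.le (by positivity), ← Real.rpow_natCast (4 * δ),
          ← Real.rpow_mul (by positivity)]
        push_cast
        rw [mul_comm _ p, hNp, Real.rpow_one]
      rw [h3] at h2
      calc h (Z N s) ^ (-p) * (C * (W t * (t - s) ^ N) ^ p / p)
          ≤ h (Z N s) ^ (-p) * (C * (h (Z N s) ^ p * (4 * δ)) / p) := by gcongr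
        _ = (h (Z N s) ^ (-p) * h (Z N s) ^ p) * (C' * δ) := by rw [hC']; ring
        _ = C' * δ := by rw [← Real.rpow_add hx, neg_add_cancel, Real.rpow_zero, one_mul]
  intro t ht
  refine (hYZ N le_rfl t ht.1).trans (hB _ (hZ1 t ht.1) ((hHT t ht.1 ht.2).trans ?_))
  have hQT : Q t ≤ ∫ s in (0:ℝ)..T, q s := by
    have := hprim q hq0 hq ht.2
    simpa only [hQ, max_eq_left hT] using this
  have := ht.2
  gcongr

theorem intervalIntegrable_delay {E : Type*} [NormedAddCommGroup E] [NormedSpace ℝ E]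
    [FiniteDimensional ℝ E] [MeasurableSpace E] [BorelSpace E] {F : ℝ → E → E}
    (hF_meas : ∀ x, Measurable fun t => F t x) (hF_cont : ∀ t, Continuous (F t))
    (hF_bdd : ∀ R : ℝ, ∃ g : ℝ → ℝ, (∀ a b, IntervalIntegrable g volume a b) ∧
      ∀ t x, ‖x‖ ≤ R → ‖F t x‖ ≤ g t)
    {v : ℝ → E} (hv : Continuous v) (a b : ℝ) :
    IntervalIntegrable (fun s => F s (v s)) volume a b := by
  have hmeas : StronglyMeasurable (fun s => F s (v s)) := by
    have h1 : StronglyMeasurable (Function.uncurry fun (x : E) (t : ℝ) => F t x) :=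
      stronglyMeasurable_uncurry_of_continuous_of_stronglyMeasurable
        (fun t => hF_cont t) (fun x => (hF_meas x).stronglyMeasurable)
    exact h1.comp_measurable (hv.measurable.prodMk measurable_id)
  obtain ⟨R, hR⟩ := (isCompact_uIcc (a := a) (b := b)).exists_bound_of_continuousOn hv.continuousOn
  obtain ⟨g, hg, hgb⟩ := hF_bdd R
  refine (hg a b).mono_fun' hmeas.aestronglyMeasurable ?_
  filter_upwards [ae_restrict_mem measurableSet_uIoc] with s hs
  exact hgb _ _ (hR s (uIoc_subset_uIcc hs))

/-- Tonelli's approximate solutions: the equation with delayed argument is globally solvable. -/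
theorem exists_delay_solution {E : Type*} [NormedAddCommGroup E] [NormedSpace ℝ E]
    [FiniteDimensional ℝ E] [MeasurableSpace E] [BorelSpace E] {F : ℝ → E → E}
    (hF_meas : ∀ x, Measurable fun t => F t x) (hF_cont : ∀ t, Continuous (F t))
    (hF_bdd : ∀ R : ℝ, ∃ g : ℝ → ℝ, (∀ a b, IntervalIntegrable g volume a b) ∧
      ∀ t x, ‖x‖ ≤ R → ‖F t x‖ ≤ g t)
    (a : E) {ε : ℝ} (hε : 0 < ε) :
    ∃ u : ℝ → E, Continuous u ∧
      ∀ t, u t = a + ∫ s in (0:ℝ)..max t 0, F s (u (max (s - ε) 0)) := by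
  let Φ : (ℝ → E) → ℝ → E := fun v t => a + ∫ s in (0:ℝ)..max t 0, F s (v (max (s - ε) 0))
  let U : ℕ → ℝ → E := fun n => Φ^[n] fun _ => a
  have hU_succ (n : ℕ) (t : ℝ) :
      U (n + 1) t = a + ∫ s in (0:ℝ)..max t 0, F s (U n (max (s - ε) 0)) := by
    simp only [U, Function.iterate_succ_apply', Φ]
  have hU_cont (n : ℕ) : Continuous (U n) := by
    induction n with
    | zero => exact continuous_const
    | succ n ih =>
      rw [funext (hU_succ n)]
      have hi := fun a b => intervalIntegrable_delay hF_meas hF_cont hF_bdd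
        (v := fun s => U n (max (s - ε) 0)) (by fun_prop) a b
      exact continuous_const.add
        ((intervalIntegral.continuous_primitive hi 0).comp
          (by fun_prop : Continuous fun t : ℝ => max t 0))
  have hU_stab (n : ℕ) : ∀ t ∈ Icc 0 (n * ε), U (n + 1) t = U n t := by
    induction n with
    | zero =>
      intro t ht
      have : t = 0 := le_antisymm (by simpa using ht.2) ht.1
      subst this
      simp [hU_succ, U]
    | succ n ih =>
      intro t ht
      rw [hU_succ, hU_succ n]
      congr 1
      refine intervalIntegral.integral_congr fun s hs => ?_
      rw [max_eq_left ht.1, uIcc_of_le ht.1] at hs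
      have h2 := ht.2
      push_cast at h2
      have : max (s - ε) 0 ∈ Icc 0 (n * ε) :=
        ⟨le_max_right _ _, max_le (by linarith [hs.2]) (by positivity)⟩
      simp only [ih _ this]
  have hU_stab' (n k : ℕ) : ∀ t ∈ Icc 0 (n * ε), U (n + k) t = U n t := by
    induction k with
    | zero => intros; rfl
    | succ k ih =>
      intro t ht
      rw [← add_assoc, hU_stab (n + k) t ⟨ht.1, ht.2.trans ?_⟩, ih t ht]
      push_cast
      nlinarith [(Nat.cast_nonneg k : (0:ℝ) ≤ k)]
  let N : ℝ → ℕ := fun t => ⌈t / ε⌉₊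
  have hN (t : ℝ) : t ≤ N t * ε := (div_le_iff₀ hε).1 (Nat.le_ceil _)
  let V : ℝ → E := fun t => U (N (max t 0)) (max t 0)
  have hV (n : ℕ) (t : ℝ) (ht : t ≤ n * ε) : V t = U n (max t 0) := by
    have h1 : N (max t 0) ≤ n := by
      refine Nat.ceil_le.2 ((div_le_iff₀ hε).2 (max_le ht (by positivity)))
    obtain ⟨k, rfl⟩ := Nat.exists_eq_add_of_le h1
    exact (hU_stab' _ k _ ⟨le_max_right _ _, hN _⟩).symm
  refine ⟨V, continuous_iff_continuousAt.2 fun t => ?_, fun t => ?_⟩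
  · have h1 : V =ᶠ[𝓝 t] fun s => U (N (t + 1)) (max s 0) := by
      filter_upwards [Iio_mem_nhds (lt_add_one t)] with s hs
      exact hV _ _ ((le_of_lt hs).trans (hN _))
    exact (((hU_cont _).comp (by fun_prop : Continuous fun s : ℝ => max s 0)).continuousAt).congr
      h1.symm
  · have h0 : t ≤ ((N t + 1 : ℕ) : ℝ) * ε := by
      push_cast; nlinarith [hN t]
    rw [hV _ t h0, hU_succ, max_eq_left (le_max_right t 0)]
    congr 1
    refine intervalIntegral.integral_congr fun s hs => ?_
    rw [uIcc_of_le (le_max_right _ _)] at hs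
    have h3 : max (s - ε) 0 ≤ N t * ε := by
      refine max_le ?_ (by positivity)
      rcases le_total t 0 with h | h
      · rw [max_eq_right h] at hs
        have : (0:ℝ) ≤ N t * ε := by positivity
        linarith [hs.2]
      · rw [max_eq_left h] at hs
        linarith [hs.2, hN t]
    simp only [hV _ _ h3, max_eq_left (le_max_right (s - ε) 0)]

/-- Families of curves with a common bound and a common modulus of continuity on each half-line
`(-∞, n]` are compact in the compact-open topology. -/
theorem isCompact_of_modulus {E : Type*} [NormedAddCommGroup E] [NormedSpace ℝ E]
    [FiniteDimensional ℝ E] {R : ℝ → ℝ} {G : ℕ → ℝ → ℝ} (hG : ∀ n, Continuous (G n)) :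
    IsCompact {u : C(ℝ, E) | (∀ t, ‖u t‖ ≤ R t) ∧
      ∀ (n : ℕ) (s t : ℝ), s ≤ n → t ≤ n → ‖u t - u s‖ ≤ |G n t - G n s|} := by
  have : ProperSpace E := FiniteDimensional.proper ℝ E
  have key : ∀ t₀ : ℝ, ∀ e > 0, ∃ d ∈ 𝓝 t₀, ∀ t ∈ d, ∀ u : ℝ → E,
      (∀ (n : ℕ) (s t : ℝ), s ≤ n → t ≤ n → ‖u t - u s‖ ≤ |G n t - G n s|) →
        dist (u t₀) (u t) < e := by
    intro t₀ e he
    obtain ⟨n, hn⟩ := exists_nat_gt t₀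
    refine ⟨_, inter_mem (Iio_mem_nhds hn)
      ((hG n).continuousAt.eventually (Metric.ball_mem_nhds (G n t₀) he)), fun t ht u hu => ?_⟩
    rw [dist_comm, dist_eq_norm]
    exact (hu n t₀ t hn.le (le_of_lt ht.1)).trans_lt ht.2
  refine ArzelaAscoli.isCompact_of_equicontinuous _ ?_ ?_
  · have : ContinuousMap.toFun '' {u : C(ℝ, E) | (∀ t, ‖u t‖ ≤ R t) ∧
      ∀ (n : ℕ) (s t : ℝ), s ≤ n → t ≤ n → ‖u t - u s‖ ≤ |G n t - G n s|} =
        (Set.pi univ fun t => Metric.closedBall (0 : E) (R t)) ∩ {u : ℝ → E |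
          ∀ (n : ℕ) (s t : ℝ), s ≤ n → t ≤ n → ‖u t - u s‖ ≤ |G n t - G n s|} := by
      ext u
      constructor
      · rintro ⟨v, ⟨h1, h2⟩, rfl⟩
        exact ⟨fun t _ => by simpa using h1 t, h2⟩
      · rintro ⟨h1, h2⟩
        have hc : Continuous u := by
          refine continuous_iff_continuousAt.2 fun t₀ => Metric.tendsto_nhds.2 fun e he => ?_
          obtain ⟨d, hd, h⟩ := key t₀ e he
          filter_upwards [hd] with t ht
          rw [dist_comm]
          exact h t ht u h2
        exact ⟨⟨u, hc⟩, ⟨fun t => by simpa using h1 t (mem_univ t), h2⟩, rfl⟩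
    rw [this]
    refine (isCompact_univ_pi fun t => isCompact_closedBall _ _).inter_right ?_
    simp only [ofPred_forall]
    refine isClosed_iInter fun n => isClosed_iInter fun s => isClosed_iInter fun t =>
      isClosed_iInter fun _ => isClosed_iInter fun _ => ?_
    exact isClosed_le (by fun_prop) continuous_const
  · intro t₀
    rw [Metric.equicontinuousAt_iff_right]
    intro e he
    obtain ⟨d, hd, h⟩ := key t₀ e he
    filter_upwards [hd] with t ht u
    exact h t ht u u.2.2

/-- Carathéodory's existence theorem on `[0, ∞)`, assuming an a priori bound for the solutions of
the equations with delayed argument. -/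
theorem exists_global_solution {E : Type*} [NormedAddCommGroup E] [NormedSpace ℝ E]
    [FiniteDimensional ℝ E] [MeasurableSpace E] [BorelSpace E] {F : ℝ → E → E}
    (hF_meas : ∀ x, Measurable fun t => F t x) (hF_cont : ∀ t, Continuous (F t))
    (hF_bdd : ∀ R : ℝ, ∃ g : ℝ → ℝ, (∀ a b, IntervalIntegrable g volume a b) ∧
      ∀ t x, ‖x‖ ≤ R → ‖F t x‖ ≤ g t)
    (a : E)
    (hap : ∀ T : ℝ, 0 ≤ T → ∃ R, ∀ ε > 0, ∀ u : ℝ → E, Continuous u →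
      (∀ t, 0 ≤ t → u t = a + ∫ s in (0:ℝ)..t, F s (u (max (s - ε) 0))) →
      ∀ t ∈ Icc 0 T, ‖u t‖ ≤ R) :
    ∃ u : ℝ → E, Continuous u ∧ ∀ t, 0 ≤ t → u t = a + ∫ s in (0:ℝ)..t, F s (u s) := by
  choose! R hR using hap
  choose g hg hgb using hF_bdd
  choose u hu_cont hu using fun p : ℕ => exists_delay_solution hF_meas hF_cont
    (fun R => ⟨g R, hg R, hgb R⟩) a (ε := 1 / ((p : ℝ) + 1)) (by positivity)
  have hu_eq (p : ℕ) (t : ℝ) (ht : 0 ≤ t) :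
      u p t = a + ∫ s in (0:ℝ)..t, F s (u p (max (s - 1 / ((p : ℝ) + 1)) 0)) := by
    rw [hu p t, max_eq_left ht]
  have hu_max (p : ℕ) (t : ℝ) : u p t = u p (max t 0) := by
    rw [hu p t, hu p (max t 0), max_eq_left (le_max_right t 0)]
  have hu_bdd (p : ℕ) {T t : ℝ} (hT : 0 ≤ T) (ht : t ≤ T) : ‖u p t‖ ≤ R T := by
    rw [hu_max]
    exact hR T hT _ (by positivity) (u p) (hu_cont p) (hu_eq p) _ ⟨le_max_right _ _, max_le ht hT⟩
  have hF_le (p : ℕ) {T s : ℝ} (hT : 0 ≤ T) (hs : s ≤ T) :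
      ‖F s (u p (max (s - 1 / ((p : ℝ) + 1)) 0))‖ ≤ g (R T) s := by
    refine hgb _ _ _ (hu_bdd p hT (max_le ?_ hT))
    have : (0 : ℝ) < 1 / ((p : ℝ) + 1) := by positivity
    linarith
  have hint (p : ℕ) (b c : ℝ) : IntervalIntegrable
      (fun s => F s (u p (max (s - 1 / ((p : ℝ) + 1)) 0))) volume b c :=
    intervalIntegrable_delay hF_meas hF_cont (fun R => ⟨g R, hg R, hgb R⟩)
      (v := fun s => u p (max (s - 1 / ((p : ℝ) + 1)) 0))
      ((hu_cont p).comp (by fun_prop)) b c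
  let G : ℕ → ℝ → ℝ := fun n t => ∫ s in (0:ℝ)..max t 0, g (R n) s
  have hG (n : ℕ) : Continuous (G n) :=
    (intervalIntegral.continuous_primitive (hg _) 0).comp
      (by fun_prop : Continuous fun t : ℝ => max t 0)
  have hmod (p n : ℕ) (s t : ℝ) (hs : s ≤ n) (ht : t ≤ n) :
      ‖u p t - u p s‖ ≤ |G n t - G n s| := by
    have hn : (0 : ℝ) ≤ n := by positivity
    rw [hu p t, hu p s, add_sub_add_left_eq_sub,
      intervalIntegral.integral_interval_sub_left (hint _ _ _) (hint _ _ _),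
      intervalIntegral.integral_interval_sub_left (hg _ _ _) (hg _ _ _)]
    refine intervalIntegral.norm_integral_le_abs_of_norm_le ?_ (hg _ _ _)
    filter_upwards [ae_restrict_mem measurableSet_uIoc] with r hr
    exact hF_le p hn (hr.2.trans (max_le (max_le hs hn) (max_le ht hn)))
  obtain ⟨v, -, φ, hφ, hlim⟩ := (isCompact_of_modulus (R := fun t => R (max t 0)) hG).tendsto_subseq
    (x := fun p => (⟨u p, hu_cont p⟩ : C(ℝ, E)))
    (fun p => ⟨fun t => hu_bdd p (le_max_right _ _) (le_max_left _ _), hmod p⟩)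
  rw [ContinuousMap.tendsto_iff_tendstoLocallyUniformly] at hlim
  have hε : Tendsto (fun p => 1 / ((φ p : ℝ) + 1)) atTop (𝓝 0) :=
    tendsto_one_div_add_atTop_nhds_zero_nat.comp hφ.tendsto_atTop
  refine ⟨v, v.continuous, fun t ht => ?_⟩
  have h1 : Tendsto (fun p => u (φ p) t) atTop (𝓝 (v t)) :=
    TendstoLocallyUniformly.tendsto_comp hlim v.continuous.continuousAt tendsto_const_nhds
  have h2 : Tendsto (fun p => a + ∫ s in (0:ℝ)..t,
      F s (u (φ p) (max (s - 1 / ((φ p : ℝ) + 1)) 0))) atTop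
      (𝓝 (a + ∫ s in (0:ℝ)..t, F s (v s))) := by
    refine tendsto_const_nhds.add
      (intervalIntegral.tendsto_integral_filter_of_dominated_convergence (g (R t))
        (.of_forall fun p => ?_)
        (.of_forall fun p => .of_forall fun s hs => ?_) (hg _ _ _) (.of_forall fun s hs => ?_))
    · exact (intervalIntegrable_iff.1 (hint _ _ _)).aestronglyMeasurable
    · rw [uIoc_of_le ht] at hs
      exact hF_le _ ht hs.2
    · rw [uIoc_of_le ht] at hs
      refine ((hF_cont s).tendsto _).comp ?_
      refine TendstoLocallyUniformly.tendsto_comp hlim v.continuous.continuousAt ?_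
      have : Tendsto (fun p => max (s - 1 / ((φ p : ℝ) + 1)) 0) atTop (𝓝 (max (s - 0) 0)) :=
        (tendsto_const_nhds.sub hε).max tendsto_const_nhds
      rwa [sub_zero, max_eq_left hs.1.le] at this
  refine tendsto_nhds_unique h1 (h2.congr fun p => (hu_eq _ t ht).symm)

/-- The first-order vector field of the scalar equation `w^{(m)} = f (t, w, …, w^{(m-1)})`, with
the lower-order components truncated to be nonnegative. -/
def companionField {m : ℕ} (f : ℝ → (Fin m → ℝ) → ℝ) (t : ℝ) (x : Fin m → ℝ) : Fin m → ℝ :=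
  fun i => if hi : (i : ℕ) + 1 < m then max (x ⟨i + 1, hi⟩) 0 else f t x

section CompanionField

variable {m : ℕ} {f : ℝ → (Fin m → ℝ) → ℝ}

theorem companionField_nonneg (hf0 : ∀ t x, 0 ≤ f t x) (t : ℝ) (x : Fin m → ℝ) (i : Fin m) :
    0 ≤ companionField f t x i := by
  unfold companionField
  split_ifs
  exacts [le_max_right _ _, hf0 t x]

theorem measurable_companionField (hf_meas : ∀ x, Measurable fun t => f t x) (x : Fin m → ℝ) :
    Measurable fun t => companionField f t x := by
  refine measurable_pi_iff.2 fun i => ?_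
  unfold companionField
  split_ifs
  exacts [measurable_const, hf_meas x]

theorem continuous_companionField (hf_cont : ∀ t, Continuous (f t)) (t : ℝ) :
    Continuous (companionField f t) := by
  refine continuous_pi fun i => ?_
  unfold companionField
  split_ifs
  exacts [by fun_prop, hf_cont t]

theorem companionField_bound {k : Fin m} {q h : ℝ → ℝ} (hf0 : ∀ t x, 0 ≤ f t x)
    (hf_le : ∀ t x, f t x ≤ q t * h (max (x k) 0)) (hh_mono : MonotoneOn h (Ici 0))
    (hh_nonneg : ∀ s, 0 ≤ s → 0 ≤ h s)
    (hq : ∀ a b, IntervalIntegrable q volume a b) (hq0 : ∀ t, 0 ≤ q t) (R : ℝ) :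
    ∃ g : ℝ → ℝ, (∀ a b, IntervalIntegrable g volume a b) ∧
      ∀ t x, ‖x‖ ≤ R → ‖companionField f t x‖ ≤ g t := by
  refine ⟨fun t => q t * h (max R 0) + max R 0,
    fun a b => ((hq a b).mul_const _).add intervalIntegrable_const, fun t x hx => ?_⟩
  have hR0 : 0 ≤ max R 0 := le_max_right _ _
  have hx' (j : Fin m) : max (x j) 0 ≤ max R 0 :=
    max_le_max_right 0 ((le_abs_self _).trans ((norm_le_pi_norm x j).trans hx))
  have hqh := mul_nonneg (hq0 t) (hh_nonneg _ hR0)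
  refine (pi_norm_le_iff_of_nonneg (by positivity)).2 fun i => ?_
  rw [Real.norm_of_nonneg (companionField_nonneg hf0 t x i)]
  unfold companionField
  split_ifs
  · linarith [hx' ⟨i + 1, by assumption⟩]
  · have := mul_le_mul_of_nonneg_left (hh_mono (le_max_right (x k) 0) hR0 (hx' k)) (hq0 t)
    linarith [hf_le t x]

theorem integral_system_apply {F : ℝ → Fin m → ℝ}
    (hF : ∀ a b, IntervalIntegrable F volume a b) {a : Fin m → ℝ} {u : ℝ → Fin m → ℝ}
    (hu : ∀ t, 0 ≤ t → u t = a + ∫ s in (0:ℝ)..t, F s) (i : Fin m) {t : ℝ} (ht : 0 ≤ t) :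
    u t i = a i + ∫ s in (0:ℝ)..t, F s i := by
  have := (ContinuousLinearMap.proj (R := ℝ) (φ := fun _ : Fin m => ℝ) i).intervalIntegral_comp_comm
    (hF 0 t)
  simp only [ContinuousLinearMap.proj_apply] at this
  rw [hu t ht, Pi.add_apply, this]

theorem intervalIntegrable_apply {F : ℝ → Fin m → ℝ}
    (hF : ∀ a b, IntervalIntegrable F volume a b) (i : Fin m) (b c : ℝ) :
    IntervalIntegrable (fun s => F s i) volume b c :=
  ⟨(hF b c).1.eval i, (hF b c).2.eval i⟩

theorem companionField_apriori {k : Fin m} {q h : ℝ → ℝ}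
    (hf_meas : ∀ x, Measurable fun t => f t x) (hf_cont : ∀ t, Continuous (f t))
    (hf0 : ∀ t x, 0 ≤ f t x) (hf_le : ∀ t x, f t x ≤ q t * h (max (x k) 0))
    (hh_mono : MonotoneOn h (Ici 0)) (hh_cont : ContinuousOn h (Ici 0))
    (hh_nonneg : ∀ s, 0 ≤ s → 0 ≤ h s) (hh_pos : ∀ s, 0 < s → 0 < h s)
    (hq : ∀ a b, IntervalIntegrable q volume a b) (hq0 : ∀ t, 0 ≤ q t)
    (hdiv : ∫⁻ s in Ici (1:ℝ), ENNReal.ofReal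
      (h s ^ (-(1 / (((m - 1 - k : ℕ) : ℝ) + 1))) * s ^ (1 / (((m - 1 - k : ℕ) : ℝ) + 1) - 1)) = ⊤)
    {a : Fin m → ℝ} (ha : ∀ i, 0 ≤ a i) {T : ℝ} (hT : 0 ≤ T) :
    ∃ R, ∀ ε > 0, ∀ u : ℝ → Fin m → ℝ, Continuous u →
      (∀ t, 0 ≤ t → u t = a + ∫ s in (0:ℝ)..t, companionField f s (u (max (s - ε) 0))) →
      ∀ t ∈ Icc 0 T, ‖u t‖ ≤ R := by
  have hkm := k.2
  obtain ⟨B, hB⟩ := exists_bound_of_integral_inequalities (m - 1 - k) hh_mono hh_cont hh_nonneg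
    hh_pos hq hq0 hdiv ‖a‖ T hT
  set B' := max B 0 with hB'
  have hB'0 : 0 ≤ B' := le_max_right _ _
  set r₀ : ℝ := ‖a‖ + h B' * ∫ s in (0:ℝ)..T, q s with hr₀
  have hr₀0 : 0 ≤ r₀ := add_nonneg (norm_nonneg _) (mul_nonneg (hh_nonneg _ hB'0)
    (intervalIntegral.integral_nonneg hT fun s _ => hq0 s))
  let r : ℕ → ℝ := fun n => n.rec r₀ fun _ x => ‖a‖ + T * x
  have hr_succ (n : ℕ) : r (n + 1) = ‖a‖ + T * r n := rfl
  have hr0 (n : ℕ) : 0 ≤ r n := by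
    induction n with
    | zero => exact hr₀0
    | succ n ih => rw [hr_succ]; positivity
  refine ⟨∑ n ∈ Finset.range m, r n, fun ε hε u huc hu t ht => ?_⟩
  have hFi : ∀ b c, IntervalIntegrable (fun s => companionField f s (u (max (s - ε) 0)))
      volume b c := fun b c =>
    intervalIntegrable_delay (measurable_companionField hf_meas)
      (continuous_companionField hf_cont)
      (companionField_bound hf0 hf_le hh_mono hh_nonneg hq hq0)
      (v := fun s => u (max (s - ε) 0)) (huc.comp (by fun_prop)) b c
  have hFii := intervalIntegrable_apply hFi
  have hF0 := fun s => companionField_nonneg hf0 s (u (max (s - ε) 0))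
  have huv := fun i t ht => integral_system_apply hFi hu i (t := t) ht
  have hu0 (i : Fin m) (t : ℝ) (ht : 0 ≤ t) : 0 ≤ u t i := by
    rw [huv i t ht]
    exact add_nonneg (ha i) (intervalIntegral.integral_nonneg ht fun s _ => hF0 s i)
  have hum (i : Fin m) : MonotoneOn (fun t => u t i) (Ici 0) := by
    intro s hs t ht hst
    simp only [huv i s hs, huv i t ht]
    exact add_le_add_right (intervalIntegral.integral_mono_interval le_rfl hs hst
      (.of_forall fun s => hF0 s i) (hFii i _ _)) _
  have hdelay (i : Fin m) (s : ℝ) (hs : 0 ≤ s) : u (max (s - ε) 0) i ≤ u s i :=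
    hum i (mem_Ici.2 (le_max_right _ _)) (mem_Ici.2 hs) (max_le (by linarith) hs)
  have ha' (i : Fin m) : a i ≤ ‖a‖ := (le_abs_self _).trans (norm_le_pi_norm a i)
  let Y : ℕ → ℝ → ℝ := fun j t => u t ⟨m - 1 - j, by omega⟩
  have hYc (j : ℕ) : Continuous (Y j) := (continuous_apply _).comp huc
  have hY0 (j : ℕ) (t : ℝ) (ht : 0 ≤ t) : 0 ≤ Y j t := hu0 _ t ht
  have hYs (j : ℕ) (hj : j + 1 < m) (t : ℝ) (ht : 0 ≤ t) :
      Y (j + 1) t ≤ ‖a‖ + ∫ s in (0:ℝ)..t, Y j s := by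
    simp only [Y]
    rw [huv _ t ht]
    refine add_le_add (ha' _) (intervalIntegral.integral_mono_on ht (hFii _ _ _)
      ((hYc j).intervalIntegrable _ _) fun s hs => ?_)
    have h1 : m - 1 - (j + 1) + 1 < m := by omega
    have h2 : (⟨m - 1 - (j + 1) + 1, h1⟩ : Fin m) = ⟨m - 1 - j, by omega⟩ :=
      Fin.ext (by simp only; omega)
    simp only [companionField, h1, dif_pos, h2]
    exact max_le (hdelay _ s hs.1) (hu0 _ s hs.1)
  have hYN : Y (m - 1 - k) = fun t => u t k := by
    funext t
    simp only [Y]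
    congr 1
    exact Fin.ext (by simp only; omega)
  have hqhi (t : ℝ) (ht : 0 ≤ t) :
      IntervalIntegrable (fun s => q s * h (u s k)) volume 0 t := by
    refine (hq 0 t).mul_continuousOn (hh_cont.comp ((continuous_apply k).comp huc).continuousOn ?_)
    rw [uIcc_of_le ht]
    exact fun s hs => hu0 k s hs.1
  have hYz (t : ℝ) (ht : 0 ≤ t) : Y 0 t ≤ ‖a‖ + ∫ s in (0:ℝ)..t, q s * h (u s k) := by
    simp only [Y]
    rw [huv _ t ht]
    refine add_le_add (ha' _) (intervalIntegral.integral_mono_on ht (hFii _ _ _) (hqhi t ht)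
      fun s hs => ?_)
    have h1 : ¬ (m - 1 - 0 + 1 < m) := by omega
    simp only [companionField, h1, dif_neg, not_false_eq_true]
    refine (hf_le _ _).trans (mul_le_mul_of_nonneg_left (hh_mono (mem_Ici.2 (le_max_right _ _))
      (mem_Ici.2 (hu0 k s hs.1)) (max_le (hdelay k s hs.1) (hu0 k s hs.1))) (hq0 s))
  have hk := hB Y hYc hY0 (fun j hj => hYs j (by omega)) (by rw [hYN]; exact hYz)
  rw [hYN] at hk
  have hYr (j : ℕ) (hj : j < m) : ∀ t ∈ Icc 0 T, Y j t ≤ r j := by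
    induction j with
    | zero =>
      intro t ht
      refine (hYz t ht.1).trans (add_le_add_right ?_ _)
      rw [← intervalIntegral.integral_const_mul]
      refine (intervalIntegral.integral_mono_on ht.1 (hqhi t ht.1) ((hq 0 t).const_mul (h B'))
        fun s hs => ?_).trans (intervalIntegral.integral_mono_interval le_rfl ht.1 ht.2
          (.of_forall fun s => mul_nonneg (hh_nonneg _ hB'0) (hq0 s)) ((hq 0 T).const_mul _))
      rw [mul_comm (h B')]
      exact mul_le_mul_of_nonneg_left (hh_mono (hu0 k s hs.1) hB'0
        ((hk s ⟨hs.1, hs.2.trans ht.2⟩).trans (le_max_left _ _))) (hq0 s)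
    | succ j ih =>
      intro t ht
      refine (hYs j hj t ht.1).trans (add_le_add_right ?_ _)
      refine (intervalIntegral.integral_mono_on ht.1 ((hYc j).intervalIntegrable _ _)
        intervalIntegrable_const
        fun s hs => ih (by omega) s ⟨hs.1, hs.2.trans ht.2⟩).trans ?_
      rw [intervalIntegral.integral_const, smul_eq_mul, sub_zero]
      exact mul_le_mul_of_nonneg_right ht.2 (hr0 j)
  refine (pi_norm_le_iff_of_nonneg (Finset.sum_nonneg fun n _ => hr0 n)).2 fun i => ?_
  rw [Real.norm_of_nonneg (hu0 i t ht.1)]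
  have hi := hYr (m - 1 - i) (by omega) t ht
  have : Y (m - 1 - i) t = u t i := by
    simp only [Y]
    congr 1
    exact Fin.ext (by simp only; omega)
  rw [this] at hi
  exact hi.trans (Finset.single_le_sum (fun n _ => hr0 n) (Finset.mem_range.2 (by omega)))

end CompanionField

/-- **Theorem 2.1.** If the locally Carathéodory nonnegative right-hand side `f`
satisfies `f (t, x₀, …, x_{m-1}) ≤ q (t) h (x_k)` and
`∫_1^∞ h(s)^{-1/(m-k)} s^{1/(m-k)-1} ds = ∞`, then the Cauchy problem
`w^{(m)} = f (t, w, …, w^{(m-1)})`, `w^{(i)}(0) = aᵢ ≥ 0`, has a global solution. -/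
theorem kiguradze_kvinikadze_exactness
    (m k : ℕ) (hm : 1 ≤ m) (hk : k < m)
    (f : ℝ → (Fin m → ℝ) → ℝ)
    (hf_car : IsLocallyCaratheodory m f)
    (hf_nonneg : ∀ t, 0 ≤ t → ∀ x : Fin m → ℝ, (∀ i, 0 ≤ x i) → 0 ≤ f t x)
    (q : ℝ → ℝ) (hq_loc : LocallyIntegrableOn q (Ici 0))
    (hq_nonneg : ∀ t, 0 ≤ t → 0 ≤ q t)
    (h : ℝ → ℝ) (hh_mono : MonotoneOn h (Ici 0)) (hh_cont : ContinuousOn h (Ici 0))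
    (hh_nonneg : ∀ s, 0 ≤ s → 0 ≤ h s) (hh_pos : ∀ s, 0 < s → 0 < h s)
    (hbound : ∀ᵐ t ∂(volume.restrict (Ici (0:ℝ))),
      ∀ x : Fin m → ℝ, (∀ i, 0 ≤ x i) → f t x ≤ q t * h (x ⟨k, hk⟩))
    (hdiv : ∫⁻ s in Ici (1:ℝ),
        ENNReal.ofReal (h s ^ (-(1:ℝ) / ((m:ℝ) - (k:ℝ))) * s ^ ((1:ℝ) / ((m:ℝ) - (k:ℝ)) - 1))
        = ⊤)
    (a : Fin m → ℝ) (ha : ∀ i, 0 ≤ a i) :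
    ∃ u : Fin m → ℝ → ℝ, IsSolutionOn m f u (Ici 0) ∧ ∀ i, u i 0 = a i := by
  have hN : ((m - 1 - k : ℕ) : ℝ) + 1 = (m : ℝ) - k := by
    have : m - 1 - k + 1 + k = m := by omega
    rw [eq_sub_iff_add_eq]
    exact_mod_cast this
  obtain ⟨G, hGae, hGm, hG⟩ :=
    ((ae_restrict_iff' measurableSet_Ici).1 (hbound.and hf_car.2.1)).exists_measurable_mem
  set S : Set ℝ := G ∩ Ici 0 with hS
  have hSm : MeasurableSet S := hGm.inter measurableSet_Ici
  set f' : ℝ → (Fin m → ℝ) → ℝ :=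
    fun t x => S.indicator (fun t => f t fun j => max (x j) 0) t with hf'
  set q' : ℝ → ℝ := (Ici 0).indicator q with hq'
  have hq'0 : ∀ t, 0 ≤ q' t := fun t => indicator_nonneg hq_nonneg t
  have hq'i : ∀ b c, IntervalIntegrable q' volume b c := fun b c => by
    rw [intervalIntegrable_iff]
    have h1 : IntegrableOn q (Icc 0 (max b c)) :=
      hq_loc.integrableOn_compact_subset Icc_subset_Ici_self isCompact_Icc
    have h2 : IntegrableOn q' (Iic (max b c)) := by
      rw [hq', integrableOn_indicator_iff measurableSet_Ici, Ici_inter_Iic]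
      exact h1
    exact h2.mono_set fun s hs => hs.2
  have hf'_meas : ∀ x, Measurable fun t => f' t x := fun x => (hf_car.1 _).indicator hSm
  have hf'_cont : ∀ t, Continuous (f' t) := fun t => by
    by_cases ht : t ∈ S
    · simp only [hf', indicator_of_mem ht]
      exact (hG t ht.1 ht.2).2.comp (by fun_prop)
    · simp only [hf', indicator_of_notMem ht]
      exact continuous_const
  have hf'0 : ∀ t x, 0 ≤ f' t x := fun t x =>
    indicator_nonneg (fun t ht => hf_nonneg t ht.2 _ fun i => le_max_right _ _) t
  have hf'_le : ∀ t x, f' t x ≤ q' t * h (max (x ⟨k, hk⟩) 0) := fun t x => by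
    by_cases ht : t ∈ S
    · simp only [hf', hq', indicator_of_mem ht, indicator_of_mem ht.2]
      exact (hG t ht.1 ht.2).1 _ fun i => le_max_right _ _
    · simp only [hf', indicator_of_notMem ht]
      exact mul_nonneg (hq'0 t) (hh_nonneg _ (le_max_right _ _))
  obtain ⟨u, huc, hu⟩ := exists_global_solution (measurable_companionField hf'_meas)
    (continuous_companionField hf'_cont)
    (companionField_bound hf'0 hf'_le hh_mono hh_nonneg hq'i hq'0) a fun T hT =>
      companionField_apriori hf'_meas hf'_cont hf'0 hf'_le hh_mono hh_cont hh_nonneg hh_pos hq'i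
        hq'0 (by rw [hN, ← neg_div]; exact hdiv) ha hT
  have hFi : ∀ b c, IntervalIntegrable (fun s => companionField f' s (u s)) volume b c :=
    intervalIntegrable_delay (measurable_companionField hf'_meas)
      (continuous_companionField hf'_cont)
      (companionField_bound hf'0 hf'_le hh_mono hh_nonneg hq'i hq'0) huc
  have huv := fun i t ht => integral_system_apply hFi hu i (t := t) ht
  have hua : u 0 = a := by simpa using hu 0 le_rfl
  have hu0 (i : Fin m) (t : ℝ) (ht : 0 ≤ t) : 0 ≤ u t i := by
    rw [huv i t ht]
    exact add_nonneg (ha i) (intervalIntegral.integral_nonneg ht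
      fun s _ => companionField_nonneg hf'0 s (u s) i)
  have hlast (s : ℝ) : companionField f' s (u s) ⟨m - 1, by omega⟩ = f' s (u s) := by
    have h1 : ¬ (m - 1 + 1 < m) := by omega
    simp only [companionField, h1, dif_neg, not_false_eq_true]
  have hae (t : ℝ) (ht : 0 ≤ t) : ∀ᵐ s, s ∈ uIoc 0 t → f' s (u s) = f s fun j => u s j := by
    filter_upwards [hGae] with s hsG hs
    rw [uIoc_of_le ht] at hs
    simp only [hf', indicator_of_mem (show s ∈ S from ⟨hsG, hs.1.le⟩)]
    congr 1
    funext j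
    exact max_eq_left (hu0 j s hs.1.le)
  refine ⟨fun i t => u t i, ⟨fun i hi t ht => ?_, fun t ht => ?_, fun _ t ht => ?_⟩,
    congrFun hua⟩
  · simp only [hua]
    rw [huv _ t ht]
    congr 1
    refine intervalIntegral.integral_congr fun s hs => ?_
    rw [uIcc_of_le ht] at hs
    simp only [companionField, hi, dif_pos, max_eq_left (hu0 _ s hs.1)]
  · refine IntervalIntegrable.congr_ae ((intervalIntegrable_apply hFi ⟨m - 1, by omega⟩ 0 t)) ?_
    rw [EventuallyEq, ae_restrict_iff' measurableSet_uIoc]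
    simpa only [hlast] using hae t ht
  · simp only [hua]
    rw [huv _ t ht]
    congr 1
    simp only [hlast]
    exact intervalIntegral.integral_congr_ae (hae t ht)
end
end

section
/- Let n ≥ 1 be an integer and g : (0,∞) → (0,∞) a non-decreasing continuous function. Let u be a positive solution of the equation (d/dt) u^{1/n}(t) = g^{1/n}(u(t)) on an interval [0,T). Then, with α = 1/2^{n+1} and β = 1/(1 + 2^n) (constants depending only on n), the inequality u(t) − u(0) ≥ α ∫_0^t (t − τ)^{n−1} g(β u(τ)) dτ holds for all t ∈ [0,T). -/
open MeasureTheory Set Filter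

noncomputable section

/-- For a nonnegative monotone continuous `h` on `[0,t]`, the `n`-th power of its integral dominates
`n` times the integral of `h ^ n` against the kernel `(t - τ) ^ (n - 1)`. -/
theorem integral_sub_pow_mul_pow_le {n : ℕ} (hn : 1 ≤ n) {t : ℝ} (ht : 0 ≤ t) {h : ℝ → ℝ}
    (hc : ContinuousOn h (Icc 0 t)) (hm : MonotoneOn h (Icc 0 t)) (h0 : ∀ x ∈ Icc 0 t, 0 ≤ h x) :
    n * ∫ τ in (0:ℝ)..t, (t - τ) ^ (n - 1) * h τ ^ n ≤ (∫ τ in (0:ℝ)..t, h τ) ^ n := by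
  have hsub : ∀ {x}, x ∈ Icc 0 t → Icc x t ⊆ Icc 0 t := fun hx => Icc_subset_Icc_left hx.1
  have hint : ∀ {x}, x ∈ Icc 0 t → IntervalIntegrable h volume x t := fun hx =>
    (hc.mono (by rw [uIcc_of_le hx.2]; exact hsub hx)).intervalIntegrable
  have hlow : ∀ x ∈ Icc 0 t, (t - x) * h x ≤ ∫ τ in x..t, h τ := by
    intro x hx
    have := intervalIntegral.integral_mono_on hx.2
      (intervalIntegrable_const (c := h x)) (hint hx) (fun y hy => hm hx (hsub hx hy) hy.1)
    simpa using this
  have hHc : ContinuousOn (fun x => ∫ τ in x..t, h τ) (Icc 0 t) := by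
    have := intervalIntegral.continuousOn_primitive_interval_left (μ := volume) (f := h)
      (a := 0) (b := t) (by rw [uIcc_of_le ht]; exact hc.integrableOn_Icc)
    rwa [uIcc_of_le ht] at this
  have hderiv : ∀ x ∈ Ioo 0 t, HasDerivAt (fun x => -(∫ τ in x..t, h τ) ^ n)
      (n * (∫ τ in x..t, h τ) ^ (n - 1) * h x) x := by
    intro x hx
    have hx' := Ioo_subset_Icc_self hx
    have hmeas : StronglyMeasurableAtFilter h (nhds x) volume :=
      (hc.mono Ioo_subset_Icc_self).stronglyMeasurableAtFilter isOpen_Ioo x hx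
    have := ((intervalIntegral.integral_hasDerivAt_left (hint hx') hmeas
      (hc.continuousAt (Icc_mem_nhds hx.1 hx.2))).pow n).neg
    rwa [mul_neg, neg_neg] at this
  have hc' : ContinuousOn (fun x => n * (∫ τ in x..t, h τ) ^ (n - 1) * h x) (Icc 0 t) :=
    (continuousOn_const.mul (hHc.pow _)).mul hc
  have hftc := intervalIntegral.integral_eq_sub_of_hasDerivAt_of_le ht (hHc.pow n).neg hderiv
    (hc'.intervalIntegrable_of_Icc ht)
  simp only [intervalIntegral.integral_same, zero_pow (by omega : n ≠ 0), Pi.neg_apply, Pi.pow_apply,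
    neg_zero, zero_sub, neg_neg] at hftc
  rw [← hftc, ← intervalIntegral.integral_const_mul]
  refine intervalIntegral.integral_mono_on ht ?_ (hc'.intervalIntegrable_of_Icc ht) ?_
  · refine ContinuousOn.intervalIntegrable_of_Icc ht ?_
    exact continuousOn_const.mul (ContinuousOn.mul (by fun_prop) (hc.pow n))
  · intro x hx
    have hpow : h x ^ n = h x ^ (n - 1) * h x := by rw [← pow_succ]; congr; omega
    rw [hpow, ← mul_assoc ((t - x) ^ (n - 1)), ← mul_pow, ← mul_assoc]
    have hle := hlow x hx
    have hhx := h0 x hx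
    have hprod := mul_nonneg (sub_nonneg.2 hx.2) hhx
    gcongr

/-- **Lemma 2.2.** Let `u` be a positive solution of `(u^{1/n})' = g(u)^{1/n}`
on `[0,T)` (local absolute continuity of `u^{1/n}` together with the a.e. differential
equation is encoded by the integral identity).  Then, with `α = 1/2^{n+1}` and
`β = 1/(1+2^n)`, one has `u(t) - u(0) ≥ α ∫_0^t (t-τ)^{n-1} g(β u(τ)) dτ` on `[0,T)`. -/
theorem lower_bound_for_first_order_solution
    (n : ℕ) (hn : 1 ≤ n) (T : ℝ) (hT : 0 < T)
    (g : ℝ → ℝ) (hg_pos : ∀ s, 0 < s → 0 < g s)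
    (hg_mono : MonotoneOn g (Ioi 0)) (hg_cont : ContinuousOn g (Ioi 0))
    (u : ℝ → ℝ) (hu_pos : ∀ t ∈ Ico (0:ℝ) T, 0 < u t)
    (hu_int : ∀ t ∈ Ico (0:ℝ) T,
      IntervalIntegrable (fun τ => g (u τ) ^ ((1:ℝ) / n)) volume 0 t)
    (hu_sol : ∀ t ∈ Ico (0:ℝ) T,
      u t ^ ((1:ℝ) / n) = u 0 ^ ((1:ℝ) / n) + ∫ τ in (0:ℝ)..t, g (u τ) ^ ((1:ℝ) / n)) :
    ∀ t ∈ Ico (0:ℝ) T,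
      u t - u 0 ≥ (1 / 2 ^ (n + 1)) *
        ∫ τ in (0:ℝ)..t, (t - τ) ^ (n - 1) * g (1 / (1 + 2 ^ n) * u τ) := by
  intro t ht
  have hn0 : n ≠ 0 := by omega
  have hmem : ∀ {x}, x ∈ Icc 0 t → x ∈ Ico 0 T := fun hx => ⟨hx.1, hx.2.trans_lt ht.2⟩
  set w : ℝ → ℝ := fun x => u x ^ ((1:ℝ) / n)
  set h : ℝ → ℝ := fun x => g (u x) ^ ((1:ℝ) / n)
  have hroot : ∀ {y : ℝ}, 0 ≤ y → (y ^ ((1:ℝ) / n)) ^ n = y := fun hy => by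
    rw [one_div, Real.rpow_inv_natCast_pow hy hn0]
  have hwu : ∀ x ∈ Icc 0 t, w x ^ n = u x := fun x hx => hroot (hu_pos x (hmem hx)).le
  have hhg : ∀ x ∈ Icc 0 t, h x ^ n = g (u x) := fun x hx =>
    hroot (hg_pos _ (hu_pos x (hmem hx))).le
  have hw_eq : ∀ x ∈ Icc 0 t, w x = w 0 + ∫ τ in (0:ℝ)..x, h τ := fun x hx => hu_sol x (hmem hx)
  have hh_nonneg : ∀ x ∈ Icc 0 t, 0 ≤ h x := fun x hx =>
    Real.rpow_nonneg (hg_pos _ (hu_pos x (hmem hx))).le _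
  have hw_nonneg : ∀ x ∈ Icc 0 t, 0 ≤ w x := fun x hx =>
    Real.rpow_nonneg (hu_pos x (hmem hx)).le _
  have h0t : (0:ℝ) ∈ Icc 0 t := ⟨le_rfl, ht.1⟩
  have hw_cont : ContinuousOn w (Icc 0 t) := by
    have hi := intervalIntegral.continuousOn_primitive_interval' (hu_int t ht) left_mem_uIcc
    rw [uIcc_of_le ht.1] at hi
    exact (continuousOn_const.add hi).congr hw_eq
  have hu_cont : ContinuousOn u (Icc 0 t) := (hw_cont.pow n).congr fun x hx => (hwu x hx).symm
  have hw_mono : MonotoneOn w (Icc 0 t) := by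
    intro x hx y hy hxy
    have hadd := intervalIntegral.integral_add_adjacent_intervals (hu_int x (hmem hx))
      ((hu_int x (hmem hx)).symm.trans (hu_int y (hmem hy)))
    have hpos : 0 ≤ ∫ τ in x..y, h τ := intervalIntegral.integral_nonneg hxy fun z hz =>
      hh_nonneg z ⟨hx.1.trans hz.1, hz.2.trans hy.2⟩
    rw [hw_eq x hx, hw_eq y hy]
    linarith
  have hu_mono : MonotoneOn u (Icc 0 t) := by
    intro x hx y hy hxy
    rw [← hwu x hx, ← hwu y hy]
    exact pow_le_pow_left₀ (hw_nonneg x hx) (hw_mono hx hy hxy) n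
  have hgu_cont : ContinuousOn (fun x => g (u x)) (Icc 0 t) :=
    hg_cont.comp hu_cont fun x hx => hu_pos x (hmem hx)
  have hh_cont : ContinuousOn h (Icc 0 t) := hgu_cont.rpow_const fun x _ => Or.inr (by positivity)
  have hh_mono : MonotoneOn h (Icc 0 t) := fun x hx y hy hxy =>
    Real.rpow_le_rpow (hg_pos _ (hu_pos x (hmem hx))).le
      (hg_mono (hu_pos x (hmem hx)) (hu_pos y (hmem hy)) (hu_mono hx hy hxy)) (by positivity)
  have hmain := integral_sub_pow_mul_pow_le hn ht.1 hh_cont hh_mono hh_nonneg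
  have hsuper : (∫ τ in (0:ℝ)..t, h τ) ^ n ≤ u t - u 0 := by
    have hI : 0 ≤ ∫ τ in (0:ℝ)..t, h τ := intervalIntegral.integral_nonneg ht.1 hh_nonneg
    have := pow_add_pow_le (hw_nonneg 0 h0t) hI hn0
    rw [← hw_eq t ⟨ht.1, le_rfl⟩, hwu 0 h0t, hwu t ⟨ht.1, le_rfl⟩] at this
    linarith
  have hβ : (0:ℝ) < 1 / (1 + 2 ^ n) := by positivity
  have hβ1 : (1:ℝ) / (1 + 2 ^ n) ≤ 1 := by
    rw [div_le_one (by positivity)]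
    have : (0:ℝ) < 2 ^ n := by positivity
    linarith
  have hβu : ∀ x ∈ Icc 0 t, 0 < 1 / (1 + 2 ^ n) * u x := fun x hx =>
    mul_pos hβ (hu_pos x (hmem hx))
  have hcmp : ∫ τ in (0:ℝ)..t, (t - τ) ^ (n - 1) * g (1 / (1 + 2 ^ n) * u τ) ≤
      ∫ τ in (0:ℝ)..t, (t - τ) ^ (n - 1) * h τ ^ n := by
    refine intervalIntegral.integral_mono_on ht.1
      (ContinuousOn.intervalIntegrable_of_Icc ht.1 ?_)
      (ContinuousOn.intervalIntegrable_of_Icc ht.1 ?_) ?_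
    · exact ContinuousOn.mul (by fun_prop) (hg_cont.comp (continuousOn_const.mul hu_cont) hβu)
    · exact ContinuousOn.mul (by fun_prop) (hh_cont.pow n)
    · intro x hx
      have hux := hu_pos x (hmem hx)
      rw [hhg x hx]
      exact mul_le_mul_of_nonneg_left
        (hg_mono (hβu x hx) hux (mul_le_of_le_one_left hux.le hβ1))
        (pow_nonneg (sub_nonneg.2 hx.2) _)
  have hnonneg : 0 ≤ ∫ τ in (0:ℝ)..t, (t - τ) ^ (n - 1) * g (1 / (1 + 2 ^ n) * u τ) :=
    intervalIntegral.integral_nonneg ht.1 fun x hx =>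
      mul_nonneg (pow_nonneg (sub_nonneg.2 hx.2) _) (hg_pos _ (hβu x hx)).le
  have hα : (1:ℝ) / 2 ^ (n + 1) ≤ n :=
    (div_le_one (by positivity)).2 (one_le_pow₀ (by norm_num)) |>.trans (by exact_mod_cast hn)
  calc (1 / 2 ^ (n + 1)) * ∫ τ in (0:ℝ)..t, (t - τ) ^ (n - 1) * g (1 / (1 + 2 ^ n) * u τ)
      ≤ n * ∫ τ in (0:ℝ)..t, (t - τ) ^ (n - 1) * h τ ^ n :=
        mul_le_mul hα hcmp hnonneg (Nat.cast_nonneg n)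
    _ ≤ u t - u 0 := hmain.trans hsuper
end
end

section
/- Let n ≥ 1 be an integer and h : (0,∞) → (0,∞) a non-decreasing continuous function such that ∫_1^∞ h(s)^{−1/n} s^{1/n−1} ds = ∞. Then for all positive initial values b_0, …, b_{n−1} > 0 the Cauchy problem v^{(n)} = h(v), v^{(i)}(0) = b_i (i = 0, …, n−1), has a global solution, i.e. a solution on [0,∞). -/
open MeasureTheory Set Filter

noncomputable section

/-- Extension of `g : ℝ → ℝ` to `ℝ≥0∞` with value `⊤` at `⊤`. -/
def ennrealExtend (g : ℝ → ℝ) (x : ENNReal) : ENNReal :=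
  if x = ⊤ then ⊤ else ENNReal.ofReal (g x.toReal)

lemma ennrealExtend_of_ne_top (g : ℝ → ℝ) {x : ENNReal} (hx : x ≠ ⊤) :
    ennrealExtend g x = ENNReal.ofReal (g x.toReal) := if_neg hx

lemma ennrealExtend_mono {g : ℝ → ℝ} (hg : Monotone g) : Monotone (ennrealExtend g) := by
  intro x y hxy
  by_cases hy : y = ⊤
  · simp [ennrealExtend, hy]
  · have hx : x ≠ ⊤ := ne_top_of_le_ne_top hy hxy
    rw [ennrealExtend_of_ne_top g hx, ennrealExtend_of_ne_top g hy]
    exact ENNReal.ofReal_le_ofReal (hg (ENNReal.toReal_mono hy hxy))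

/-- The right-hand side of the first-order system equivalent to `w^{(n)} = g (w)`. -/
def systemRhs (n : ℕ) (g : ℝ → ℝ) (u : ℕ → ℝ →o ENNReal) (i : ℕ) (s : ℝ) : ENNReal :=
  if i + 1 < n then u (i + 1) s else ennrealExtend g (u 0 s)

lemma systemRhs_mono_left {n : ℕ} {g : ℝ → ℝ} (hg : Monotone g) {u w : ℕ → ℝ →o ENNReal}
    (huw : u ≤ w) (i : ℕ) (s : ℝ) : systemRhs n g u i s ≤ systemRhs n g w i s := by
  unfold systemRhs
  split_ifs
  · exact huw (i + 1) s
  · exact ennrealExtend_mono hg (huw 0 s)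

lemma systemRhs_mono {n : ℕ} {g : ℝ → ℝ} (hg : Monotone g) (u : ℕ → ℝ →o ENNReal) (i : ℕ) :
    Monotone (systemRhs n g u i) := by
  intro s t hst
  unfold systemRhs
  split_ifs
  · exact (u (i + 1)).mono hst
  · exact ennrealExtend_mono hg ((u 0).mono hst)

/-- The monotone integral operator whose fixed points solve the first-order system. -/
def picardOperator (n : ℕ) {g : ℝ → ℝ} (hg : Monotone g) (β : ℕ → ℝ) :
    (ℕ → ℝ →o ENNReal) →o (ℕ → ℝ →o ENNReal) where
  toFun u i :=
    { toFun := fun t => ENNReal.ofReal (β i) + ∫⁻ s in Ioc 0 t, systemRhs n g u i s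
      monotone' := fun _ _ hst =>
        add_le_add_right (lintegral_mono_set (Ioc_subset_Ioc_right hst)) _ }
  monotone' := fun _ _ huw i _ =>
    add_le_add_right (lintegral_mono fun s => systemRhs_mono_left hg huw i s) _

lemma picardOperator_apply (n : ℕ) {g : ℝ → ℝ} (hg : Monotone g) (β : ℕ → ℝ)
    (u : ℕ → ℝ →o ENNReal) (i : ℕ) (t : ℝ) :
    picardOperator n hg β u i t
      = ENNReal.ofReal (β i) + ∫⁻ s in Ioc 0 t, systemRhs n g u i s := rfl

/-- The step functions with value `c i j` on `(T j, T (j + 1)]`, and `⊤` for `i ≥ n`. -/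
def stepMajorant (n : ℕ) (c : ℕ → ℕ → ℝ) (T : ℕ → ℝ) (i : ℕ) : ℝ →o ENNReal where
  toFun t := if i < n then ⨅ (j : ℕ) (_ : t ≤ T (j + 1)), ENNReal.ofReal (c i j) else ⊤
  monotone' := by
    intro s t hst
    dsimp only
    split_ifs
    · exact iInf_mono fun j => iInf_mono' fun hj => ⟨hst.trans hj, le_rfl⟩
    · exact le_rfl

lemma stepMajorant_le {n : ℕ} (c : ℕ → ℕ → ℝ) (T : ℕ → ℝ) {i j : ℕ} {t : ℝ} (hi : i < n)
    (ht : t ≤ T (j + 1)) : stepMajorant n c T i t ≤ ENNReal.ofReal (c i j) := by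
  change (if i < n then ⨅ (j : ℕ) (_ : t ≤ T (j + 1)), ENNReal.ofReal (c i j) else ⊤) ≤ _
  rw [if_pos hi]
  exact iInf₂_le j ht

lemma picardOperator_stepMajorant_le {n : ℕ} {g : ℝ → ℝ} (hg : Monotone g)
    {β : ℕ → ℝ} {c : ℕ → ℕ → ℝ} {T : ℕ → ℝ} (hn : 0 < n) (hT0 : T 0 = 0) (hT : Monotone T)
    (hc : ∀ i j, 0 ≤ c i j) (hβ : ∀ i, 0 ≤ β i)
    (hzero : ∀ i < n, β i + (T 1 - T 0) * c (i + 1) 0 ≤ c i 0)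
    (hsucc : ∀ i < n, ∀ j, c i j + (T (j + 2) - T (j + 1)) * c (i + 1) (j + 1) ≤ c i (j + 1))
    (hgc : ∀ j, g (c 0 j) ≤ c n j) :
    picardOperator n hg β (stepMajorant n c T) ≤ stepMajorant n c T := by
  have hrhs : ∀ i < n, ∀ j s, s ≤ T (j + 1) →
      systemRhs n g (stepMajorant n c T) i s ≤ ENNReal.ofReal (c (i + 1) j) := by
    intro i hi j s hs
    unfold systemRhs
    split_ifs with h1
    · exact stepMajorant_le c T h1 hs
    · obtain rfl : n = i + 1 := by omega
      refine (ennrealExtend_mono hg (stepMajorant_le c T hn hs)).trans ?_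
      rw [ennrealExtend_of_ne_top g ENNReal.ofReal_ne_top, ENNReal.toReal_ofReal (hc 0 j)]
      exact ENNReal.ofReal_le_ofReal (hgc j)
  have hblock : ∀ i < n, ∀ j t, t ≤ T (j + 1) →
      ∫⁻ s in Ioc (T j) t, systemRhs n g (stepMajorant n c T) i s
        ≤ ENNReal.ofReal ((T (j + 1) - T j) * c (i + 1) j) := by
    intro i hi j t ht
    calc ∫⁻ s in Ioc (T j) t, systemRhs n g (stepMajorant n c T) i s
        ≤ ∫⁻ _ in Ioc (T j) t, ENNReal.ofReal (c (i + 1) j) :=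
          setLIntegral_mono measurable_const fun s hs => hrhs i hi j s (hs.2.trans ht)
      _ = ENNReal.ofReal (c (i + 1) j) * ENNReal.ofReal (t - T j) := by
          rw [setLIntegral_const, Real.volume_Ioc]
      _ ≤ ENNReal.ofReal ((T (j + 1) - T j) * c (i + 1) j) := by
          rw [mul_comm, ENNReal.ofReal_mul (sub_nonneg.2 (hT j.le_succ))]
          gcongr
  have key : ∀ i < n, ∀ j t, t ≤ T (j + 1) →
      ENNReal.ofReal (β i) + ∫⁻ s in Ioc 0 t, systemRhs n g (stepMajorant n c T) i s
        ≤ ENNReal.ofReal (c i j) := by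
    intro i hi j
    induction j with
    | zero =>
      intro t ht
      refine le_trans ?_ (ENNReal.ofReal_le_ofReal (hzero i hi))
      rw [ENNReal.ofReal_add (hβ i)
        (mul_nonneg (sub_nonneg.2 (hT (Nat.zero_le 1))) (hc _ _))]
      have := hblock i hi 0 t ht
      rw [hT0] at this ⊢
      gcongr
    | succ j ih =>
      intro t ht
      refine le_trans ?_ (ENNReal.ofReal_le_ofReal (hsucc i hi j))
      rw [ENNReal.ofReal_add (hc _ _)
        (mul_nonneg (sub_nonneg.2 (hT (Nat.le_succ _))) (hc _ _))]
      refine le_trans ?_ (add_le_add (ih _ le_rfl) (hblock i hi (j + 1) t ht))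
      rw [add_assoc]
      gcongr
      refine (lintegral_mono_set ?_).trans (lintegral_union_le _ _ _)
      intro s hs
      rcases le_or_gt s (T (j + 1)) with h | h
      · exact Or.inl ⟨hs.1, h⟩
      · exact Or.inr ⟨h, hs.2⟩
  intro i t
  rw [picardOperator_apply]
  change _ ≤ (if i < n then ⨅ (j : ℕ) (_ : t ≤ T (j + 1)), ENNReal.ofReal (c i j) else ⊤)
  split_ifs with hi
  · exact le_iInf₂ fun j hj => key i hi j t hj
  · exact le_top

/-- A discrete supersolution defined for all times yields a global solution. -/
theorem exists_isSolutionOn_of_discrete_supersolution {n : ℕ} (hn : 1 ≤ n) {h : ℝ → ℝ}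
    (hh_pos : ∀ s, 0 < s → 0 < h s) (hh_mono : MonotoneOn h (Ioi 0))
    {b : Fin n → ℝ} (hb : ∀ i, 0 < b i) {c : ℕ → ℕ → ℝ} {T : ℕ → ℝ}
    (hT0 : T 0 = 0) (hT : Monotone T) (hT_top : Tendsto T atTop atTop)
    (hc : ∀ i j, 0 ≤ c i j) (hc_zero : ∀ j, b ⟨0, hn⟩ ≤ c 0 j)
    (hzero : ∀ i : Fin n, b i + (T 1 - T 0) * c (i + 1) 0 ≤ c i 0)
    (hsucc : ∀ i < n, ∀ j, c i j + (T (j + 2) - T (j + 1)) * c (i + 1) (j + 1) ≤ c i (j + 1))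
    (hhc : ∀ j, h (c 0 j) ≤ c n j) :
    ∃ v : Fin n → ℝ → ℝ,
      IsSolutionOn n (fun _ x => h (x ⟨0, hn⟩)) v (Ici 0) ∧ ∀ i, v i 0 = b i := by
  have hb0 := hb ⟨0, hn⟩
  set b0 := b ⟨0, hn⟩ with hb0_def
  have hpos : ∀ y, 0 < max y b0 := fun y => hb0.trans_le (le_max_right _ _)
  set g : ℝ → ℝ := fun y => h (max y b0) with hg_def
  have hg : Monotone g := fun x y hxy =>
    hh_mono (hpos x) (hpos y) (max_le_max_right _ hxy)
  have hg_nonneg : ∀ y, 0 ≤ g y := fun y => (hh_pos _ (hpos y)).le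
  set β : ℕ → ℝ := fun i => if hi : i < n then b ⟨i, hi⟩ else 0 with hβ_def
  have hβ_eq : ∀ i : Fin n, β i = b i := fun i => by simp [hβ_def]
  have hβ : ∀ i, 0 ≤ β i := by
    intro i
    by_cases hi : i < n
    · exact (hβ_eq ⟨i, hi⟩).symm ▸ (hb ⟨i, hi⟩).le
    · simp [hβ_def, hi]
  set u := (picardOperator n hg β).lfp with hu_def
  have hu : ∀ i t, u i t = ENNReal.ofReal (β i) + ∫⁻ s in Ioc 0 t, systemRhs n g u i s := by
    intro i t
    conv_lhs => rw [hu_def, ← OrderHom.map_lfp]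
    rfl
  have hu_le : u ≤ stepMajorant n c T := by
    refine OrderHom.lfp_le _ (picardOperator_stepMajorant_le hg hn hT0 hT hc hβ ?_ hsucc ?_)
    · intro i hi
      have := hzero ⟨i, hi⟩
      rwa [← hβ_eq] at this
    · intro j
      simp only [hg_def, max_eq_left (hc_zero j)]
      exact hhc j
  have hfin : ∀ i < n, ∀ t, u i t ≠ ⊤ := by
    intro i hi t
    obtain ⟨j, hj⟩ := ((tendsto_add_atTop_iff_nat 1).2 hT_top |>.eventually_ge_atTop t).exists
    exact ne_top_of_le_ne_top ENNReal.ofReal_ne_top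
      ((hu_le i t).trans (stepMajorant_le c T hi hj))
  have hlint : ∀ i < n, ∀ t, ∫⁻ s in Ioc 0 t, systemRhs n g u i s ≠ ⊤ := fun i hi t =>
    ne_top_of_le_ne_top (hfin i hi t) (by rw [hu i t]; exact le_add_self)
  have hmeas : ∀ i, Measurable (systemRhs n g u i) := fun i =>
    (systemRhs_mono hg u i).measurable
  have hrhs_fin : ∀ i s, systemRhs n g u i s < ⊤ := by
    intro i s
    unfold systemRhs
    split_ifs with h1
    · exact (hfin _ h1 s).lt_top
    · rw [ennrealExtend_of_ne_top g (hfin 0 hn s)]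
      exact ENNReal.ofReal_lt_top
  have hinit : ∀ i : Fin n, (u i 0).toReal = b i := by
    intro i
    rw [hu]
    simp [hβ_eq, (hb i).le]
  have hsol : ∀ i (hi : i < n), ∀ t ∈ Ici (0 : ℝ),
      (u i t).toReal = (u i 0).toReal + ∫ s in (0 : ℝ)..t, (systemRhs n g u i s).toReal := by
    intro i hi t ht
    have := hβ i
    rw [intervalIntegral.integral_of_le ht,
      integral_toReal (hmeas i).aemeasurable (ae_of_all _ (hrhs_fin i)), hu i t, hu i 0,
      ENNReal.toReal_add ENNReal.ofReal_ne_top (hlint i hi t)]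
    simp
  have h_intble : ∀ i < n, ∀ t ∈ Ici (0 : ℝ),
      IntervalIntegrable (fun s => (systemRhs n g u i s).toReal) volume 0 t := by
    intro i hi t ht
    rw [intervalIntegrable_iff_integrableOn_Ioc_of_le ht]
    exact integrable_toReal_of_lintegral_ne_top (hmeas i).aemeasurable (hlint i hi t)
  have hlast : (fun s => (systemRhs n g u (n - 1) s).toReal) = fun s => h (u 0 s).toReal := by
    funext s
    have hle : b0 ≤ (u 0 s).toReal := by
      refine (ENNReal.ofReal_le_iff_le_toReal (hfin 0 hn s)).1 ?_
      rw [hu 0 s, hb0_def, ← hβ_eq ⟨0, hn⟩]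
      exact le_self_add
    rw [systemRhs, if_neg (by omega), ennrealExtend_of_ne_top g (hfin 0 hn s),
      ENNReal.toReal_ofReal (hg_nonneg _)]
    simp only [hg_def, max_eq_left hle]
  refine ⟨fun i t => (u i t).toReal, ⟨?_, ?_, ?_⟩, hinit⟩
  · intro i hi t ht
    have := hsol i (by omega) t ht
    simpa only [systemRhs, if_pos hi] using this
  · intro t ht
    have := h_intble (n - 1) (by omega) t ht
    rwa [hlast] at this
  · intro hm t ht
    have := hsol (n - 1) (by omega) t ht
    rwa [hlast] at this

/-- Dyadic form of the divergence condition. -/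
lemma not_summable_of_lintegral_eq_top {n : ℕ} (hn : 1 ≤ n) {h : ℝ → ℝ}
    (hh_pos : ∀ s, 0 < s → 0 < h s) (hh_mono : MonotoneOn h (Ioi 0))
    (hdiv : ∫⁻ s in Ici (1:ℝ),
        ENNReal.ofReal (h s ^ (-(1:ℝ) / (n:ℝ)) * s ^ ((1:ℝ) / (n:ℝ) - 1)) = ⊤) :
    ¬ Summable fun k : ℕ => (2:ℝ) ^ k / h ((2 ^ n) ^ k) ^ ((n:ℝ)⁻¹) := by
  intro hsum
  have hn0 : (n:ℝ) ≠ 0 := by positivity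
  have hn1 : (1:ℝ) ≤ n := by exact_mod_cast hn
  set f : ℝ → ENNReal := fun s =>
    ENNReal.ofReal (h s ^ (-(1:ℝ) / (n:ℝ)) * s ^ ((1:ℝ) / (n:ℝ) - 1)) with hf
  set Q : ℝ := 2 ^ n with hQ
  have hQ1 : 1 < Q := one_lt_pow₀ one_lt_two (by omega)
  have hQ0 : 0 < Q := one_pos.trans hQ1
  have hcover : Ici (1:ℝ) ⊆ ⋃ k : ℕ, Ico (Q ^ k) (Q ^ (k + 1)) := by
    intro s hs
    obtain ⟨k, hk⟩ := exists_nat_pow_near hs hQ1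
    exact mem_iUnion.2 ⟨k, hk⟩
  have hterm : ∀ k : ℕ, ∫⁻ s in Ico (Q ^ k) (Q ^ (k + 1)), f s
      ≤ ENNReal.ofReal (Q * ((2:ℝ) ^ k / h (Q ^ k) ^ ((n:ℝ)⁻¹))) := by
    intro k
    have hQk : 0 < Q ^ k := pow_pos hQ0 k
    have hhk := hh_pos _ hQk
    have hroot : (Q ^ k) ^ ((n:ℝ)⁻¹) = 2 ^ k := by
      rw [hQ, ← pow_mul, mul_comm, pow_mul,
        Real.pow_rpow_inv_natCast (by positivity) (by omega)]
    calc ∫⁻ s in Ico (Q ^ k) (Q ^ (k + 1)), f s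
        ≤ ∫⁻ _ in Ico (Q ^ k) (Q ^ (k + 1)),
            ENNReal.ofReal ((h (Q ^ k) ^ ((n:ℝ)⁻¹))⁻¹ * (2 ^ k / Q ^ k)) := by
          refine setLIntegral_mono measurable_const fun s hs => ENNReal.ofReal_le_ofReal ?_
          have hs0 : 0 < s := hQk.trans_le hs.1
          refine mul_le_mul ?_ ?_ (by positivity) (by positivity)
          · rw [← Real.rpow_neg hhk.le, neg_div, one_div]
            exact Real.rpow_le_rpow_of_nonpos hhk (hh_mono hQk hs0 hs.1)
              (by rw [neg_nonpos]; positivity)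
          · rw [← hroot, ← Real.rpow_sub_one hQk.ne', one_div]
            exact Real.rpow_le_rpow_of_nonpos hQk hs.1 (sub_nonpos.2 (inv_le_one_of_one_le₀ hn1))
      _ ≤ ENNReal.ofReal (Q * ((2:ℝ) ^ k / h (Q ^ k) ^ ((n:ℝ)⁻¹))) := by
          rw [setLIntegral_const, Real.volume_Ico, ← ENNReal.ofReal_mul (by positivity)]
          refine ENNReal.ofReal_le_ofReal ?_
          calc (h (Q ^ k) ^ ((n:ℝ)⁻¹))⁻¹ * (2 ^ k / Q ^ k) * (Q ^ (k + 1) - Q ^ k)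
              ≤ (h (Q ^ k) ^ ((n:ℝ)⁻¹))⁻¹ * (2 ^ k / Q ^ k) * Q ^ (k + 1) := by
                gcongr
                exact sub_le_self _ hQk.le
            _ = Q * ((2:ℝ) ^ k / h (Q ^ k) ^ ((n:ℝ)⁻¹)) := by
                rw [pow_succ]
                field_simp
  refine (hsum.mul_left Q).tsum_ofReal_ne_top (top_unique ?_)
  calc (⊤ : ENNReal) = ∫⁻ s in Ici (1:ℝ), f s := hdiv.symm
    _ ≤ ∫⁻ s in ⋃ k : ℕ, Ico (Q ^ k) (Q ^ (k + 1)), f s := lintegral_mono_set hcover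
    _ ≤ ∑' k : ℕ, ∫⁻ s in Ico (Q ^ k) (Q ^ (k + 1)), f s := lintegral_iUnion_le _ _
    _ ≤ _ := ENNReal.tsum_le_tsum hterm

/-- **Lemma 2.3.** If `h : (0,∞) → (0,∞)` is non-decreasing, continuous and
`∫_1^∞ h(s)^{-1/n} s^{1/n-1} ds = ∞`, then the Cauchy problem `v^{(n)} = h(v)`,
`v^{(i)}(0) = bᵢ > 0`, has a global solution. -/
theorem global_solution_autonomous
    (n : ℕ) (hn : 1 ≤ n)
    (h : ℝ → ℝ) (hh_pos : ∀ s, 0 < s → 0 < h s)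
    (hh_mono : MonotoneOn h (Ioi 0)) (hh_cont : ContinuousOn h (Ioi 0))
    (hdiv : ∫⁻ s in Ici (1:ℝ),
        ENNReal.ofReal (h s ^ (-(1:ℝ) / (n:ℝ)) * s ^ ((1:ℝ) / (n:ℝ) - 1)) = ⊤)
    (b : Fin n → ℝ) (hb : ∀ i, 0 < b i) :
    ∃ v : Fin n → ℝ → ℝ,
      IsSolutionOn n (fun _ x => h (x ⟨0, hn⟩)) v (Ici 0) ∧ ∀ i, v i 0 = b i := by
  have hQ : ∀ k : ℕ, (0:ℝ) < (2 ^ n) ^ k := fun k => by positivity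
  set a : ℕ → ℝ := fun k => h ((2 ^ n) ^ k) ^ ((n:ℝ)⁻¹) with ha_def
  have ha : ∀ k, 0 < a k := fun k => Real.rpow_pos_of_pos (hh_pos _ (hQ k)) _
  have ha_mono : Monotone a := fun k l hkl =>
    Real.rpow_le_rpow (hh_pos _ (hQ k)).le
      (hh_mono (hQ k) (hQ l) (pow_le_pow_right₀ (one_le_pow₀ one_le_two) hkl)) (by positivity)
  have ha_pow : ∀ k, a k ^ n = h ((2 ^ n) ^ k) := fun k =>
    Real.rpow_inv_natCast_pow (hh_pos _ (hQ k)).le (by omega)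
  set d : ℕ → ℕ → ℝ := fun i k => (2 ^ n) ^ k * (a k / 2 ^ k) ^ i with hd_def
  have hd : ∀ i k, 0 < d i k := fun i k => by have := ha k; positivity
  have hd_zero : ∀ k, d 0 k = (2 ^ n) ^ k := fun k => by simp [hd_def]
  have hd_top : ∀ k, d n k = h ((2 ^ n) ^ k) := fun k => by
    simp only [hd_def]
    rw [← ha_pow, div_pow, ← pow_mul, ← pow_mul, mul_comm n k]
    field_simp
  have hd_step : ∀ i k, 2 ^ k / (2 * a k) * d (i + 1) k = d i k / 2 := fun i k => by
    have := ha k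
    simp only [hd_def]
    rw [pow_succ]
    field_simp
  have hd_succ : ∀ i < n, ∀ k, 2 * d i k ≤ d i (k + 1) := by
    intro i hi k
    obtain ⟨m, rfl⟩ : ∃ m, n = i + (m + 1) := ⟨n - i - 1, by omega⟩
    have hak := ha k
    have h1 : (1:ℝ) ≤ 2 ^ m := one_le_pow₀ one_le_two
    calc 2 * d i k = 2 * 1 * ((2 ^ (i + (m + 1))) ^ k * (a k / 2 ^ k) ^ i) := by
          simp only [hd_def]; ring
      _ ≤ 2 * 2 ^ m * ((2 ^ (i + (m + 1))) ^ k * (a (k + 1) / 2 ^ k) ^ i) := by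
          gcongr
          exact ha_mono k.le_succ
      _ = d i (k + 1) := by
          simp only [hd_def, pow_succ, div_pow, mul_pow, pow_add]
          field_simp
  have hd_mono : ∀ i < n, Monotone (d i) := fun i hi =>
    monotone_nat_of_le_succ fun k => by linarith [hd_succ i hi k, hd i k]
  have hd_large : ∀ i : Fin n, ∀ᶠ k in atTop, b i ≤ d i k / 2 := by
    intro i
    have hgeom : ∀ k, d i 0 * 2 ^ k ≤ d i k := by
      intro k
      induction k with
      | zero => simp
      | succ k ih => rw [pow_succ]; linarith [hd_succ i i.2 k]
    have htend : Tendsto (fun k : ℕ => d i 0 * (2:ℝ) ^ k) atTop atTop :=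
      (tendsto_pow_atTop_atTop_of_one_lt one_lt_two).const_mul_atTop (hd i 0)
    filter_upwards [htend.eventually_ge_atTop (2 * b i)] with k hk
    linarith [hgeom k]
  obtain ⟨K, hK⟩ := (eventually_all.2 hd_large).exists
  set δ : ℕ → ℝ := fun k => 2 ^ (k + K) / (2 * a (k + K)) with hδ_def
  have hδ : ∀ k, 0 ≤ δ k := fun k => by have := ha (k + K); positivity
  have hδ_sum : ¬ Summable δ := by
    intro hs
    refine not_summable_of_lintegral_eq_top hn hh_pos hh_mono hdiv
      ((summable_nat_add_iff K).1 ((hs.mul_left 2).congr fun k => ?_))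
    have := ha (k + K)
    change 2 * (2 ^ (k + K) / (2 * a (k + K))) = 2 ^ (k + K) / a (k + K)
    field_simp
  set T : ℕ → ℝ := fun j => ∑ k ∈ Finset.range j, δ k with hT_def
  have hT_succ : ∀ j, T (j + 1) - T j = δ j := fun j => by
    simp [hT_def, Finset.sum_range_succ]
  refine exists_isSolutionOn_of_discrete_supersolution hn hh_pos hh_mono hb
    (c := fun i j => d i (j + K)) (T := T) (by simp [hT_def])
    (monotone_nat_of_le_succ fun j => by linarith [hT_succ j, hδ j])
    ((not_summable_iff_tendsto_nat_atTop_of_nonneg hδ).1 hδ_sum)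
    (fun i j => (hd i _).le) (fun j => ?_) (fun i => ?_) (fun i hi j => ?_) (fun j => ?_)
  · linarith [hK ⟨0, hn⟩, hd_mono 0 hn (Nat.le_add_left K j), hd 0 K]
  · rw [hT_succ 0]
    simp only [hδ_def, hd_step, zero_add]
    linarith [hK i]
  · rw [hT_succ (j + 1)]
    simp only [hδ_def, hd_step]
    have := hd_succ i hi (j + K)
    rw [show j + 1 + K = j + K + 1 by omega]
    linarith
  · exact le_of_eq (by rw [hd_zero, hd_top])
end
end

section
/- Let n ≥ 1 be an integer and g : (0,∞) → (0,∞) a non-decreasing continuous function. Let u be a positive solution of (d/dt) u^{1/n}(t) = g^{1/n}(u(t)) on an interval [0,T). Then u(t) − u(t₁) ≥ (t − t₁)^n g(u(t₁)) for all real numbers 0 ≤ t₁ ≤ t < T. -/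
open MeasureTheory Set Filter

noncomputable section

/-- Let `u` be a positive solution of `(u^{1/n})' = g(u)^{1/n}` on `[0,T)`
(local absolute continuity of `u^{1/n}` together with the a.e. differential equation is
encoded by the integral identity).  Then `u(t) - u(t₁) ≥ (t - t₁)^n g(u(t₁))` for all
`0 ≤ t₁ ≤ t < T`. -/
theorem pointwise_lower_bound_for_first_order_solution
    (n : ℕ) (hn : 1 ≤ n) (T : ℝ) (hT : 0 < T)
    (g : ℝ → ℝ) (hg_pos : ∀ s, 0 < s → 0 < g s)
    (hg_mono : MonotoneOn g (Ioi 0)) (hg_cont : ContinuousOn g (Ioi 0))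
    (u : ℝ → ℝ) (hu_pos : ∀ t ∈ Ico (0:ℝ) T, 0 < u t)
    (hu_int : ∀ t ∈ Ico (0:ℝ) T,
      IntervalIntegrable (fun τ => g (u τ) ^ ((1:ℝ) / n)) volume 0 t)
    (hu_sol : ∀ t ∈ Ico (0:ℝ) T,
      u t ^ ((1:ℝ) / n) = u 0 ^ ((1:ℝ) / n) + ∫ τ in (0:ℝ)..t, g (u τ) ^ ((1:ℝ) / n)) :
    ∀ t₁ t : ℝ, 0 ≤ t₁ → t₁ ≤ t → t < T →
      u t - u t₁ ≥ (t - t₁) ^ n * g (u t₁) := by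
  have hn0 : n ≠ 0 := by omega
  have hexp : (0:ℝ) < 1 / n := by positivity
  have root_pow {x : ℝ} (hx : 0 ≤ x) : (x ^ ((1:ℝ) / n)) ^ n = x := by
    rw [one_div, Real.rpow_inv_natCast_pow hx hn0]
  have increment {a b : ℝ} (ha : 0 ≤ a) (hab : a ≤ b) (hb : b < T) :
      IntervalIntegrable (fun τ => g (u τ) ^ ((1:ℝ) / n)) volume a b ∧
      u b ^ ((1:ℝ) / n) = u a ^ ((1:ℝ) / n) + ∫ τ in a..b, g (u τ) ^ ((1:ℝ) / n) := by
    have haT : a ∈ Ico 0 T := ⟨ha, hab.trans_lt hb⟩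
    have hbT : b ∈ Ico 0 T := ⟨ha.trans hab, hb⟩
    refine ⟨(hu_int a haT).symm.trans (hu_int b hbT), ?_⟩
    rw [hu_sol a haT, hu_sol b hbT, add_assoc,
      intervalIntegral.integral_add_adjacent_intervals (hu_int a haT)
        ((hu_int a haT).symm.trans (hu_int b hbT))]
  have u_mono {a b : ℝ} (ha : 0 ≤ a) (hab : a ≤ b) (hb : b < T) : u a ≤ u b := by
    have h := (increment ha hab hb).2
    have hnonneg : 0 ≤ ∫ τ in a..b, g (u τ) ^ ((1:ℝ) / n) :=
      intervalIntegral.integral_nonneg hab fun τ hτ =>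
        Real.rpow_nonneg (hg_pos _ (hu_pos τ ⟨ha.trans hτ.1, hτ.2.trans_lt hb⟩)).le _
    rw [← Real.rpow_le_rpow_iff (hu_pos a ⟨ha, hab.trans_lt hb⟩).le
      (hu_pos b ⟨ha.trans hab, hb⟩).le hexp]
    linarith
  intro t₁ t h₁ h₁t htT
  have hu₁ := hu_pos t₁ ⟨h₁, h₁t.trans_lt htT⟩
  have hg₁ := hg_pos _ hu₁
  obtain ⟨hint, hincr⟩ := increment h₁ h₁t htT
  have hlower : (t - t₁) * g (u t₁) ^ ((1:ℝ) / n) ≤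
      ∫ τ in t₁..t, g (u τ) ^ ((1:ℝ) / n) := by
    rw [← smul_eq_mul, ← intervalIntegral.integral_const]
    refine intervalIntegral.integral_mono_on h₁t intervalIntegrable_const hint fun τ hτ => ?_
    exact Real.rpow_le_rpow hg₁.le
      (hg_mono hu₁ (hu_pos τ ⟨h₁.trans hτ.1, hτ.2.trans_lt htT⟩)
        (u_mono h₁ hτ.1 (hτ.2.trans_lt htT))) hexp.le
  have hx : 0 ≤ u t₁ ^ ((1:ℝ) / n) := Real.rpow_nonneg hu₁.le _
  have hy : 0 ≤ (t - t₁) * g (u t₁) ^ ((1:ℝ) / n) :=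
    mul_nonneg (sub_nonneg.2 h₁t) (Real.rpow_nonneg hg₁.le _)
  have key : u t₁ + (t - t₁) ^ n * g (u t₁) ≤ u t := by
    calc u t₁ + (t - t₁) ^ n * g (u t₁)
        = (u t₁ ^ ((1:ℝ) / n)) ^ n + ((t - t₁) * g (u t₁) ^ ((1:ℝ) / n)) ^ n := by
          rw [mul_pow, root_pow hu₁.le, root_pow hg₁.le]
      _ ≤ (u t₁ ^ ((1:ℝ) / n) + (t - t₁) * g (u t₁) ^ ((1:ℝ) / n)) ^ n :=
          pow_add_pow_le hx hy hn0
      _ ≤ (u t ^ ((1:ℝ) / n)) ^ n := by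
          rw [hincr]
          gcongr
      _ = u t := root_pow (hu_pos t ⟨h₁.trans h₁t, htT⟩).le
  linarith
end
end

section
/- Let n ≥ 1 be an integer and g : (0,∞) → (0,∞) a non-decreasing continuous function such that ∫_1^∞ g(s)^{−1/n} s^{1/n−1} ds = ∞. Then for every initial value u₀ > 0 the Cauchy problem (d/dt) u^{1/n}(t) = g^{1/n}(u(t)), u(0) = u₀, has a positive global solution on [0,∞); moreover this solution satisfies (1/n) ∫_{u(0)}^{u(t)} g(s)^{−1/n} s^{1/n−1} ds = t for all t ∈ (0,∞). -/
open MeasureTheory Set Filter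

noncomputable section

/-- A positive continuous function on `ℝ` whose primitive is unbounded in both directions has a
primitive with a differentiable global inverse. -/
theorem exists_inverse_primitive (h : ℝ → ℝ) (hc : Continuous h) (hp : ∀ x, 0 < h x) (a : ℝ)
    (htop : Tendsto (fun x => ∫ s in a..x, h s) atTop atTop)
    (hbot : Tendsto (fun x => ∫ s in a..x, h s) atBot atBot) :
    ∃ u : ℝ → ℝ, u 0 = a ∧ Monotone u ∧ (∀ t, ∫ s in a..(u t), h s = t) ∧
      ∀ t, HasDerivAt u (h (u t))⁻¹ t := by
  set H : ℝ → ℝ := fun x => ∫ s in a..x, h s with hH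
  have hd : ∀ x, HasDerivAt H (h x) x := fun x => hc.integral_hasStrictDerivAt a x |>.hasDerivAt
  have hm : StrictMono H := strictMono_of_hasDerivAt_pos hd hp
  have hcont : Continuous H := continuous_iff_continuousAt.2 fun x => (hd x).continuousAt
  let e : ℝ ≃o ℝ := hm.orderIsoOfSurjective H (hcont.surjective htop hbot)
  have he : ∀ t, H (e.symm t) = t := fun t => e.apply_symm_apply t
  refine ⟨e.symm, ?_, e.symm.monotone, he, fun t => ?_⟩
  · apply hm.injective
    rw [he]
    simp [hH]
  · exact HasDerivAt.of_local_left_inverse e.symm.continuous.continuousAt (hd _) (hp _).ne'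
      (Eventually.of_forall he)

/-- The primitive of a positive continuous function with infinite integral near `∞` tends to
`∞`. -/
theorem tendsto_primitive_atTop (h : ℝ → ℝ) (hc : Continuous h) (hp : ∀ x, 0 < h x) (a : ℝ)
    (hn : ¬ IntegrableOn h (Ioi a)) :
    Tendsto (fun x => ∫ s in a..x, h s) atTop atTop := by
  have hd : ∀ x, HasDerivAt (fun x => ∫ s in a..x, h s) (h x) x :=
    fun x => hc.integral_hasStrictDerivAt a x |>.hasDerivAt
  have hm := strictMono_of_hasDerivAt_pos hd hp
  rcases tendsto_atTop_of_monotone hm.monotone with ht | ⟨l, hl⟩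
  · exact ht
  · exact absurd (integrableOn_Ioi_deriv_of_nonneg' (fun x _ => hd x) (fun x _ => (hp x).le) hl) hn

/-- If `g : (0,∞) → (0,∞)` is non-decreasing continuous and
`∫_1^∞ g(s)^{-1/n} s^{1/n-1} ds = ∞`, then for every `u₀ > 0` the Cauchy problem
`(u^{1/n})' = g(u)^{1/n}`, `u(0) = u₀`, has a positive global solution (encoded by the
integral identity for `u^{1/n}`), and this solution satisfies
`(1/n) ∫_{u(0)}^{u(t)} g(s)^{-1/n} s^{1/n-1} ds = t` for all `t > 0`. -/
theorem global_solution_first_order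
    (n : ℕ) (hn : 1 ≤ n)
    (g : ℝ → ℝ) (hg_pos : ∀ s, 0 < s → 0 < g s)
    (hg_mono : MonotoneOn g (Ioi 0)) (hg_cont : ContinuousOn g (Ioi 0))
    (hdiv : ∫⁻ s in Ici (1:ℝ),
        ENNReal.ofReal (g s ^ (-(1:ℝ) / (n:ℝ)) * s ^ ((1:ℝ) / (n:ℝ) - 1)) = ⊤)
    (u₀ : ℝ) (hu₀ : 0 < u₀) :
    ∃ u : ℝ → ℝ, u 0 = u₀ ∧ (∀ t, 0 ≤ t → 0 < u t) ∧
      (∀ t, 0 ≤ t → IntervalIntegrable (fun τ => g (u τ) ^ ((1:ℝ) / n)) volume 0 t) ∧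
      (∀ t, 0 ≤ t →
        u t ^ ((1:ℝ) / n) = u 0 ^ ((1:ℝ) / n) + ∫ τ in (0:ℝ)..t, g (u τ) ^ ((1:ℝ) / n)) ∧
      (∀ t, 0 < t →
        (1 / (n:ℝ)) * ∫ s in (u 0)..(u t),
          g s ^ (-(1:ℝ) / (n:ℝ)) * s ^ ((1:ℝ) / (n:ℝ) - 1) = t) := by
  have hn0 : (0:ℝ) < n := by exact_mod_cast hn
  set f : ℝ → ℝ := fun s => g s ^ (-(1:ℝ) / (n:ℝ)) * s ^ ((1:ℝ) / (n:ℝ) - 1) with hf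
  have hfp : ∀ s, 0 < s → 0 < f s := fun s hs =>
    mul_pos (Real.rpow_pos_of_pos (hg_pos s hs) _) (Real.rpow_pos_of_pos hs _)
  have hfc : ContinuousOn f (Ioi 0) :=
    (hg_cont.rpow_const fun s hs => Or.inl (hg_pos s hs).ne').mul
      (continuousOn_id.rpow_const fun s hs => Or.inl (ne_of_gt hs))
  have hfi : ¬ IntegrableOn f (Ioi u₀) := by
    intro hi
    have h1 : IntegrableOn f (Icc 1 u₀) :=
      (hfc.mono fun s hs => lt_of_lt_of_le one_pos hs.1).integrableOn_Icc
    have h2 : IntegrableOn f (Ici 1) := (h1.union hi).mono_set fun s hs => by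
      rcases le_or_gt s u₀ with h | h
      exacts [Or.inl ⟨hs, h⟩, Or.inr h]
    exact h2.lintegral_lt_top.ne hdiv
  have hmax : ∀ s, 0 < max s u₀ := fun s => lt_max_of_lt_right hu₀
  set h : ℝ → ℝ := fun s => (1 / (n:ℝ)) * f (max s u₀) with hh
  have hhp : ∀ s, 0 < h s := fun s => mul_pos (by positivity) (hfp _ (hmax s))
  have hhc : Continuous h := continuous_const.mul
    (hfc.comp_continuous (continuous_id.max continuous_const) hmax)
  have hhf : ∀ s, u₀ ≤ s → h s = (1 / (n:ℝ)) * f s := fun s hs => by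
    simp only [hh, max_eq_left hs]
  have htop := tendsto_primitive_atTop h hhc hhp u₀ fun hi => hfi <| by
    refine IntegrableOn.congr_fun (Integrable.const_mul hi (n:ℝ)) (fun s hs => ?_) measurableSet_Ioi
    simp only [hhf s (le_of_lt hs)]
    field_simp
  have hbot : Tendsto (fun x => ∫ s in u₀..x, h s) atBot atBot := by
    have hlin : Tendsto (fun x => (x - u₀) * h u₀) atBot atBot :=
      (tendsto_atBot_add_const_right _ (-u₀) tendsto_id).atBot_mul_const (hhp u₀)
    refine hlin.congr' ?_
    filter_upwards [eventually_le_atBot u₀] with x hx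
    have : ∫ s in u₀..x, h s = ∫ _ in u₀..x, h u₀ :=
      intervalIntegral.integral_congr fun s hs => by
        rw [uIcc_of_ge hx] at hs
        simp only [hh, max_eq_right hs.2, max_self]
    rw [this, intervalIntegral.integral_const, smul_eq_mul]
  obtain ⟨u, hu0, hum, hui, hud⟩ := exists_inverse_primitive h hhc hhp u₀ htop hbot
  have hule : ∀ t, 0 ≤ t → u₀ ≤ u t := fun t ht => hu0 ▸ hum ht
  have hup : ∀ t, 0 ≤ t → 0 < u t := fun t ht => hu₀.trans_le (hule t ht)
  have huc : Continuous u := continuous_iff_continuousAt.2 fun t => (hud t).continuousAt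
  have hint : ∀ t, 0 ≤ t →
      IntervalIntegrable (fun τ => g (u τ) ^ ((1:ℝ) / n)) volume 0 t := fun t ht => by
    refine ContinuousOn.intervalIntegrable ?_
    rw [uIcc_of_le ht]
    exact (hg_cont.comp huc.continuousOn fun τ hτ => hup τ hτ.1).rpow_const
      fun τ hτ => Or.inl (hg_pos _ (hup τ hτ.1)).ne'
  refine ⟨u, hu0, hup, hint, fun t ht => ?_, fun t ht => ?_⟩
  · have key := intervalIntegral.integral_eq_sub_of_hasDerivAt
      (f := fun τ => u τ ^ ((1:ℝ) / n)) (f' := fun τ => g (u τ) ^ ((1:ℝ) / n)) (a := 0) (b := t)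
      (fun τ hτ => by
        rw [uIcc_of_le ht] at hτ
        have hpos := hup τ hτ.1
        have hgpos := hg_pos _ hpos
        refine ((hud τ).rpow_const (p := (1:ℝ) / n) (Or.inl hpos.ne')).congr_deriv ?_
        rw [hhf _ (hule τ hτ.1)]
        simp only [hf, neg_div, Real.rpow_neg hgpos.le]
        have h1 := (Real.rpow_pos_of_pos hpos ((1:ℝ) / n - 1)).ne'
        have h2 := (Real.rpow_pos_of_pos hgpos ((1:ℝ) / n)).ne'
        generalize u τ ^ ((1:ℝ) / n - 1) = x at *
        generalize g (u τ) ^ ((1:ℝ) / n) = y at *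
        field_simp) (hint t ht)
    rw [key]
    ring
  · rw [hu0, ← intervalIntegral.integral_const_mul]
    refine Eq.trans (intervalIntegral.integral_congr fun s hs => ?_) (hui t)
    rw [uIcc_of_le (hule t ht.le)] at hs
    exact (hhf s hs.1).symm
end
end

section
/- Let n ≥ 1 be an integer, h : (0,∞) → (0,∞) a non-decreasing continuous function, T > 0, and b_0, …, b_{n−1} > 0. Define v_0(t) = Σ_{i=0}^{n−1} b_i t^i / i! and, for j ≥ 1, v_j(t) = Σ_{i=0}^{n−1} b_i t^i / i! + (1/(n−1)!) ∫_0^t (t−τ)^{n−1} h(v_{j−1}(τ)) dτ. Suppose u : [0,T] → (0,∞) is a continuous function satisfying u(t) ≥ Σ_{i=0}^{n−1} b_i t^i / i! + (1/(n−1)!) ∫_0^t (t−τ)^{n−1} h(u(τ)) dτ for all t ∈ [0,T]. Then v_j(t) ≤ u(t) for all t ∈ [0,T] and all j = 0, 1, 2, …. -/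
open MeasureTheory Set Filter

noncomputable section

/-- If `u : [0,T] → (0,∞)` is continuous and satisfies the integral
inequality `u(t) ≥ Σ_{i<n} bᵢ tⁱ/i! + (1/(n-1)!) ∫_0^t (t-τ)^{n-1} h(u(τ)) dτ`, then the
iterates `v_j` defined from the data `b₀, …, b_{n-1} > 0` satisfy `v_j(t) ≤ u(t)` on `[0,T]`
for every `j`. -/
theorem iterates_below_supersolution
    (n : ℕ) (hn : 1 ≤ n)
    (h : ℝ → ℝ) (hh_pos : ∀ s, 0 < s → 0 < h s)
    (hh_mono : MonotoneOn h (Ioi 0)) (hh_cont : ContinuousOn h (Ioi 0))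
    (T : ℝ) (hT : 0 < T)
    (b : Fin n → ℝ) (hb : ∀ i, 0 < b i)
    (v : ℕ → ℝ → ℝ)
    (hv0 : ∀ t, v 0 t = ∑ i : Fin n, b i * t ^ (i : ℕ) / ((i : ℕ).factorial : ℝ))
    (hvs : ∀ j t, v (j + 1) t
      = (∑ i : Fin n, b i * t ^ (i : ℕ) / ((i : ℕ).factorial : ℝ))
        + (1 / ((n - 1).factorial : ℝ)) *
            ∫ τ in (0:ℝ)..t, (t - τ) ^ (n - 1) * h (v j τ))
    (u : ℝ → ℝ) (hu_cont : ContinuousOn u (Icc 0 T))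
    (hu_pos : ∀ t ∈ Icc (0:ℝ) T, 0 < u t)
    (hu_super : ∀ t ∈ Icc (0:ℝ) T,
      u t ≥ (∑ i : Fin n, b i * t ^ (i : ℕ) / ((i : ℕ).factorial : ℝ))
        + (1 / ((n - 1).factorial : ℝ)) *
            ∫ τ in (0:ℝ)..t, (t - τ) ^ (n - 1) * h (u τ)) :
    ∀ j : ℕ, ∀ t ∈ Icc (0:ℝ) T, v j t ≤ u t := by
  have hpoly : ∀ t, 0 ≤ t →
      0 < ∑ i : Fin n, b i * t ^ (i : ℕ) / ((i : ℕ).factorial : ℝ) := by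
    intro t ht
    refine Finset.sum_pos' (fun i _ => ?_) ⟨⟨0, hn⟩, Finset.mem_univ _, ?_⟩
    · have := hb i
      positivity
    · simpa using hb ⟨0, hn⟩
  have hint_nonneg : ∀ w : ℝ → ℝ, (∀ t ∈ Icc (0:ℝ) T, 0 < w t) → ∀ t ∈ Icc (0:ℝ) T,
      0 ≤ ∫ τ in (0:ℝ)..t, (t - τ) ^ (n - 1) * h (w τ) := by
    intro w hw t ht
    refine intervalIntegral.integral_nonneg ht.1 fun τ hτ => ?_
    exact mul_nonneg (pow_nonneg (sub_nonneg.2 hτ.2) _)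
      (hh_pos _ (hw τ ⟨hτ.1, hτ.2.trans ht.2⟩)).le
  have hu_int : ∀ t ∈ Icc (0:ℝ) T,
      IntervalIntegrable (fun τ => (t - τ) ^ (n - 1) * h (u τ)) volume 0 t := by
    intro t ht
    refine ContinuousOn.intervalIntegrable_of_Icc ht.1 ?_
    refine ContinuousOn.mul (by fun_prop) ?_
    have hsub : Icc (0:ℝ) t ⊆ Icc 0 T := Icc_subset_Icc_right ht.2
    exact hh_cont.comp (hu_cont.mono hsub) fun τ hτ => hu_pos τ (hsub hτ)
  suffices key : ∀ j : ℕ, ∀ t ∈ Icc (0:ℝ) T, 0 < v j t ∧ v j t ≤ u t from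
    fun j t ht => (key j t ht).2
  intro j
  induction j with
  | zero =>
    intro t ht
    rw [hv0]
    refine ⟨hpoly t ht.1, le_trans ?_ (hu_super t ht)⟩
    exact le_add_of_nonneg_right (mul_nonneg (by positivity) (hint_nonneg u hu_pos t ht))
  | succ j ih =>
    intro t ht
    rw [hvs]
    refine ⟨add_pos_of_pos_of_nonneg (hpoly t ht.1) (mul_nonneg (by positivity)
      (hint_nonneg _ (fun s hs => (ih s hs).1) t ht)), le_trans ?_ (hu_super t ht)⟩
    refine add_le_add_right (mul_le_mul_of_nonneg_left ?_ (by positivity)) _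
    by_cases hi : IntervalIntegrable (fun τ => (t - τ) ^ (n - 1) * h (v j τ)) volume 0 t
    · refine intervalIntegral.integral_mono_on ht.1 hi (hu_int t ht) fun τ hτ => ?_
      have hτT : τ ∈ Icc (0:ℝ) T := ⟨hτ.1, hτ.2.trans ht.2⟩
      exact mul_le_mul_of_nonneg_left
        (hh_mono (ih τ hτT).1 (hu_pos τ hτT) (ih τ hτT).2)
        (pow_nonneg (sub_nonneg.2 hτ.2) _)
    · rw [intervalIntegral.integral_undef hi]
      exact hint_nonneg u hu_pos t ht
end
end

section
/- Let n ≥ 1 be an integer, q : [0,∞) → [0,∞) a locally integrable function, and h : [0,∞) → [0,∞) a non-decreasing continuous function with h(s) > 0 for all s > 0, such that ∫_1^∞ h(s)^{−1/n} s^{1/n−1} ds = ∞. Then for all initial values c_0, …, c_{n−1} ≥ 0 the Cauchy problem u^{(n)} = q(t) h(u), u^{(i)}(0) = c_i (i = 0, …, n−1), has a global solution on [0,∞). -/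
open MeasureTheory Set Filter

noncomputable section

/-- A Riemann-sum criterion: if the increments of `F` dominate `g s * ∫ τ in s..t, p τ` with `g`
non-decreasing, then they dominate the integral of `g * p`. -/
theorem integral_mul_le_sub_of_forall_mul_le {p g F : ℝ → ℝ} {t : ℝ} (ht : 0 ≤ t)
    (hp : IntegrableOn p (Icc 0 t)) (hp0 : ∀ s ∈ Icc 0 t, 0 ≤ p s) (hg : MonotoneOn g (Icc 0 t))
    (hgp : IntegrableOn (fun s => g s * p s) (Icc 0 t))
    (hF : ∀ s ∈ Icc 0 t, ∀ r ∈ Icc 0 t, s ≤ r → g s * ∫ τ in s..r, p τ ≤ F r - F s) :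
    ∫ τ in (0:ℝ)..t, g τ * p τ ≤ F t - F 0 := by
  have int_of {f : ℝ → ℝ} (hf : IntegrableOn f (Icc 0 t)) {a b : ℝ} (ha : a ∈ Icc 0 t)
      (hb : b ∈ Icc 0 t) : IntervalIntegrable f volume a b :=
    (hf.mono_set (uIcc_subset_Icc ha hb)).intervalIntegrable
  have h0 : (0:ℝ) ∈ Icc 0 t := left_mem_Icc.2 ht
  have h1 : t ∈ Icc 0 t := right_mem_Icc.2 ht
  have hcont : ContinuousOn (fun s => ∫ τ in (0:ℝ)..s, p τ) (Icc 0 t) := by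
    have := intervalIntegral.continuousOn_primitive_interval (μ := volume) (f := p) (a := 0) (b := t)
      (by rwa [uIcc_of_le ht])
    rwa [uIcc_of_le ht] at this
  have hunif := Metric.uniformContinuousOn_iff.1
    (isCompact_Icc.uniformContinuousOn_of_continuous hcont)
  have key : ∀ ε > 0, ∫ τ in (0:ℝ)..t, g τ * p τ ≤ F t - F 0 + (g t - g 0) * ε := by
    intro ε hε
    obtain ⟨δ, hδ, hδε⟩ := hunif ε hε
    have step : ∀ s ∈ Icc 0 t, ∀ r ∈ Icc 0 t, s ≤ r → r - s < δ →
        ∫ τ in s..r, g τ * p τ ≤ F r - F s + (g r - g s) * ε := by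
      intro s hs r hr hsr hd
      have hP : ∫ τ in s..r, p τ ≤ ε := by
        have := hδε r hr s hs (by rw [Real.dist_eq, abs_of_nonneg (by linarith)]; exact hd)
        rw [Real.dist_eq, intervalIntegral.integral_interval_sub_left (int_of hp h0 hr)
          (int_of hp h0 hs)] at this
        exact (le_abs_self _).trans this.le
      have hle : ∫ τ in s..r, g τ * p τ ≤ ∫ τ in s..r, g r * p τ := by
        refine intervalIntegral.integral_mono_on hsr (int_of hgp hs hr)
          ((int_of hp hs hr).const_mul _) fun τ hτ => ?_
        have hτ' : τ ∈ Icc 0 t := ⟨hs.1.trans hτ.1, hτ.2.trans hr.2⟩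
        exact mul_le_mul_of_nonneg_right (hg hτ' hr hτ.2) (hp0 τ hτ')
      rw [intervalIntegral.integral_const_mul] at hle
      have hgm := hg hs hr hsr
      have := hF s hs r hr hsr
      nlinarith [mul_le_mul_of_nonneg_left hP (sub_nonneg.2 hgm)]
    have chain : ∀ N : ℕ, ∀ s ∈ Icc 0 t, ∀ r ∈ Icc 0 t, s ≤ r → r - s ≤ N * (δ / 2) →
        ∫ τ in s..r, g τ * p τ ≤ F r - F s + (g r - g s) * ε := by
      intro N
      induction N with
      | zero =>
        intro s _ r _ hsr hd
        obtain rfl : s = r := by simp at hd; linarith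
        simp
      | succ N ih =>
        intro s hs r hr hsr hd
        push_cast at hd
        have hmr : max s (r - δ / 2) ≤ r := max_le hsr (by linarith)
        have hm : max s (r - δ / 2) ∈ Icc 0 t :=
          ⟨hs.1.trans (le_max_left _ _), hmr.trans hr.2⟩
        have e1 := ih s hs _ hm (le_max_left _ _) (by
          rw [sub_le_iff_le_add]
          refine max_le ?_ (by linarith)
          have : 0 ≤ (N:ℝ) * (δ / 2) := by positivity
          linarith)
        have e2 := step _ hm r hr hmr (by linarith [le_max_right s (r - δ / 2)])
        rw [← intervalIntegral.integral_add_adjacent_intervals (int_of hgp hs hm)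
          (int_of hgp hm hr)]
        linarith
    obtain ⟨N, hN⟩ := exists_nat_ge (t / (δ / 2))
    refine chain N 0 h0 t h1 ht ?_
    rw [div_le_iff₀ (by positivity)] at hN
    linarith
  refine le_of_forall_pos_le_add fun ε hε => ?_
  have hM : 0 ≤ g t - g 0 := sub_nonneg.2 (hg h0 h1 ht)
  refine (key (ε / (g t - g 0 + 1)) (by positivity)).trans ?_
  gcongr
  rw [mul_div_assoc', div_le_iff₀ (by positivity)]
  nlinarith

/-- Monotone iteration: a system of integral equations with non-negative, non-decreasing and
continuous right-hand side which has a supersolution has a solution. -/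
theorem exists_solution_of_supersolution {ι : Type*} (G : ι → ℝ → (ι → ℝ) → ℝ) (c : ι → ℝ)
    (y : ℝ → ι → ℝ) (hc : 0 ≤ c)
    (hmeas : ∀ i (u : ℝ → ι → ℝ), (∀ j, Measurable fun t => u t j) → (∀ t, 0 ≤ u t) →
      AEStronglyMeasurable (fun τ => G i τ (u τ)) (volume.restrict (Ici 0)))
    (hmono : ∀ i τ, 0 ≤ τ → MonotoneOn (G i τ) (Ici 0))
    (hcont : ∀ i τ, 0 ≤ τ → ContinuousOn (G i τ) (Ici 0))
    (hnonneg : ∀ i τ, 0 ≤ τ → ∀ x, 0 ≤ x → 0 ≤ G i τ x)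
    (hy0 : ∀ t, 0 ≤ t → 0 ≤ y t)
    (hyint : ∀ i t, 0 ≤ t → IntervalIntegrable (fun τ => G i τ (y τ)) volume 0 t)
    (hsup : ∀ i t, 0 ≤ t → c i + ∫ τ in (0:ℝ)..t, G i τ (y τ) ≤ y t i) :
    ∃ u : ℝ → ι → ℝ, ∀ i t, 0 ≤ t → IntervalIntegrable (fun τ => G i τ (u τ)) volume 0 t ∧
      u t i = c i + ∫ τ in (0:ℝ)..t, G i τ (u τ) := by
  have hint : ∀ u : ℝ → ι → ℝ, (∀ j, Measurable fun t => u t j) → (∀ t, 0 ≤ u t) →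
      (∀ t, 0 ≤ t → u t ≤ y t) → ∀ i t, 0 ≤ t →
      IntervalIntegrable (fun τ => G i τ (u τ)) volume 0 t := by
    intro u hu hu0 huy i t ht
    refine (hyint i t ht).mono_fun ((hmeas i u hu hu0).mono_measure ?_) ?_
    · rw [uIoc_of_le ht]
      exact Measure.restrict_mono (fun τ hτ => hτ.1.le) le_rfl
    · rw [uIoc_of_le ht]
      refine (ae_restrict_iff' measurableSet_Ioc).2 (Eventually.of_forall fun τ hτ => ?_)
      have h0 := hτ.1.le
      beta_reduce
      rw [Real.norm_of_nonneg (hnonneg i τ h0 _ (hu0 τ)),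
        Real.norm_of_nonneg (hnonneg i τ h0 _ (hy0 τ h0))]
      exact hmono i τ h0 (hu0 τ) (hy0 τ h0) (huy τ h0)
  let Φ : (ℝ → ι → ℝ) → ℝ → ι → ℝ := fun u t i => c i + ∫ τ in (0:ℝ)..(max t 0), G i τ (u τ)
  let U : ℕ → ℝ → ι → ℝ := fun k => Φ^[k] 0
  have hUs : ∀ k, U (k + 1) = Φ (U k) := fun k => Function.iterate_succ_apply' Φ k 0
  have hΦmono : ∀ u v : ℝ → ι → ℝ, (∀ i t, 0 ≤ t →
        IntervalIntegrable (fun τ => G i τ (u τ)) volume 0 t) →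
      (∀ i t, 0 ≤ t → IntervalIntegrable (fun τ => G i τ (v τ)) volume 0 t) →
      (∀ t, 0 ≤ t → 0 ≤ u t) → (∀ t, 0 ≤ t → u t ≤ v t) → ∀ t, Φ u t ≤ Φ v t := by
    intro u v hu hv hu0 huv t i
    have ht : 0 ≤ max t 0 := le_max_right _ _
    refine add_le_add_right (intervalIntegral.integral_mono_on ht (hu i _ ht) (hv i _ ht) ?_) _
    intro τ hτ
    exact hmono i τ hτ.1 (hu0 τ hτ.1) ((hu0 τ hτ.1).trans (huv τ hτ.1)) (huv τ hτ.1)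
  have inv : ∀ k, (∀ j, Measurable fun t => U k t j) ∧ (∀ t, 0 ≤ U k t) ∧
      (∀ t, 0 ≤ t → U k t ≤ y t) := by
    intro k
    induction k with
    | zero => exact ⟨fun j => measurable_const, fun t => le_rfl, hy0⟩
    | succ k ih =>
      obtain ⟨a, b, d⟩ := ih
      have hi := hint _ a b d
      rw [hUs]
      refine ⟨fun j => Monotone.measurable fun s t hst => ?_, fun t i => ?_, fun t ht => ?_⟩
      · refine add_le_add_right (intervalIntegral.integral_mono_interval le_rfl
          (le_max_right _ _) (max_le_max_right 0 hst) ?_ (hi j _ (le_max_right _ _))) _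
        exact (ae_restrict_iff' measurableSet_Ioc).2
          (Eventually.of_forall fun τ hτ => hnonneg j τ hτ.1.le _ (b τ))
      · exact add_nonneg (hc i) (intervalIntegral.integral_nonneg (le_max_right _ _)
          fun τ hτ => hnonneg i τ hτ.1 _ (b τ))
      · refine (hΦmono _ y hi hyint (fun t _ => b t) d t).trans fun i => ?_
        simpa [Φ, max_eq_left ht] using hsup i t ht
  have hintU k := hint _ (inv k).1 (inv k).2.1 (inv k).2.2
  have hstep : ∀ k t, U k t ≤ U (k + 1) t := by
    intro k
    induction k with
    | zero => exact (inv 1).2.1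
    | succ k ih =>
      intro t
      have := hΦmono _ _ (hintU k) (hintU (k + 1)) (fun t _ => (inv k).2.1 t) (fun t _ => ih t) t
      rwa [← hUs, ← hUs] at this
  have hbdd : ∀ t i, BddAbove (range fun k => U k t i) := by
    intro t i
    refine ⟨y (max t 0) i, ?_⟩
    rintro _ ⟨k, rfl⟩
    refine le_trans ?_ ((inv k).2.2 (max t 0) (le_max_right _ _) i)
    cases k with
    | zero => exact le_rfl
    | succ k => simp [hUs, Φ]
  let u : ℝ → ι → ℝ := fun t i => ⨆ k, U k t i
  have hlim : ∀ t i, Tendsto (fun k => U k t i) atTop (nhds (u t i)) := fun t i =>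
    tendsto_atTop_ciSup (monotone_nat_of_le_succ fun k => hstep k t i) (hbdd t i)
  have hu0 : ∀ t, 0 ≤ u t := fun t i => ge_of_tendsto' (hlim t i) fun k => (inv k).2.1 t i
  have huy : ∀ t, 0 ≤ t → u t ≤ y t := fun t ht i =>
    le_of_tendsto' (hlim t i) fun k => (inv k).2.2 t ht i
  have hum : ∀ j, Measurable fun t => u t j := fun j =>
    measurable_of_tendsto_metrizable (fun k => (inv k).1 j) (tendsto_pi_nhds.2 fun t => hlim t j)
  refine ⟨u, fun i t ht => ⟨hint u hum hu0 huy i t ht, ?_⟩⟩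
  refine tendsto_nhds_unique ((tendsto_add_atTop_iff_nat 1).2 (hlim t i)) ?_
  simp only [hUs, Φ, max_eq_left ht]
  refine Tendsto.const_add _ ?_
  refine intervalIntegral.tendsto_integral_filter_of_dominated_convergence
    (fun τ => G i τ (y τ)) ?_ ?_ (hyint i t ht) ?_
  · refine Eventually.of_forall fun k => ?_
    rw [uIoc_of_le ht]
    exact (hintU k i t ht).1.aestronglyMeasurable
  · refine Eventually.of_forall fun k => Eventually.of_forall fun τ hτ => ?_
    rw [uIoc_of_le ht] at hτ
    have h0 := hτ.1.le
    rw [Real.norm_of_nonneg (hnonneg i τ h0 _ ((inv k).2.1 τ))]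
    exact hmono i τ h0 ((inv k).2.1 τ) (hy0 τ h0) ((inv k).2.2 τ h0)
  · refine Eventually.of_forall fun τ hτ => ?_
    rw [uIoc_of_le ht] at hτ
    have hw := hcont i τ hτ.1.le (u τ) (hu0 τ)
    refine hw.tendsto.comp (tendsto_nhdsWithin_iff.2 ⟨tendsto_pi_nhds.2 (hlim τ), ?_⟩)
    exact Eventually.of_forall fun k => (inv k).2.1 τ

/-- Under the divergence condition, the scalar problem `X' ≥ h (X ^ n) ^ (1 / n)`, `X 0 ≥ x₀`, has
a non-decreasing global solution. -/
theorem exists_monotone_profile {n : ℕ} (hn : 1 ≤ n) {h : ℝ → ℝ}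
    (hh_mono : MonotoneOn h (Ici 0)) (hh_cont : ContinuousOn h (Ici 0))
    (hh_pos : ∀ s, 0 < s → 0 < h s)
    (hdiv : ∫⁻ s in Ici (1:ℝ),
        ENNReal.ofReal (h s ^ (-(1:ℝ) / (n:ℝ)) * s ^ ((1:ℝ) / (n:ℝ) - 1)) = ⊤)
    {x₀ : ℝ} (hx₀ : 1 ≤ x₀) :
    ∃ X : ℝ → ℝ, (∀ v, 0 ≤ v → x₀ ≤ X v) ∧ MonotoneOn X (Ici 0) ∧
      ∀ v w, 0 ≤ v → v ≤ w → h (X v ^ n) ^ ((1:ℝ) / n) * (w - v) ≤ X w - X v := by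
  have hn0 : (0:ℝ) < n := by exact_mod_cast hn
  set φ : ℝ → ℝ := fun s => h s ^ (-(1:ℝ) / (n:ℝ)) * s ^ ((1:ℝ) / (n:ℝ) - 1) with hφ
  have hφ_cont : ContinuousOn φ (Ici 1) := by
    refine ContinuousOn.mul ?_ ?_
    · exact (hh_cont.mono (Ici_subset_Ici.2 zero_le_one)).rpow_const fun s hs =>
        Or.inl (hh_pos s (zero_lt_one.trans_le hs)).ne'
    · exact continuousOn_id.rpow_const fun s hs => Or.inl (zero_lt_one.trans_le hs).ne'
  have hφ_pos : ∀ s, 1 ≤ s → 0 < φ s := fun s hs =>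
    mul_pos (Real.rpow_pos_of_pos (hh_pos s (by linarith)) _)
      (Real.rpow_pos_of_pos (by linarith) _)
  have hφ_int : ∀ a b, 1 ≤ a → 1 ≤ b → IntervalIntegrable φ volume a b := fun a b ha hb =>
    (hφ_cont.mono fun s hs => (le_min ha hb).trans hs.1).intervalIntegrable
  have hy₀ : 1 ≤ x₀ ^ n := one_le_pow₀ hx₀
  set Ψ : ℝ → ℝ := fun y => ∫ s in (x₀ ^ n)..y, φ s with hΨ
  have hunbdd : ∀ M, ∃ y, x₀ ^ n ≤ y ∧ M ≤ Ψ y := by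
    by_contra! hcon
    obtain ⟨M, hM⟩ := hcon
    have hI : IntegrableOn φ (Ioi (x₀ ^ n)) := by
      refine integrableOn_Ioi_of_intervalIntegral_norm_bounded M (x₀ ^ n) (b := id)
        (l := atTop) (fun b => ?_) tendsto_id ?_
      · by_cases hb : x₀ ^ n ≤ b
        · exact (hφ_int _ _ hy₀ (hy₀.trans hb)).1
        · simp [Ioc_eq_empty_of_le (not_le.1 hb).le]
      · filter_upwards [eventually_ge_atTop (x₀ ^ n)] with b hb
        refine le_trans (le_of_eq ?_) (hM b hb).le
        refine intervalIntegral.integral_congr fun s hs => ?_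
        simp only [id, uIcc_of_le hb] at hs
        exact Real.norm_of_nonneg (hφ_pos s (hy₀.trans hs.1)).le
    have hI1 : IntegrableOn φ (Ici 1) := by
      rw [← Icc_union_Ioi_eq_Ici hy₀]
      exact ((hφ_cont.mono Icc_subset_Ici_self).integrableOn_Icc).union hI
    have hfin := hI1.2
    rw [hasFiniteIntegral_iff_norm] at hfin
    refine absurd hdiv (ne_of_lt (lt_of_le_of_lt ?_ hfin))
    exact lintegral_mono fun s => ENNReal.ofReal_le_ofReal (le_abs_self _)
  have hsurj : ∀ v, 0 ≤ v → ∃ y, x₀ ^ n ≤ y ∧ Ψ y = n * v := by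
    intro v hv
    obtain ⟨b, hb, hMb⟩ := hunbdd (n * v)
    have hc : ContinuousOn Ψ (Icc (x₀ ^ n) b) := by
      have := intervalIntegral.continuousOn_primitive_interval (μ := volume) (f := φ)
        (a := x₀ ^ n) (b := b) (by
          rw [uIcc_of_le hb]
          exact (hφ_cont.mono fun s hs => hy₀.trans hs.1).integrableOn_Icc)
      rwa [uIcc_of_le hb] at this
    obtain ⟨y, hy, hyv⟩ := intermediate_value_Icc hb hc
      (show (n:ℝ) * v ∈ Icc (Ψ (x₀ ^ n)) (Ψ b) from ⟨by simp [hΨ]; positivity, hMb⟩)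
    exact ⟨y, hy.1, hyv⟩
  choose! Y hY₀ hYv using hsurj
  have hsub : ∀ v w, 0 ≤ v → 0 ≤ w → ∫ s in (Y v)..(Y w), φ s = n * (w - v) := by
    intro v w hv hw
    rw [mul_sub, ← hYv v hv, ← hYv w hw]
    exact (intervalIntegral.integral_interval_sub_left
      (hφ_int _ _ hy₀ (hy₀.trans (hY₀ w hw))) (hφ_int _ _ hy₀ (hy₀.trans (hY₀ v hv)))).symm
  have hYmono : MonotoneOn Y (Ici 0) := by
    intro v hv w hw hvw
    by_contra! hlt
    have hpos := intervalIntegral.intervalIntegral_pos_of_pos_on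
      (hφ_int _ _ (hy₀.trans (hY₀ w hw)) (hy₀.trans (hY₀ v hv)))
      (fun s hs => hφ_pos s ((hy₀.trans (hY₀ w hw)).trans hs.1.le)) hlt
    rw [hsub w v hw hv] at hpos
    nlinarith
  have hY1 : ∀ v, 0 ≤ v → 1 ≤ Y v := fun v hv => hy₀.trans (hY₀ v hv)
  refine ⟨fun v => Y v ^ ((1:ℝ) / n), fun v hv => ?_, fun v hv w hw hvw => ?_,
    fun v w hv hvw => ?_⟩
  · have := Real.rpow_le_rpow (by positivity) (hY₀ v hv) (by positivity : (0:ℝ) ≤ 1 / n)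
    rwa [one_div, Real.pow_rpow_inv_natCast (by linarith) (by omega), ← one_div] at this
  · exact Real.rpow_le_rpow (by linarith [hY1 v hv]) (hYmono hv hw hvw) (by positivity)
  · have hw : 0 ≤ w := hv.trans hvw
    have hv1 := hY1 v hv
    have hle := hYmono hv hw hvw
    have hhpos := hh_pos (Y v) (by linarith)
    have hpow : (Y v ^ ((1:ℝ) / n)) ^ n = Y v := by
      rw [one_div]
      exact Real.rpow_inv_natCast_pow (by linarith) (by omega)
    have hbound : n * (w - v) ≤
        h (Y v) ^ (-(1:ℝ) / n) * ∫ s in (Y v)..(Y w), s ^ ((1:ℝ) / n - 1) := by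
      rw [← hsub v w hv hw, ← intervalIntegral.integral_const_mul]
      refine intervalIntegral.integral_mono_on hle (hφ_int _ _ hv1 (hY1 w hw)) ?_ fun s hs => ?_
      · refine ContinuousOn.intervalIntegrable (continuousOn_const.mul
          (continuousOn_id.rpow_const fun s hs => Or.inl ?_))
        rw [uIcc_of_le hle] at hs
        exact (by linarith [hs.1] : (0:ℝ) < s).ne'
      · have hs1 : 1 ≤ s := hv1.trans hs.1
        refine mul_le_mul_of_nonneg_right ?_ (Real.rpow_nonneg (by linarith) _)
        refine Real.rpow_le_rpow_of_nonpos hhpos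
          (hh_mono (by simp; linarith) (by simp; linarith) hs.1) ?_
        rw [neg_div]
        exact neg_nonpos.2 (by positivity)
    rw [integral_rpow (Or.inl (by linarith [show (0:ℝ) < 1 / n by positivity])),
      sub_add_cancel, neg_div, Real.rpow_neg hhpos.le] at hbound
    simp only [hpow]
    have hk : 0 < h (Y v) ^ ((1:ℝ) / n) := Real.rpow_pos_of_pos hhpos _
    have : n * (w - v) ≤ n * ((Y w ^ ((1:ℝ) / n) - Y v ^ ((1:ℝ) / n)) / h (Y v) ^ ((1:ℝ) / n)) := by
      refine hbound.trans (le_of_eq ?_)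
      field_simp
    have := le_of_mul_le_mul_left this hn0
    rwa [le_div_iff₀ hk, mul_comm] at this

/-- The `n + 1` quantities `X ^ (n - i) * K ^ i`, where `K ^ n = h (X ^ n)`, form a
supersolution of `y_i' = p(t) * y_{i+1}`. -/
theorem exists_supersolution {n : ℕ} (hn : 1 ≤ n) {p : ℝ → ℝ}
    (hp_loc : LocallyIntegrableOn p (Ici 0)) (hp_nonneg : ∀ t, 0 ≤ t → 0 ≤ p t) {h : ℝ → ℝ}
    (hh_mono : MonotoneOn h (Ici 0)) (hh_cont : ContinuousOn h (Ici 0))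
    (hh_pos : ∀ s, 0 < s → 0 < h s)
    (hdiv : ∫⁻ s in Ici (1:ℝ),
        ENNReal.ofReal (h s ^ (-(1:ℝ) / (n:ℝ)) * s ^ ((1:ℝ) / (n:ℝ) - 1)) = ⊤)
    {c : Fin n → ℝ} (hc : ∀ i, 0 ≤ c i) :
    ∃ A : ℕ → ℝ → ℝ, (∀ i t, 0 ≤ t → 0 ≤ A i t) ∧ (∀ i, i ≤ n → MonotoneOn (A i) (Ici 0)) ∧
      (∀ t, 0 ≤ t → A n t = h (A 0 t)) ∧
      ∀ (i : Fin n) t, 0 ≤ t → c i + ∫ τ in (0:ℝ)..t, A (i + 1) τ * p τ ≤ A i t := by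
  set κ : ℝ := h 1 ^ ((1:ℝ) / n) with hκ
  have hκ0 : 0 < κ := Real.rpow_pos_of_pos (hh_pos 1 one_pos) _
  set x₀ : ℝ := 1 + ∑ j, c j / κ ^ (j:ℕ) with hx₀
  have hx₀1 : 1 ≤ x₀ :=
    le_add_of_nonneg_right (Finset.sum_nonneg fun j _ => div_nonneg (hc j) (by positivity))
  obtain ⟨X, hX₀, hXm, hXK⟩ := exists_monotone_profile hn hh_mono hh_cont hh_pos hdiv hx₀1
  set K : ℝ → ℝ := fun v => h (X v ^ n) ^ ((1:ℝ) / n) with hK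
  have hX1 : ∀ v, 0 ≤ v → 1 ≤ X v := fun v hv => hx₀1.trans (hX₀ v hv)
  have hKκ : ∀ v, 0 ≤ v → κ ≤ K v := fun v hv =>
    Real.rpow_le_rpow (hh_pos 1 one_pos).le
      (hh_mono (by simp) (by simp; have := hX1 v hv; positivity) (one_le_pow₀ (hX1 v hv)))
      (by positivity)
  have hKm : MonotoneOn K (Ici 0) := by
    intro v hv w hw hvw
    have h1 := hX1 v hv
    have h2 := hX1 w hw
    refine Real.rpow_le_rpow (hh_pos _ (by positivity)).le
      (hh_mono (by simp; positivity) (by simp; positivity) ?_) (by positivity)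
    exact pow_le_pow_left₀ (by linarith) (hXm hv hw hvw) n
  have hpint : ∀ a b, 0 ≤ a → 0 ≤ b → IntervalIntegrable p volume a b := fun a b ha hb =>
    (hp_loc.integrableOn_compact_subset (fun s hs => (le_min ha hb).trans hs.1)
      isCompact_uIcc).intervalIntegrable
  set σ : ℝ → ℝ := fun t => ∫ τ in (0:ℝ)..t, p τ with hσ
  have hσ0 : ∀ t, 0 ≤ t → 0 ≤ σ t := fun t ht =>
    intervalIntegral.integral_nonneg ht fun τ hτ => hp_nonneg τ hτ.1
  have hσsub : ∀ s r, 0 ≤ s → 0 ≤ r → ∫ τ in s..r, p τ = σ r - σ s := fun s r hs hr =>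
    (intervalIntegral.integral_interval_sub_left (hpint _ _ le_rfl hr) (hpint _ _ le_rfl hs)).symm
  have hσm : MonotoneOn σ (Ici 0) := by
    intro s hs r hr hsr
    rw [← sub_nonneg, ← hσsub s r hs hr]
    exact intervalIntegral.integral_nonneg hsr fun τ hτ => hp_nonneg τ (le_trans hs hτ.1)
  have hX0' : ∀ t, 0 ≤ t → 0 ≤ X (σ t) := fun t ht => by linarith [hX1 _ (hσ0 t ht)]
  have hK0' : ∀ t, 0 ≤ t → 0 ≤ K (σ t) := fun t ht => hκ0.le.trans (hKκ _ (hσ0 t ht))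
  have hA0 : ∀ i t, 0 ≤ t → 0 ≤ X (σ t) ^ (n - i) * K (σ t) ^ i := fun i t ht =>
    mul_nonneg (pow_nonneg (hX0' t ht) _) (pow_nonneg (hK0' t ht) _)
  have hAm : ∀ i, MonotoneOn (fun t => X (σ t) ^ (n - i) * K (σ t) ^ i) (Ici 0) := by
    intro i s hs r hr hsr
    have hσs := hσm hs hr hsr
    refine mul_le_mul
      (pow_le_pow_left₀ (hX0' s hs) (hXm (hσ0 s hs) (hσ0 r hr) hσs) _)
      (pow_le_pow_left₀ (hK0' s hs) (hKm (hσ0 s hs) (hσ0 r hr) hσs) _)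
      (pow_nonneg (hK0' s hs) _) (pow_nonneg (hX0' r hr) _)
  refine ⟨fun i t => X (σ t) ^ (n - i) * K (σ t) ^ i, hA0, fun i _ => hAm i, fun t ht => ?_,
    fun i t ht => ?_⟩
  · have := hX1 _ (hσ0 t ht)
    simp only [Nat.sub_self, pow_zero, one_mul, Nat.sub_zero, mul_one, hK, one_div]
    exact Real.rpow_inv_natCast_pow (hh_pos _ (by positivity)).le (by omega)
  · have hIcc : IntegrableOn p (Icc 0 t) :=
      hp_loc.integrableOn_compact_subset Icc_subset_Ici_self isCompact_Icc
    have hgm := (hAm (i + 1)).mono (Icc_subset_Ici_self : Icc 0 t ⊆ Ici 0)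
    have hgp : IntegrableOn
        (fun s => X (σ s) ^ (n - (i + 1)) * K (σ s) ^ ((i:ℕ) + 1) * p s) (Icc 0 t) := by
      refine hIcc.bdd_mul (c := X (σ t) ^ (n - (i + 1)) * K (σ t) ^ ((i:ℕ) + 1)) ?_ ?_
      · exact (aemeasurable_restrict_of_monotoneOn measurableSet_Icc hgm).aestronglyMeasurable
      · refine (ae_restrict_iff' measurableSet_Icc).2 (Eventually.of_forall fun s hs => ?_)
        rw [Real.norm_of_nonneg (hA0 (i + 1) s hs.1)]
        exact hgm hs (right_mem_Icc.2 ht) hs.2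
    have hmain := integral_mul_le_sub_of_forall_mul_le ht hIcc (fun s hs => hp_nonneg s hs.1)
      hgm hgp (F := fun t => X (σ t) ^ (n - i) * K (σ t) ^ (i:ℕ)) (by
        intro s hs r hr hsr
        have hσs := hσm hs.1 hr.1 hsr
        have hXsr := hXm (hσ0 s hs.1) (hσ0 r hr.1) hσs
        have hKsr := hKm (hσ0 s hs.1) (hσ0 r hr.1) hσs
        have hXs := hX0' s hs.1
        have hXr := hX0' r hr.1
        have hKs := hK0' s hs.1
        have hinc := hXK (σ s) (σ r) (hσ0 s hs.1) hσs
        obtain ⟨m, hm⟩ : ∃ m, n - (i:ℕ) = m + 1 := ⟨n - i - 1, by omega⟩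
        rw [hσsub s r hs.1 hr.1, show n - ((i:ℕ) + 1) = m by omega]
        simp only [hm]
        calc X (σ s) ^ m * K (σ s) ^ ((i:ℕ) + 1) * (σ r - σ s)
            = X (σ s) ^ m * K (σ s) ^ (i:ℕ) * (K (σ s) * (σ r - σ s)) := by ring
          _ ≤ X (σ s) ^ m * K (σ s) ^ (i:ℕ) * (X (σ r) - X (σ s)) := by gcongr
          _ = X (σ s) ^ m * X (σ r) * K (σ s) ^ (i:ℕ) - X (σ s) ^ (m + 1) * K (σ s) ^ (i:ℕ) := by
            ring
          _ ≤ X (σ r) ^ m * X (σ r) * K (σ r) ^ (i:ℕ) - X (σ s) ^ (m + 1) * K (σ s) ^ (i:ℕ) := by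
            gcongr
          _ = _ := by ring)
    have hci : c i ≤ X (σ 0) ^ (n - i) * K (σ 0) ^ (i:ℕ) := by
      have hXx := hX₀ (σ 0) (hσ0 0 le_rfl)
      have hX1' := hX1 (σ 0) (hσ0 0 le_rfl)
      have hKk := hKκ (σ 0) (hσ0 0 le_rfl)
      have hcx : c i / κ ^ (i:ℕ) ≤ x₀ := by
        have := Finset.single_le_sum (f := fun j : Fin n => c j / κ ^ (j:ℕ))
          (fun j _ => div_nonneg (hc j) (by positivity)) (Finset.mem_univ i)
        linarith
      rw [div_le_iff₀ (by positivity)] at hcx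
      refine hcx.trans (mul_le_mul (hXx.trans (le_self_pow₀ hX1' (by omega)))
        (pow_le_pow_left₀ hκ0.le hKk _) (by positivity) (by positivity))
    simp only at hmain ⊢
    linarith

/-- If `q ≥ 0` is locally integrable, `h : [0,∞) → [0,∞)` is non-decreasing
continuous and positive on `(0,∞)`, and `∫_1^∞ h(s)^{-1/n} s^{1/n-1} ds = ∞`, then the
Cauchy problem `u^{(n)} = q(t) h(u)`, `u^{(i)}(0) = cᵢ ≥ 0`, has a global solution. -/
theorem global_solution_reduced_problem
    (n : ℕ) (hn : 1 ≤ n)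
    (q : ℝ → ℝ) (hq_loc : LocallyIntegrableOn q (Ici 0))
    (hq_nonneg : ∀ t, 0 ≤ t → 0 ≤ q t)
    (h : ℝ → ℝ) (hh_mono : MonotoneOn h (Ici 0)) (hh_cont : ContinuousOn h (Ici 0))
    (hh_nonneg : ∀ s, 0 ≤ s → 0 ≤ h s) (hh_pos : ∀ s, 0 < s → 0 < h s)
    (hdiv : ∫⁻ s in Ici (1:ℝ),
        ENNReal.ofReal (h s ^ (-(1:ℝ) / (n:ℝ)) * s ^ ((1:ℝ) / (n:ℝ) - 1)) = ⊤)
    (c : Fin n → ℝ) (hc : ∀ i, 0 ≤ c i) :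
    ∃ u : Fin n → ℝ → ℝ,
      IsSolutionOn n (fun t x => q t * h (x ⟨0, hn⟩)) u (Ici 0) ∧ ∀ i, u i 0 = c i := by
  have hp_loc : LocallyIntegrableOn (fun t => q t + 1) (Ici 0) :=
    hq_loc.add ((locallyIntegrable_const (1:ℝ)).locallyIntegrableOn _)
  obtain ⟨A, hA0, hAm, hAn, hA⟩ := exists_supersolution hn hp_loc
    (fun t ht => by linarith [hq_nonneg t ht]) hh_mono hh_cont hh_pos hdiv hc
  have hqint : ∀ t, 0 ≤ t → IntervalIntegrable q volume 0 t := fun t ht =>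
    (hq_loc.integrableOn_compact_subset (by rw [uIcc_of_le ht]; exact Icc_subset_Ici_self)
      isCompact_uIcc).intervalIntegrable
  have hAint : ∀ i, i ≤ n → ∀ t, 0 ≤ t → IntervalIntegrable (A i) volume 0 t := by
    intro i hi t ht
    refine MonotoneOn.intervalIntegrable ((hAm i hi).mono ?_)
    rw [uIcc_of_le ht]
    exact Icc_subset_Ici_self
  have hAq : ∀ i, i ≤ n → ∀ t, 0 ≤ t →
      IntervalIntegrable (fun τ => A i τ * q τ) volume 0 t := by
    intro i hi t ht
    have hm := (hAm i hi).mono (Ioc_subset_Icc_self.trans Icc_subset_Ici_self : Ioc 0 t ⊆ Ici 0)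
    rw [intervalIntegrable_iff_integrableOn_Ioc_of_le ht]
    refine (hqint t ht).1.bdd_mul (c := A i t)
      (aemeasurable_restrict_of_monotoneOn measurableSet_Ioc hm).aestronglyMeasurable ?_
    refine (ae_restrict_iff' measurableSet_Ioc).2 (Eventually.of_forall fun s hs => ?_)
    rw [Real.norm_of_nonneg (hA0 i s hs.1.le)]
    exact hAm i hi hs.1.le ht hs.2
  let G : Fin n → ℝ → (Fin n → ℝ) → ℝ := fun i τ x =>
    if hi : (i:ℕ) + 1 < n then x ⟨i + 1, hi⟩ else q τ * h (x ⟨0, hn⟩)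
  have hGA : ∀ i : Fin n, (∀ t, 0 ≤ t →
        IntervalIntegrable (fun τ => G i τ fun j => A j τ) volume 0 t) ∧
      ∀ τ, 0 ≤ τ → G i τ (fun j => A j τ) ≤ A (i + 1) τ * (q τ + 1) := by
    intro i
    by_cases hi : (i:ℕ) + 1 < n
    · simp only [G, hi, dif_pos]
      refine ⟨hAint _ hi.le, fun τ hτ => ?_⟩
      nlinarith [mul_nonneg (hA0 (i + 1) τ hτ) (hq_nonneg τ hτ)]
    · have hin : (i:ℕ) + 1 = n := by omega
      simp only [G, hi, dif_neg, not_false_eq_true]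
      refine ⟨fun t ht => ?_, fun τ hτ => ?_⟩
      · refine (hAq n le_rfl t ht).congr fun τ hτ => ?_
        rw [uIoc_of_le ht] at hτ
        simp only [hAn τ hτ.1.le, mul_comm]
      · rw [hin, ← hAn τ hτ]
        nlinarith [hA0 n τ hτ]
  obtain ⟨u, hu⟩ := exists_solution_of_supersolution G c (fun τ j => A j τ) hc
    (by
      intro i v hv hv0
      by_cases hi : (i:ℕ) + 1 < n
      · simp only [G, hi, dif_pos]
        exact (hv _).aestronglyMeasurable
      · simp only [G, hi, dif_neg, not_false_eq_true]
        refine (hq_loc.aestronglyMeasurable).mul (Measurable.aestronglyMeasurable ?_)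
        have hc' : Continuous fun s : ℝ => h (max s 0) :=
          hh_cont.comp_continuous (by fun_prop) fun s => mem_Ici.2 (le_max_right _ _)
        have hmax : ∀ t, max (v t ⟨0, hn⟩) 0 = v t ⟨0, hn⟩ := fun t => max_eq_left (hv0 t _)
        simpa only [Function.comp_def, hmax] using
          hc'.measurable.comp (hv ⟨0, hn⟩))
    (by
      intro i τ hτ x hx z hz hxz
      by_cases hi : (i:ℕ) + 1 < n
      · simpa only [G, hi, dif_pos] using hxz _
      · simp only [G, hi, dif_neg, not_false_eq_true]
        exact mul_le_mul_of_nonneg_left (hh_mono (hx _) (hz _) (hxz _)) (hq_nonneg τ hτ))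
    (by
      intro i τ hτ
      by_cases hi : (i:ℕ) + 1 < n
      · simp only [G, hi, dif_pos]
        fun_prop
      · simp only [G, hi, dif_neg, not_false_eq_true]
        exact continuousOn_const.mul (hh_cont.comp (by fun_prop) fun x hx => hx _))
    (by
      intro i τ hτ x hx
      by_cases hi : (i:ℕ) + 1 < n
      · simp only [G, hi, dif_pos]
        exact hx _
      · simp only [G, hi, dif_neg, not_false_eq_true]
        exact mul_nonneg (hq_nonneg τ hτ) (hh_nonneg _ (hx _)))
    (fun t ht j => hA0 j t ht) (fun i => (hGA i).1)
    (by
      intro i t ht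
      refine le_trans ?_ (hA i t ht)
      refine add_le_add_right (intervalIntegral.integral_mono_on ht ((hGA i).1 t ht) ?_
        fun τ hτ => (hGA i).2 τ hτ.1) _
      simp only [mul_add, mul_one]
      exact (hAq _ i.2 t ht).add (hAint _ i.2 t ht))
  have hu0 : ∀ i, u 0 i = c i := fun i => by simpa using (hu i 0 le_rfl).2
  refine ⟨fun i t => u t i, ⟨fun i hi t ht => ?_, fun t ht => ?_, fun hm t ht => ?_⟩, hu0⟩
  · have := (hu ⟨i, Nat.lt_of_succ_lt hi⟩ t ht).2
    simp only [G, hi, dif_pos] at this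
    beta_reduce
    rw [this, hu0]
  · have := (hu ⟨n - 1, Nat.sub_lt hn Nat.one_pos⟩ t ht).1
    simpa only [G, show ¬ (n - 1 + 1 < n) by omega, dif_neg, not_false_eq_true] using this
  · have := (hu ⟨n - 1, Nat.sub_lt hm Nat.one_pos⟩ t ht).2
    simp only [G, show ¬ (n - 1 + 1 < n) by omega, dif_neg, not_false_eq_true] at this
    beta_reduce
    rw [this, hu0]
end
end

section
/- Let n ≥ 1 be an integer and h : [0,∞) → [0,∞) a non-decreasing continuous function with h(s) > 0 for all s > 0. Let w be a solution of w^{(n)} = h(2w) on [0,∞) with positive initial values w^{(i)}(0) > 0 (i = 0, …, n−1). Then for all 0 ≤ s ≤ t and all i = 0, …, n−1, one has w^{(i)}(t) ≥ Σ_{l=0}^{n−i−1} w^{(i+l)}(s) (t − s)^l / l! + (t − s)^{n−i} h(2 w(s)) / (n−i)!. -/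
open MeasureTheory Set Filter

noncomputable section

/-- A function which is an indefinite integral on `[0, ∞)` is continuous on compact intervals. -/
theorem continuousOn_Icc_of_eq_add_integral {f g : ℝ → ℝ}
    (hf : ∀ t, 0 ≤ t → f t = f 0 + ∫ τ in (0:ℝ)..t, g τ)
    (hg : ∀ t, 0 ≤ t → IntervalIntegrable g volume 0 t) {T : ℝ} (hT : 0 ≤ T) :
    ContinuousOn f (Icc 0 T) := by
  have hprim := intervalIntegral.continuousOn_primitive_interval' (hg T hT) left_mem_uIcc
  rw [uIcc_of_le hT] at hprim
  exact (continuousOn_const.add hprim).congr fun t ht => hf t ht.1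

section IntegralChain

variable {n : ℕ} {g : ℕ → ℝ → ℝ}

/-- In a chain of successive primitives all members are locally integrable. -/
theorem intervalIntegrable_of_integral_chain
    (hg : ∀ i < n, ∀ t, 0 ≤ t → g i t = g i 0 + ∫ τ in (0:ℝ)..t, g (i + 1) τ)
    (hint : ∀ t, 0 ≤ t → IntervalIntegrable (g n) volume 0 t) {i : ℕ} (hi : i ≤ n) :
    ∀ t, 0 ≤ t → IntervalIntegrable (g i) volume 0 t := by
  induction hi using Nat.decreasingInduction with
  | self => exact hint
  | of_succ j hj ih =>
    intro t ht
    refine ContinuousOn.intervalIntegrable ?_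
    rw [uIcc_of_le ht]
    exact continuousOn_Icc_of_eq_add_integral (hg j hj) ih ht

theorem integral_chain_sub
    (hg : ∀ i < n, ∀ t, 0 ≤ t → g i t = g i 0 + ∫ τ in (0:ℝ)..t, g (i + 1) τ)
    (hint : ∀ t, 0 ≤ t → IntervalIntegrable (g n) volume 0 t) {i : ℕ} (hi : i < n)
    {s t : ℝ} (hs : 0 ≤ s) (ht : 0 ≤ t) :
    g i t = g i s + ∫ τ in s..t, g (i + 1) τ := by
  have hint' := intervalIntegrable_of_integral_chain hg hint (Nat.succ_le_of_lt hi)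
  rw [hg i hi t ht, hg i hi s hs, add_assoc,
    intervalIntegral.integral_add_adjacent_intervals (hint' s hs)
      ((hint' s hs).symm.trans (hint' t ht))]

/-- If the last member of the chain is nonnegative on `[0, T)`, every earlier member with
nonnegative initial values stays above its initial value on `[0, T]`. -/
theorem initial_le_of_integral_chain
    (hg : ∀ i < n, ∀ t, 0 ≤ t → g i t = g i 0 + ∫ τ in (0:ℝ)..t, g (i + 1) τ)
    (h0 : ∀ i < n, 0 ≤ g i 0) {T : ℝ} (hn : ∀ t, 0 ≤ t → t < T → 0 ≤ g n t)
    {i : ℕ} (hi : i < n) {t : ℝ} (ht : 0 ≤ t) (htT : t ≤ T) : g i 0 ≤ g i t := by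
  have step : ∀ j < n, (∀ τ, 0 ≤ τ → τ < T → 0 ≤ g (j + 1) τ) →
      ∀ t, 0 ≤ t → t ≤ T → g j 0 ≤ g j t := by
    intro j hj hpos t ht htT
    have hnonneg : 0 ≤ ∫ τ in (0:ℝ)..t, g (j + 1) τ := by
      rw [intervalIntegral.integral_of_le ht, integral_Ioc_eq_integral_Ioo]
      exact setIntegral_nonneg measurableSet_Ioo fun τ hτ => hpos τ hτ.1.le (hτ.2.trans_le htT)
    linarith [hg j hj t ht]
  have nonneg : ∀ j ≤ n, ∀ τ, 0 ≤ τ → τ < T → 0 ≤ g j τ := by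
    intro j hj
    induction hj using Nat.decreasingInduction with
    | self => exact hn
    | of_succ j hj ih =>
      exact fun τ h1 h2 => (h0 j hj).trans (step j hj ih τ h1 h2.le)
  exact step i hi (nonneg _ hi) t ht htT

/-- Taylor lower bound for a chain of successive primitives whose last member is bounded below
on `[s, ∞)` by its value at `s`. -/
theorem taylor_le_of_integral_chain
    (hg : ∀ i < n, ∀ t, 0 ≤ t → g i t = g i 0 + ∫ τ in (0:ℝ)..t, g (i + 1) τ)
    (hint : ∀ t, 0 ≤ t → IntervalIntegrable (g n) volume 0 t) {s : ℝ} (hs : 0 ≤ s)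
    (hn : ∀ t, s ≤ t → g n s ≤ g n t) (k : ℕ) :
    ∀ i, i + k = n → ∀ t, s ≤ t →
      ∑ l ∈ Finset.range (k + 1), g (i + l) s * (t - s) ^ l / (l.factorial : ℝ) ≤ g i t := by
  induction k with
  | zero =>
    rintro i rfl t ht
    simpa using hn t ht
  | succ k ih =>
    intro i hi t ht
    have hin : i < n := by omega
    have hint' := intervalIntegrable_of_integral_chain hg hint (Nat.succ_le_of_lt hin)
    rw [integral_chain_sub hg hint hin hs (hs.trans ht), Finset.sum_range_succ']
    have hmono : ∫ τ in s..t, ∑ l ∈ Finset.range (k + 1),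
        g (i + 1 + l) s * (τ - s) ^ l / (l.factorial : ℝ) ≤ ∫ τ in s..t, g (i + 1) τ := by
      refine intervalIntegral.integral_mono_on ht ?_
        ((hint' s hs).symm.trans (hint' t (hs.trans ht))) fun τ hτ => ih (i + 1) (by omega) τ hτ.1
      exact Continuous.intervalIntegrable (by fun_prop) _ _
    have hcalc : ∫ τ in s..t, ∑ l ∈ Finset.range (k + 1),
          g (i + 1 + l) s * (τ - s) ^ l / (l.factorial : ℝ)
        = ∑ l ∈ Finset.range (k + 1),
          g (i + (l + 1)) s * (t - s) ^ (l + 1) / ((l + 1).factorial : ℝ) := by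
      rw [intervalIntegral.integral_finsetSum
        fun l _ => Continuous.intervalIntegrable (by fun_prop) _ _]
      refine Finset.sum_congr rfl fun l _ => ?_
      rw [intervalIntegral.integral_div, intervalIntegral.integral_const_mul,
        intervalIntegral.integral_comp_sub_right (fun x => x ^ l) s, integral_pow,
        Nat.factorial_succ, show i + 1 + l = i + (l + 1) by ring]
      have : (l.factorial : ℝ) ≠ 0 := by positivity
      push_cast
      simp only [sub_self, ne_eq, Nat.succ_ne_zero, not_false_eq_true, zero_pow, sub_zero]
      field_simp
    rw [hcalc] at hmono
    simp only [add_zero, pow_zero, mul_one, Nat.factorial_zero, Nat.cast_one, div_one]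
    linarith

end IntegralChain

/-- For a global solution `w` of `w^{(n)} = h(2w)` with positive initial
data, for all `0 ≤ s ≤ t` and `i = 0, …, n-1`,
`w^{(i)}(t) ≥ Σ_{l<n-i} w^{(i+l)}(s)(t-s)^l/l! + (t-s)^{n-i} h(2w(s))/(n-i)!`. -/
theorem taylor_lower_estimate
    (n : ℕ) (hn : 1 ≤ n)
    (h : ℝ → ℝ) (hh_mono : MonotoneOn h (Ici 0)) (hh_cont : ContinuousOn h (Ici 0))
    (hh_nonneg : ∀ s, 0 ≤ s → 0 ≤ h s) (hh_pos : ∀ s, 0 < s → 0 < h s)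
    (w : Fin n → ℝ → ℝ)
    (hw : IsSolutionOn n (fun _ x => h (2 * x ⟨0, hn⟩)) w (Ici 0))
    (hw0 : ∀ i, 0 < w i 0) :
    ∀ s t : ℝ, 0 ≤ s → s ≤ t → ∀ i : Fin n,
      w i t ≥ (∑ l : Fin (n - (i : ℕ)),
          w ⟨(i : ℕ) + (l : ℕ), by have := i.isLt; have := l.isLt; omega⟩ s
            * (t - s) ^ (l : ℕ) / ((l : ℕ).factorial : ℝ))
        + (t - s) ^ (n - (i : ℕ)) * h (2 * w ⟨0, hn⟩ s)
            / ((n - (i : ℕ)).factorial : ℝ) := by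
  obtain ⟨hlow, hint, htop⟩ := hw
  set g : ℕ → ℝ → ℝ := fun i τ => if hi : i < n then w ⟨i, hi⟩ τ else h (2 * w ⟨0, hn⟩ τ) with g_def
  have g_lt : ∀ i (hi : i < n), g i = w ⟨i, hi⟩ := fun i hi => by
    funext τ; simp [g_def, hi]
  have g_n : g n = fun τ => h (2 * w ⟨0, hn⟩ τ) := by
    funext τ; simp [g_def]
  have hg : ∀ i < n, ∀ t, 0 ≤ t → g i t = g i 0 + ∫ τ in (0:ℝ)..t, g (i + 1) τ := by
    intro i hi t ht
    rcases Nat.lt_or_ge (i + 1) n with hi' | hi'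
    · rw [g_lt i hi, g_lt (i + 1) hi']
      exact hlow i hi' t ht
    · obtain rfl : n = i + 1 := by omega
      rw [g_n, g_lt i hi]
      exact htop hn t ht
  have hgint : ∀ t, 0 ≤ t → IntervalIntegrable (g n) volume 0 t := by
    rw [g_n]; exact hint
  have g_init : ∀ i < n, 0 < g i 0 := fun i hi => by rw [g_lt i hi]; exact hw0 _
  have g_zero : g 0 = w ⟨0, hn⟩ := g_lt 0 hn
  have g_last_nonneg : ∀ t, 0 ≤ g 0 t → 0 ≤ g n t := fun t ht => by
    rw [g_n]
    rw [g_zero] at ht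
    exact hh_nonneg _ (by positivity)
  have g_zero_pos : ∀ t, 0 ≤ t → 0 < g 0 t := by
    by_contra! ⟨t, ht, hneg⟩
    have hcont : ContinuousOn (g 0) (Icc 0 t) :=
      continuousOn_Icc_of_eq_add_integral (hg 0 hn)
        (intervalIntegrable_of_integral_chain hg hgint hn) ht
    have hcomp : IsCompact (Icc 0 t ∩ g 0 ⁻¹' Iic 0) :=
      isCompact_Icc.of_isClosed_subset (hcont.preimage_isClosed_of_isClosed isClosed_Icc isClosed_Iic)
        inter_subset_left
    obtain ⟨T, ⟨hT, hTneg⟩, hmin⟩ := hcomp.exists_isLeast ⟨t, ⟨ht, le_rfl⟩, hneg⟩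
    have hbefore : ∀ τ, 0 ≤ τ → τ < T → 0 ≤ g n τ := by
      refine fun τ h1 h2 => g_last_nonneg τ ?_
      by_contra! hτ
      exact absurd (hmin ⟨⟨h1, h2.le.trans hT.2⟩, hτ.le⟩) (not_le.mpr h2)
    have := initial_le_of_integral_chain hg (fun i hi => (g_init i hi).le) hbefore hn hT.1 le_rfl
    exact absurd (this.trans hTneg) (not_le.mpr (g_init 0 hn))
  have g_nonneg : ∀ i ≤ n, ∀ t, 0 ≤ t → 0 ≤ g i t := by
    intro i hi t ht
    have hlast : ∀ τ, 0 ≤ τ → 0 ≤ g n τ := fun τ hτ => g_last_nonneg τ (g_zero_pos τ hτ).le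
    rcases hi.lt_or_eq with hi | rfl
    · exact (g_init i hi).le.trans (initial_le_of_integral_chain hg
        (fun i hi => (g_init i hi).le) (fun τ hτ _ => hlast τ hτ) hi ht le_rfl)
    · exact hlast t ht
  intro s t hs hst i
  have hlast : ∀ τ, s ≤ τ → g n s ≤ g n τ := by
    intro τ hτ
    have hpos_s := g_zero_pos s hs
    have hpos_τ := g_zero_pos τ (hs.trans hτ)
    have hle : g 0 s ≤ g 0 τ := by
      rw [integral_chain_sub hg hgint hn hs (hs.trans hτ)]
      exact le_add_of_nonneg_right (intervalIntegral.integral_nonneg hτ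
        fun x hx => g_nonneg _ hn x (hs.trans hx.1))
    rw [g_zero] at hpos_s hpos_τ hle
    rw [g_n]
    exact hh_mono (mem_Ici.mpr (by positivity)) (mem_Ici.mpr (by positivity)) (by linarith)
  have key := taylor_le_of_integral_chain hg hgint hs hlast (n - (i : ℕ)) i (by omega) t hst
  rw [Finset.sum_range_succ, Finset.sum_range, show (i : ℕ) + (n - i) = n by omega, g_n,
    g_lt i i.isLt] at key
  refine ge_iff_le.mpr (le_trans (le_of_eq ?_) key)
  congr 1
  · refine Finset.sum_congr rfl fun l _ => ?_
    rw [g_lt]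
  · ring
end
end

section
/- Let m ≥ 1 be an integer and f : [0,∞) × [0,∞)^m → [0,∞) a non-negative locally Carathéodory function. Suppose there exist an integer k with 0 ≤ k ≤ m−1, a locally integrable function q : [0,∞) → [0,∞), and a real number λ with 0 ≤ λ ≤ 1, such that f(t, x_0, …, x_{m−1}) ≤ q(t) x_k^λ for almost all t ∈ [0,∞) and all x_i ∈ [0,∞). Then for every choice of initial values a_0, …, a_{m−1} ≥ 0 the Cauchy problem w^{(m)} = f(t, w, …, w^{(m−1)}), w^{(i)}(0) = a_i (i = 0, …, m−1), has a global solution on [0,∞). -/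
open MeasureTheory Set Filter

noncomputable section

/-- Nodes of the Euler polygon with step `1 / N` for the field `F` started at `a`. -/
def eulerNode {E : Type*} [NormedAddCommGroup E] [NormedSpace ℝ E]
    (F : ℝ → E → E) (a : E) (N : ℝ) : ℕ → E
  | 0 => a
  | j + 1 => eulerNode F a N j + ∫ s in (j / N)..((j + 1) / N), F s (eulerNode F a N j)

/-- A pointwise bounded sequence of curves with a common modulus of continuity has a pointwise
convergent subsequence. -/
theorem exists_subseq_tendsto_of_common_modulus {E : Type*} [NormedAddCommGroup E] [ProperSpace E]
    {v : ℕ → ℝ → E} {G : ℝ → ℝ} (hG : Continuous G)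
    (hv : ∀ n s t, ‖v n t - v n s‖ ≤ |G t - G s|) {a : E} (h0 : ∀ n, v n 0 = a) :
    ∃ φ : ℕ → ℕ, StrictMono φ ∧ ∃ u : ℝ → E,
      ∀ t, Tendsto (fun n => v (φ n) t) atTop (nhds (u t)) := by
  have hK : IsCompact (Set.pi univ fun r : ℚ => Metric.closedBall a |G r - G 0|) :=
    isCompact_univ_pi fun r => isCompact_closedBall _ _
  have hmem : ∀ n, (fun r : ℚ => v n r) ∈
      Set.pi univ fun r : ℚ => Metric.closedBall a |G r - G 0| := by
    intro n r _
    have := hv n 0 r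
    rwa [h0, ← dist_eq_norm] at this
  obtain ⟨w, -, φ, hφ, hlim⟩ := hK.tendsto_subseq hmem
  rw [tendsto_pi_nhds] at hlim
  have hcau : ∀ t, CauchySeq fun n => v (φ n) t := by
    intro t
    rw [Metric.cauchySeq_iff]
    intro ε hε
    have hopen : IsOpen {x : ℝ | |G t - G x| < ε / 3} :=
      isOpen_lt (by fun_prop) continuous_const
    obtain ⟨r, hr⟩ := Rat.denseRange_cast.exists_mem_open hopen
      ⟨t, by simp only [mem_ofPred_eq, sub_self, abs_zero]; positivity⟩
    obtain ⟨M, hM⟩ := Metric.cauchySeq_iff.1 (hlim r).cauchySeq (ε / 3) (by positivity)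
    refine ⟨M, fun i hi j hj => ?_⟩
    have h1 := hM i hi j hj
    have h2 := hv (φ i) r t
    have h3 := hv (φ j) r t
    rw [← dist_eq_norm] at h2 h3
    rw [dist_comm] at h3
    have h4 := dist_triangle4 (v (φ i) t) (v (φ i) r) (v (φ j) r) (v (φ j) t)
    simp only [Function.comp_apply, mem_ofPred_eq] at h1 hr
    linarith
  choose u hu using fun t => cauchySeq_tendsto_of_complete (hcau t)
  exact ⟨φ, hφ, u, hu⟩

section Caratheodory

variable {E : Type*} [NormedAddCommGroup E] {F : ℝ → E → E} {h : ℝ → ℝ}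

theorem measurable_caratheodory_comp [MeasurableSpace E] [BorelSpace E] [ProperSpace E]
    (hF_meas : ∀ x, Measurable fun t => F t x)
    (hF_cont : ∀ t, Continuous (F t)) {p : ℝ → E} (hp : Measurable p) :
    Measurable fun t => F t (p t) := by
  have : Measurable (Function.uncurry fun (x : E) (t : ℝ) => F t x) :=
    measurable_uncurry_of_continuous_of_measurable hF_cont hF_meas
  exact this.comp (hp.prodMk measurable_id)

theorem intervalIntegrable_caratheodory_comp [MeasurableSpace E] [BorelSpace E] [ProperSpace E]
    (hF_meas : ∀ x, Measurable fun t => F t x)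
    (hF_cont : ∀ t, Continuous (F t)) (hh : ∀ s t, IntervalIntegrable h volume s t)
    (hF_bound : ∀ t x, ‖F t x‖ ≤ h t * (1 + ‖x‖)) {p : ℝ → E} (hp : Measurable p)
    {b : ℝ → ℝ} (hb : Continuous b) (hpb : ∀ t, 1 + ‖p t‖ ≤ b t) (hh0 : ∀ t, 0 ≤ h t) (s t : ℝ) :
    IntervalIntegrable (fun τ => F τ (p τ)) volume s t := by
  refine ((hh s t).mul_continuousOn hb.continuousOn).mono_fun
    (measurable_caratheodory_comp hF_meas hF_cont hp).aestronglyMeasurable (ae_of_all _ fun τ => ?_)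
  refine (hF_bound τ (p τ)).trans (le_trans ?_ (le_abs_self _))
  exact mul_le_mul_of_nonneg_left (hpb τ) (hh0 τ)

theorem one_add_norm_eulerNode_le [NormedSpace ℝ E] (hh : ∀ s t, IntervalIntegrable h volume s t)
    (hF_bound : ∀ t x, ‖F t x‖ ≤ h t * (1 + ‖x‖)) (a : E) {N : ℝ} (hN : 0 < N) (j : ℕ) :
    1 + ‖eulerNode F a N j‖ ≤ (1 + ‖a‖) * Real.exp (∫ s in (0:ℝ)..(j / N), h s) := by
  induction j with
  | zero => simp [eulerNode]
  | succ j ih =>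
    set x := eulerNode F a N j
    have hle : (j : ℝ) / N ≤ (j + 1) / N := by gcongr; linarith
    have h1 : ‖∫ s in (j / N : ℝ)..((j + 1) / N), F s x‖ ≤
        (∫ s in (j / N : ℝ)..((j + 1) / N), h s) * (1 + ‖x‖) := by
      rw [← intervalIntegral.integral_mul_const]
      exact intervalIntegral.norm_integral_le_of_norm_le hle
        (ae_of_all _ fun s _ => hF_bound s x) ((hh _ _).mul_const _)
    have h2 : (∫ s in (0:ℝ)..((j + 1) / N), h s) =
        (∫ s in (0:ℝ)..(j / N), h s) + ∫ s in (j / N : ℝ)..((j + 1) / N), h s :=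
      (intervalIntegral.integral_add_adjacent_intervals (hh _ _) (hh _ _)).symm
    set D := ∫ s in (j / N : ℝ)..((j + 1) / N), h s
    have h3 : ‖eulerNode F a N (j + 1)‖ ≤ ‖x‖ + D * (1 + ‖x‖) :=
      (norm_add_le _ _).trans (by gcongr)
    push_cast
    rw [h2, Real.exp_add, ← mul_assoc]
    calc 1 + ‖eulerNode F a N (j + 1)‖ ≤ (1 + ‖x‖) * (D + 1) := by linarith
      _ ≤ (1 + ‖x‖) * Real.exp D := by gcongr; exact Real.add_one_le_exp D
      _ ≤ _ := by gcongr

/-- The Euler polygon, as the integral of the step-frozen vector field, interpolates its nodes. -/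
theorem integral_eulerNode_floor [NormedSpace ℝ E] (a : E) {N : ℝ} (hN : 0 < N)
    (hint : ∀ s t, IntervalIntegrable (fun τ => F τ (eulerNode F a N ⌊τ * N⌋₊)) volume s t)
    (j : ℕ) :
    a + ∫ s in (0:ℝ)..(j / N), F s (eulerNode F a N ⌊s * N⌋₊) = eulerNode F a N j := by
  induction j with
  | zero => simp [eulerNode]
  | succ j ih =>
    have hle : (j : ℝ) / N ≤ (j + 1) / N := by gcongr; linarith
    push_cast
    rw [← intervalIntegral.integral_add_adjacent_intervals (hint 0 (j / N)) (hint _ _),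
      ← add_assoc, ih, eulerNode]
    congr 1
    refine intervalIntegral.integral_congr_Ioo_of_le hle fun s hs => ?_
    have hfl : ⌊s * N⌋₊ = j := by
      rw [Nat.floor_eq_iff (mul_nonneg ((by positivity : (0:ℝ) ≤ j / N).trans hs.1.le) hN.le)]
      exact ⟨(div_le_iff₀ hN).1 hs.1.le, (lt_div_iff₀ hN).1 hs.2⟩
    simp only [hfl]

/-- Global existence for a Carathéodory differential equation with linear growth. -/
theorem exists_global_solution_of_linear_growth [NormedSpace ℝ E] [ProperSpace E]
    [MeasurableSpace E] [BorelSpace E] (hF_meas : ∀ x, Measurable fun t => F t x)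
    (hF_cont : ∀ t, Continuous (F t)) (hh : ∀ s t, IntervalIntegrable h volume s t)
    (hh0 : ∀ t, 0 ≤ h t) (hF_bound : ∀ t x, ‖F t x‖ ≤ h t * (1 + ‖x‖)) (a : E) :
    ∃ u : ℝ → E, Continuous u ∧ (∀ s t, IntervalIntegrable (fun τ => F τ (u τ)) volume s t) ∧
      ∀ t, 0 ≤ t → u t = a + ∫ τ in (0:ℝ)..t, F τ (u τ) := by
  set H : ℝ → ℝ := fun t => ∫ s in (0:ℝ)..t, h s with hH
  have hHc : Continuous H := intervalIntegral.continuous_primitive hh 0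
  set b : ℝ → ℝ := fun t => (1 + ‖a‖) * Real.exp |H t| with hb
  have hbc : Continuous b := by fun_prop
  have hHmono : Monotone H := fun s t hst => by
    have := intervalIntegral.integral_add_adjacent_intervals (hh 0 s) (hh s t)
    have h' := intervalIntegral.integral_nonneg (μ := volume) hst fun τ _ => hh0 τ
    simp only [hH]; linarith
  set g : ℝ → ℝ := fun t => h t * b t with hg
  have hgi : ∀ s t, IntervalIntegrable g volume s t := fun s t =>
    (hh s t).mul_continuousOn hbc.continuousOn
  set G : ℝ → ℝ := fun t => ∫ s in (0:ℝ)..t, g s with hG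
  have hGc : Continuous G := intervalIntegral.continuous_primitive hgi 0
  set N : ℕ → ℝ := fun n => n + 1
  have hN : ∀ n, 0 < N n := fun n => by positivity
  set p : ℕ → ℝ → E := fun n t => eulerNode F a (N n) ⌊t * N n⌋₊ with hp
  have hpm : ∀ n, Measurable (p n) := fun n =>
    (measurable_from_nat (f := eulerNode F a (N n))).comp
      (Nat.measurable_floor.comp (measurable_id.mul_const _))
  have hpb : ∀ n t, 1 + ‖p n t‖ ≤ b t := by
    intro n t
    refine (one_add_norm_eulerNode_le hh hF_bound a (hN n) _).trans ?_
    simp only [hb]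
    gcongr
    rcases le_total 0 t with ht | ht
    · refine (hHmono ?_).trans (le_abs_self _)
      rw [div_le_iff₀ (hN n)]
      exact Nat.floor_le (mul_nonneg ht (hN n).le)
    · rw [Nat.floor_of_nonpos (mul_nonpos_of_nonpos_of_nonneg ht (hN n).le)]
      simp
  have hFp : ∀ n τ, ‖F τ (p n τ)‖ ≤ g τ := fun n τ =>
    (hF_bound τ _).trans (mul_le_mul_of_nonneg_left (hpb n τ) (hh0 τ))
  have hint : ∀ n s t, IntervalIntegrable (fun τ => F τ (p n τ)) volume s t := fun n =>
    intervalIntegrable_caratheodory_comp hF_meas hF_cont hh hF_bound (hpm n) hbc (hpb n) hh0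
  set v : ℕ → ℝ → E := fun n t => a + ∫ τ in (0:ℝ)..t, F τ (p n τ) with hv
  have hvmod : ∀ n s t, ‖v n t - v n s‖ ≤ |G t - G s| := by
    intro n s t
    simp only [hv, hG, add_sub_add_left_eq_sub]
    rw [intervalIntegral.integral_interval_sub_left (hint n _ _) (hint n _ _),
      intervalIntegral.integral_interval_sub_left (hgi _ _) (hgi _ _)]
    exact intervalIntegral.norm_integral_le_abs_of_norm_le (ae_of_all _ fun τ => hFp n τ)
      (hgi _ _)
  obtain ⟨φ, hφ, u, hu⟩ := exists_subseq_tendsto_of_common_modulus hGc hvmod (a := a)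
    (fun n => by simp [hv])
  have humod : ∀ s t, ‖u t - u s‖ ≤ |G t - G s| := fun s t =>
    le_of_tendsto ((hu t).sub (hu s)).norm (Eventually.of_forall fun n => hvmod _ _ _)
  have huc : Continuous u := by
    rw [continuous_iff_continuousAt]
    intro s
    have h1 : Tendsto (fun t => |G t - G s|) (nhds s) (nhds 0) := by
      have : Continuous fun t => |G t - G s| := by fun_prop
      simpa using this.tendsto s
    exact tendsto_iff_norm_sub_tendsto_zero.2
      (squeeze_zero (fun _ => norm_nonneg _) (fun t => humod s t) h1)
  have hpu : ∀ s, 0 ≤ s → Tendsto (fun n => p (φ n) s) atTop (nhds (u s)) := by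
    intro s hs
    have hNt : Tendsto (fun n => N (φ n)) atTop atTop :=
      (tendsto_atTop_add_const_right _ _ tendsto_natCast_atTop_atTop).comp hφ.tendsto_atTop
    have hfl : Tendsto (fun n => (⌊s * N (φ n)⌋₊ : ℝ) / N (φ n)) atTop (nhds s) :=
      (tendsto_nat_floor_mul_div_atTop hs).comp hNt
    have h1 : Tendsto (fun n => |G ((⌊s * N (φ n)⌋₊ : ℝ) / N (φ n)) - G s|) atTop (nhds 0) := by
      have : Continuous fun t => |G t - G s| := by fun_prop
      simpa [Function.comp_def] using (this.tendsto s).comp hfl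
    have h2 : Tendsto (fun n => p (φ n) s - v (φ n) s) atTop (nhds 0) := by
      refine squeeze_zero_norm (fun n => ?_) h1
      have := hvmod (φ n) s ((⌊s * N (φ n)⌋₊ : ℝ) / N (φ n))
      rwa [show v (φ n) ((⌊s * N (φ n)⌋₊ : ℝ) / N (φ n)) = p (φ n) s from
        integral_eulerNode_floor a (hN _) (hint _) _] at this
    simpa using h2.add (hu s)
  refine ⟨u, huc, intervalIntegrable_caratheodory_comp hF_meas hF_cont hh hF_bound huc.measurable
    (b := fun t => 1 + ‖u t‖) (by fun_prop) (fun _ => le_rfl) hh0, fun t ht => ?_⟩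
  refine tendsto_nhds_unique (hu t) (tendsto_const_nhds.add ?_)
  refine intervalIntegral.tendsto_integral_filter_of_dominated_convergence g
    (Eventually.of_forall fun n =>
      (measurable_caratheodory_comp hF_meas hF_cont (hpm _)).aestronglyMeasurable)
    (Eventually.of_forall fun n => ae_of_all _ fun τ _ => hFp _ τ) (hgi _ _)
    (ae_of_all _ fun τ hτ => ?_)
  rw [uIoc_of_le ht] at hτ
  exact ((hF_cont τ).tendsto _).comp (hpu τ hτ.1.le)

end Caratheodory

/-- If the locally Carathéodory nonnegative right-hand side `f` satisfies
`f (t, x₀, …, x_{m-1}) ≤ q(t) x_k^λ` with `0 ≤ λ ≤ 1`, then the Cauchy problem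
`w^{(m)} = f (t, w, …, w^{(m-1)})`, `w^{(i)}(0) = aᵢ ≥ 0`, has a global solution. -/
theorem global_solution_sublinear_power
    (m k : ℕ) (hm : 1 ≤ m) (hk : k < m)
    (f : ℝ → (Fin m → ℝ) → ℝ)
    (hf_car : IsLocallyCaratheodory m f)
    (hf_nonneg : ∀ t, 0 ≤ t → ∀ x : Fin m → ℝ, (∀ i, 0 ≤ x i) → 0 ≤ f t x)
    (q : ℝ → ℝ) (hq_loc : LocallyIntegrableOn q (Ici 0))
    (hq_nonneg : ∀ t, 0 ≤ t → 0 ≤ q t)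
    (lam : ℝ) (hlam0 : 0 ≤ lam) (hlam1 : lam ≤ 1)
    (hbound : ∀ᵐ t ∂(volume.restrict (Ici (0:ℝ))),
      ∀ x : Fin m → ℝ, (∀ i, 0 ≤ x i) → f t x ≤ q t * x ⟨k, hk⟩ ^ lam)
    (a : Fin m → ℝ) (ha : ∀ i, 0 ≤ a i) :
    ∃ u : Fin m → ℝ → ℝ, IsSolutionOn m f u (Ici 0) ∧ ∀ i, u i 0 = a i := by
  obtain ⟨hf_meas, hf_cont, -⟩ := hf_car
  have hae : ∀ᵐ t ∂(volume.restrict (Ici (0:ℝ))), (Continuous fun x => f t x) ∧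
      ∀ x : Fin m → ℝ, (∀ i, 0 ≤ x i) → f t x ≤ q t * x ⟨k, hk⟩ ^ lam := hf_cont.and hbound
  obtain ⟨A, hAsub, hAmeas, hAnull⟩ := exists_measurable_superset_of_null (ae_iff.1 hae)
  rw [Measure.restrict_apply hAmeas] at hAnull
  set S : Set ℝ := Ici 0 \ A
  have hSm : MeasurableSet S := measurableSet_Ici.diff hAmeas
  have hSgood : ∀ t ∈ S, 0 ≤ t ∧ (Continuous fun x => f t x) ∧
      ∀ x : Fin m → ℝ, (∀ i, 0 ≤ x i) → f t x ≤ q t * x ⟨k, hk⟩ ^ lam := by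
    intro t ht
    refine ⟨ht.1, ?_⟩
    by_contra hcon
    exact ht.2 (hAsub hcon)
  have hSae : ∀ᵐ t, 0 ≤ t → t ∈ S := by
    refine (measure_eq_zero_iff_ae_notMem.1 hAnull).mono fun t ht h0 => ⟨h0, fun hA => ht ⟨hA, h0⟩⟩
  set f₀ : ℝ → (Fin m → ℝ) → ℝ := fun t x => S.indicator (fun t => f t fun j => max (x j) 0) t
    with hf₀
  set F : ℝ → (Fin m → ℝ) → Fin m → ℝ := fun t x i =>
    if hi : (i : ℕ) + 1 < m then max (x ⟨i + 1, hi⟩) 0 else f₀ t x with hF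
  set h : ℝ → ℝ := fun t => 1 + (Ici (0:ℝ)).indicator q t with hh_def
  have hind : ∀ t, 0 ≤ (Ici (0:ℝ)).indicator q t := indicator_nonneg fun t ht => hq_nonneg t ht
  have hh : ∀ s t, IntervalIntegrable h volume s t := by
    intro s t
    refine intervalIntegrable_const.add (intervalIntegrable_iff.2 ?_)
    rw [IntegrableOn, integrable_indicator_iff measurableSet_Ici, IntegrableOn,
      Measure.restrict_restrict measurableSet_Ici]
    refine (hq_loc.integrableOn_compact_subset (t := Icc 0 (max s t)) (fun τ hτ => hτ.1)
      isCompact_Icc).mono_set fun τ hτ => ⟨hτ.1, hτ.2.2⟩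
  have hf₀_nonneg : ∀ t x, 0 ≤ f₀ t x := fun t x =>
    indicator_nonneg (fun t ht => hf_nonneg t ht.1 _ fun i => le_max_right _ _) t
  have hF_nonneg : ∀ t x i, 0 ≤ F t x i := by
    intro t x i
    simp only [hF]
    split_ifs
    · exact le_max_right _ _
    · exact hf₀_nonneg t x
  have hpos_le : ∀ (x : Fin m → ℝ) i, max (x i) 0 ≤ ‖x‖ := fun x i =>
    max_le ((le_abs_self _).trans (norm_le_pi_norm x i)) (norm_nonneg _)
  have hF_bound : ∀ t x, ‖F t x‖ ≤ h t * (1 + ‖x‖) := by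
    intro t x
    have hx := norm_nonneg x
    have hq0 := hind t
    refine (pi_norm_le_iff_of_nonneg (by positivity)).2 fun i => ?_
    rw [Real.norm_of_nonneg (hF_nonneg t x i)]
    simp only [hF, hh_def]
    split_ifs with hi
    · nlinarith [hpos_le x ⟨i + 1, hi⟩, mul_nonneg hq0 hx]
    · by_cases ht : t ∈ S
      · have hy := le_max_right (x ⟨k, hk⟩) 0
        have hpow : max (x ⟨k, hk⟩) 0 ^ lam ≤ 1 + ‖x‖ := by
          rcases le_total (max (x ⟨k, hk⟩) 0) 1 with h1 | h1
          · linarith [Real.rpow_le_one hy h1 hlam0]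
          · have := Real.rpow_le_rpow_of_exponent_le h1 hlam1
            rw [Real.rpow_one] at this
            linarith [hpos_le x ⟨k, hk⟩]
        have := (hSgood t ht).2.2 (fun j => max (x j) 0) fun i => le_max_right _ _
        have h2 := mul_le_mul_of_nonneg_left hpow (hq_nonneg t ht.1)
        rw [indicator_of_mem (show t ∈ Ici (0:ℝ) from ht.1)]
        simp only [hf₀, indicator_of_mem ht]
        linarith
      · simp only [hf₀, indicator_of_notMem ht]
        positivity
  have hF_meas : ∀ x, Measurable fun t => F t x := by
    intro x
    refine measurable_pi_lambda _ fun i => ?_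
    simp only [hF]
    split_ifs
    · exact measurable_const
    · exact (hf_meas _).indicator hSm
  have hF_cont : ∀ t, Continuous (F t) := by
    intro t
    refine continuous_pi fun i => ?_
    simp only [hF]
    split_ifs
    · fun_prop
    · by_cases ht : t ∈ S
      · simp only [hf₀, indicator_of_mem ht]
        exact (hSgood t ht).2.1.comp (by fun_prop)
      · simp only [hf₀, indicator_of_notMem ht]
        exact continuous_const
  obtain ⟨u, -, hui, hu⟩ := exists_global_solution_of_linear_growth hF_meas hF_cont hh
    (fun t => add_nonneg zero_le_one (hind t)) hF_bound a
  have hui' : ∀ i s t, IntervalIntegrable (fun τ => F τ (u τ) i) volume s t := fun i s t =>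
    ⟨(ContinuousLinearMap.proj (R := ℝ) (φ := fun _ : Fin m => ℝ) i).integrable_comp (hui s t).1,
      (ContinuousLinearMap.proj (R := ℝ) (φ := fun _ : Fin m => ℝ) i).integrable_comp (hui s t).2⟩
  have hcoord : ∀ i t, 0 ≤ t → u t i = a i + ∫ τ in (0:ℝ)..t, F τ (u τ) i := by
    intro i t ht
    have h1 := (ContinuousLinearMap.proj (R := ℝ) (φ := fun _ : Fin m => ℝ) i
      ).intervalIntegral_comp_comm (hui 0 t)
    simp only [ContinuousLinearMap.proj_apply] at h1
    rw [h1, ← Pi.add_apply, ← hu t ht]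
  have hu0 : ∀ i, u 0 i = a i := fun i => by simpa using hcoord i 0 le_rfl
  have hu_nonneg : ∀ i t, 0 ≤ t → 0 ≤ u t i := fun i t ht => by
    rw [hcoord i t ht]
    exact add_nonneg (ha i) (intervalIntegral.integral_nonneg ht fun τ _ => hF_nonneg _ _ _)
  have hmlast : ¬ (m - 1 + 1 < m) := by omega
  have hlast : ∀ t, 0 ≤ t → ∀ᵐ τ, τ ∈ uIoc 0 t →
      F τ (u τ) ⟨m - 1, Nat.sub_lt hm Nat.one_pos⟩ = f τ fun j => u τ j := by
    intro t ht
    filter_upwards [hSae] with τ hτ hmem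
    rw [uIoc_of_le ht] at hmem
    have h0 := hmem.1.le
    simp only [hF, hf₀, dif_neg hmlast, indicator_of_mem (hτ h0),
      max_eq_left (hu_nonneg _ τ h0)]
  refine ⟨fun i t => u t i, ⟨fun i hi t ht => ?_, fun t ht => ?_, fun hm' t ht => ?_⟩, hu0⟩
  · beta_reduce
    rw [hu0, hcoord _ t ht]
    congr 1
    refine intervalIntegral.integral_congr fun τ hτ => ?_
    rw [uIcc_of_le ht] at hτ
    simp only [hF, dif_pos hi, max_eq_left (hu_nonneg _ τ hτ.1)]
  · exact (hui' ⟨m - 1, Nat.sub_lt hm Nat.one_pos⟩ 0 t).congr_ae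
      ((ae_restrict_iff' measurableSet_uIoc).2 (hlast t ht))
  · beta_reduce
    rw [hu0, hcoord _ t ht]
    congr 1
    exact intervalIntegral.integral_congr_ae (hlast t ht)
end
end

section
/- Let n ≥ 1 be an integer and g : (0,∞) → (0,∞) a non-decreasing continuous function. Let u be a positive solution of (d/dt) u^{1/n}(t) = g^{1/n}(u(t)) on [0,T), let β = 1/(1 + 2^n), and let 0 < t < T be such that u(0) ≥ β u(t). Then u(t) − u(t/2) ≥ (1/(1 + 2^n)) ∫_0^t (t − τ)^{n−1} g(β u(τ)) dτ. -/
open MeasureTheory Set Filter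

noncomputable section

/-- If `u > 0` and `u^{1/n}(s) = u^{1/n}(0) + ∫_0^s h` with `h ≥ 0`, then `u` is
non-decreasing. -/
theorem monotoneOn_of_rpow_eq_integral {n : ℕ} (hn : 1 ≤ n) {T : ℝ} {u h : ℝ → ℝ}
    (hu_pos : ∀ s ∈ Ico (0:ℝ) T, 0 < u s) (hh : ∀ s ∈ Ico (0:ℝ) T, 0 ≤ h s)
    (hint : ∀ s ∈ Ico (0:ℝ) T, IntervalIntegrable h volume 0 s)
    (hsol : ∀ s ∈ Ico (0:ℝ) T,
      u s ^ ((1:ℝ) / n) = u 0 ^ ((1:ℝ) / n) + ∫ τ in (0:ℝ)..s, h τ) :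
    MonotoneOn u (Ico 0 T) := by
  intro a ha b hb hab
  have hsub : ∫ τ in a..b, h τ = (∫ τ in (0:ℝ)..b, h τ) - ∫ τ in (0:ℝ)..a, h τ :=
    (intervalIntegral.integral_interval_sub_left (hint b hb) (hint a ha)).symm
  have hnonneg : 0 ≤ ∫ τ in a..b, h τ :=
    intervalIntegral.integral_nonneg hab fun x hx =>
      hh x ⟨ha.1.trans hx.1, hx.2.trans_lt hb.2⟩
  have hroot : u a ^ ((1:ℝ) / n) ≤ u b ^ ((1:ℝ) / n) := by
    rw [hsol a ha, hsol b hb]; linarith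
  have hn' : (0:ℝ) < 1 / n := by
    have : (0:ℝ) < n := by exact_mod_cast hn
    positivity
  exact (Real.rpow_le_rpow_iff (hu_pos a ha).le (hu_pos b hb).le hn').1 hroot

/-- If `u^{1/n}(s) = u^{1/n}(0) + ∫_0^s h` and `h ≥ c^{1/n}` on `[a,b]`, then
`u(b) - u(a) ≥ (b-a)^n c`. -/
theorem pow_mul_le_sub_of_rpow_eq_integral {n : ℕ} (hn : 1 ≤ n) {T : ℝ} {u h : ℝ → ℝ}
    (hu_pos : ∀ s ∈ Ico (0:ℝ) T, 0 < u s)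
    (hint : ∀ s ∈ Ico (0:ℝ) T, IntervalIntegrable h volume 0 s)
    (hsol : ∀ s ∈ Ico (0:ℝ) T,
      u s ^ ((1:ℝ) / n) = u 0 ^ ((1:ℝ) / n) + ∫ τ in (0:ℝ)..s, h τ)
    {a b c : ℝ} (ha : a ∈ Ico 0 T) (hb : b ∈ Ico 0 T) (hab : a ≤ b) (hc : 0 ≤ c)
    (hch : ∀ s ∈ Icc a b, c ^ ((1:ℝ) / n) ≤ h s) :
    (b - a) ^ n * c ≤ u b - u a := by
  have hn0 : n ≠ 0 := by omega
  have hsub : ∫ τ in a..b, h τ = (∫ τ in (0:ℝ)..b, h τ) - ∫ τ in (0:ℝ)..a, h τ :=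
    (intervalIntegral.integral_interval_sub_left (hint b hb) (hint a ha)).symm
  have hlow : (b - a) * c ^ ((1:ℝ) / n) ≤ ∫ τ in a..b, h τ := by
    have := intervalIntegral.integral_mono_on hab intervalIntegrable_const
      ((hint a ha).symm.trans (hint b hb)) hch
    simpa using this
  have hroot : u a ^ ((1:ℝ) / n) + (b - a) * c ^ ((1:ℝ) / n) ≤ u b ^ ((1:ℝ) / n) := by
    rw [hsol a ha, hsol b hb]; linarith
  have hpow : ∀ x : ℝ, 0 ≤ x → (x ^ ((1:ℝ) / n)) ^ n = x := fun x hx => by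
    rw [one_div, Real.rpow_inv_natCast_pow hx hn0]
  have hw : 0 ≤ u a ^ ((1:ℝ) / n) := Real.rpow_nonneg (hu_pos a ha).le _
  have hd : 0 ≤ (b - a) * c ^ ((1:ℝ) / n) :=
    mul_nonneg (sub_nonneg.2 hab) (Real.rpow_nonneg hc _)
  have hsum := (pow_add_pow_le hw hd hn0).trans (pow_le_pow_left₀ (add_nonneg hw hd) hroot n)
  rw [mul_pow, hpow _ hc, hpow _ (hu_pos a ha).le, hpow _ (hu_pos b hb).le] at hsum
  linarith

/-- If `f ≤ C` in absolute value on `(0,t]`, then `∫_0^t (t-τ)^{n-1} f(τ) dτ ≤ t^n C`. -/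
theorem integral_sub_pow_mul_le {n : ℕ} (hn : 1 ≤ n) {t C : ℝ} (ht : 0 ≤ t) {f : ℝ → ℝ}
    (hf : ∀ τ ∈ Ioc 0 t, |f τ| ≤ C) :
    ∫ τ in (0:ℝ)..t, (t - τ) ^ (n - 1) * f τ ≤ t ^ n * C := by
  have hb : ‖∫ τ in (0:ℝ)..t, (t - τ) ^ (n - 1) * f τ‖ ≤ t ^ (n - 1) * C * |t - 0| := by
    refine intervalIntegral.norm_integral_le_of_norm_le_const fun τ hτ => ?_
    rw [uIoc_of_le ht] at hτ
    have h0 : 0 ≤ t - τ := sub_nonneg.2 hτ.2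
    rw [norm_mul, Real.norm_of_nonneg (pow_nonneg h0 _), Real.norm_eq_abs]
    exact mul_le_mul (pow_le_pow_left₀ h0 (by linarith [hτ.1]) _) (hf τ hτ) (abs_nonneg _)
      (pow_nonneg ht _)
  refine (Real.le_norm_self _).trans (hb.trans_eq ?_)
  rw [sub_zero, abs_of_nonneg ht, mul_right_comm, pow_sub_one_mul (by omega)]

/-- Let `u` be a positive solution of `(u^{1/n})' = g(u)^{1/n}` on `[0,T)`,
let `β = 1/(1+2^n)`, and let `0 < t < T` be such that `u(0) ≥ β u(t)`.  Then
`u(t) - u(t/2) ≥ (1/(1+2^n)) ∫_0^t (t-τ)^{n-1} g(β u(τ)) dτ`. -/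
theorem base_case_lower_bound
    (n : ℕ) (hn : 1 ≤ n) (T : ℝ) (hT : 0 < T)
    (g : ℝ → ℝ) (hg_pos : ∀ s, 0 < s → 0 < g s)
    (hg_mono : MonotoneOn g (Ioi 0)) (hg_cont : ContinuousOn g (Ioi 0))
    (u : ℝ → ℝ) (hu_pos : ∀ t ∈ Ico (0:ℝ) T, 0 < u t)
    (hu_int : ∀ t ∈ Ico (0:ℝ) T,
      IntervalIntegrable (fun τ => g (u τ) ^ ((1:ℝ) / n)) volume 0 t)
    (hu_sol : ∀ t ∈ Ico (0:ℝ) T,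
      u t ^ ((1:ℝ) / n) = u 0 ^ ((1:ℝ) / n) + ∫ τ in (0:ℝ)..t, g (u τ) ^ ((1:ℝ) / n))
    (t : ℝ) (ht0 : 0 < t) (htT : t < T)
    (hinit : u 0 ≥ 1 / (1 + 2 ^ n) * u t) :
    u t - u (t / 2) ≥ (1 / (1 + 2 ^ n)) *
      ∫ τ in (0:ℝ)..t, (t - τ) ^ (n - 1) * g (1 / (1 + 2 ^ n) * u τ) := by
  have hrpow : ∀ s ∈ Ico (0:ℝ) T, 0 ≤ g (u s) ^ ((1:ℝ) / n) := fun s hs =>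
    Real.rpow_nonneg (hg_pos _ (hu_pos s hs)).le _
  have hmono := monotoneOn_of_rpow_eq_integral hn hu_pos hrpow hu_int hu_sol
  have h0 : (0:ℝ) ∈ Ico 0 T := ⟨le_rfl, hT⟩
  have ht : t ∈ Ico 0 T := ⟨ht0.le, htT⟩
  have ht2 : t / 2 ∈ Ico 0 T := ⟨by linarith, by linarith⟩
  have hβ : (0:ℝ) < 1 / (1 + 2 ^ n) := by positivity
  have hg0 : 0 < g (u 0) := hg_pos _ (hu_pos 0 h0)
  have hlow : (t - t / 2) ^ n * g (u 0) ≤ u t - u (t / 2) := by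
    refine pow_mul_le_sub_of_rpow_eq_integral hn hu_pos hu_int hu_sol ht2 ht (by linarith)
      hg0.le fun s hs => ?_
    have hs' : s ∈ Ico 0 T := ⟨ht2.1.trans hs.1, hs.2.trans_lt htT⟩
    exact Real.rpow_le_rpow hg0.le
      (hg_mono (hu_pos 0 h0) (hu_pos s hs') (hmono h0 hs' hs'.1)) (by positivity)
  have hup : ∫ τ in (0:ℝ)..t, (t - τ) ^ (n - 1) * g (1 / (1 + 2 ^ n) * u τ)
      ≤ t ^ n * g (u 0) := by
    refine integral_sub_pow_mul_le hn ht0.le fun τ hτ => ?_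
    have hτ' : τ ∈ Ico 0 T := ⟨hτ.1.le, hτ.2.trans_lt htT⟩
    have hpos : 0 < 1 / (1 + 2 ^ n) * u τ := mul_pos hβ (hu_pos τ hτ')
    rw [abs_of_pos (hg_pos _ hpos)]
    exact hg_mono hpos (hu_pos 0 h0)
      ((mul_le_mul_of_nonneg_left (hmono hτ' ht hτ.2) hβ.le).trans hinit)
  have hβ2 : (1:ℝ) / (1 + 2 ^ n) ≤ 1 / 2 ^ n :=
    one_div_le_one_div_of_le (by positivity) (by linarith)
  calc (1 / (1 + 2 ^ n)) * ∫ τ in (0:ℝ)..t, (t - τ) ^ (n - 1) * g (1 / (1 + 2 ^ n) * u τ)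
      ≤ 1 / 2 ^ n * (t ^ n * g (u 0)) :=
        (mul_le_mul_of_nonneg_left hup hβ.le).trans
          (mul_le_mul_of_nonneg_right hβ2 (by positivity))
    _ = (t - t / 2) ^ n * g (u 0) := by
        rw [sub_half, div_pow]; ring
    _ ≤ u t - u (t / 2) := hlow
end
end
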